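/- For every β ∈ (0,∞), the fractionally integrated Brownian motion Y^β satisfies e_n(Y^β) ~ π^{−(β+1)} · (β+1)^{β+1/2} · ((2β+2)/(2β+1))^{1/2} · (log n)^{−(β+1/2)} as n → ∞. -/

import Mathlib

open MeasureTheory ProbabilityTheory Filter Real
open scoped RealInnerProductSpace NNReal

/-- Lebesgue measure on `[0,1]`. -/
noncomputable def μ01 : MeasureTheory.Measure ℝ := MeasureTheory.volume.restrict (Set.Icc (0:ℝ) 1)

/-- The covariance kernel of the fractionally integrated Brownian motion
`Y^β_t = (1/Γ(β)) ∫₀^t (t-s)^{β-1} W_s ds`: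
`E(Y^β_s Y^β_t) = Γ(β)^{-2} ∫₀^s ∫₀^t (s-u)^{β-1} (t-v)^{β-1} (u ∧ v) dv du`. -/
noncomputable def fibmKernel (β : ℝ) (s t : ℝ) : ℝ :=
  (Real.Gamma β)⁻¹ ^ 2 *
    ∫ u in (0:ℝ)..s, (∫ v in (0:ℝ)..t, (s - u) ^ (β - 1) * (t - v) ^ (β - 1) * min u v)

/-- The minimal `n`-th `L²`-quantization error of an `H`-valued random vector `X`. -/
noncomputable def quantErr {H : Type*} [NormedAddCommGroup H] [InnerProductSpace ℝ H]
    {Ω : Type*} [MeasurableSpace Ω] (P : Measure Ω) (X : Ω → H) (n : ℕ) : ℝ :=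
  sInf { r : ℝ | ∃ α : Finset H, α.Nonempty ∧ α.card ≤ n ∧
    r = (∫ ω, sInf ((fun a => ‖X ω - a‖ ^ 2) '' (α : Set H)) ∂P) ^ (1/2 : ℝ) }

namespace FracBM

section Distortion

variable {H : Type*} [NormedAddCommGroup H]
variable {Ω : Type*} [MeasurableSpace Ω] {P : Measure Ω} {X Z : Ω → H}

/-- Squared distance from `x` to the codebook `α`. -/
noncomputable def minSq (α : Finset H) (x : H) : ℝ :=
  sInf ((fun a => ‖x - a‖ ^ 2) '' (α : Set H))

lemma minSq_eq_inf' {α : Finset H} (hα : α.Nonempty) (x : H) :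
    minSq α x = α.inf' hα fun a => ‖x - a‖ ^ 2 :=
  (Finset.inf'_eq_csInf_image α hα fun a => ‖x - a‖ ^ 2).symm

lemma minSq_le {α : Finset H} {a : H} (ha : a ∈ α) (x : H) : minSq α x ≤ ‖x - a‖ ^ 2 := by
  rw [minSq_eq_inf' ⟨a, ha⟩]
  exact Finset.inf'_le _ ha

lemma exists_minSq_eq {α : Finset H} (hα : α.Nonempty) (x : H) :
    ∃ a ∈ α, minSq α x = ‖x - a‖ ^ 2 := by
  rw [minSq_eq_inf' hα]
  exact Finset.exists_mem_eq_inf' hα _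

lemma minSq_nonneg (α : Finset H) (x : H) : 0 ≤ minSq α x := by
  apply Real.sInf_nonneg
  rintro _ ⟨a, -, rfl⟩
  positivity

lemma continuous_minSq (α : Finset H) : Continuous (minSq α) := by
  rcases α.eq_empty_or_nonempty with rfl | hα
  · have : minSq (∅ : Finset H) = fun _ => 0 := by ext; simp [minSq]
    rw [this]
    exact continuous_const
  · rw [funext (minSq_eq_inf' hα)]
    exact Continuous.finset_inf'_apply hα fun a _ => by fun_prop

lemma integrable_norm_sub_sq [IsFiniteMeasure P] (hX : MemLp X 2 P) (a : H) :
    Integrable (fun ω => ‖X ω - a‖ ^ 2) P :=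
  (hX.sub (memLp_const a)).integrable_norm_pow two_ne_zero

lemma integrable_minSq [IsFiniteMeasure P] (hX : MemLp X 2 P) {α : Finset H}
    (hα : α.Nonempty) : Integrable (fun ω => minSq α (X ω)) P := by
  obtain ⟨a, ha⟩ := hα
  refine (integrable_norm_sub_sq hX a).mono
    ((continuous_minSq α).comp_aestronglyMeasurable hX.1) (ae_of_all _ fun ω => ?_)
  rw [Real.norm_of_nonneg (minSq_nonneg _ _), Real.norm_of_nonneg (by positivity)]
  exact minSq_le ha _

/-- Distortion-rate function for codebooks of at most `exp R` elements. -/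
noncomputable def distortion (P : Measure Ω) (X : Ω → H) (R : ℝ) : ℝ :=
  sInf {r : ℝ | ∃ α : Finset H, α.Nonempty ∧ (α.card : ℝ) ≤ exp R ∧
    r = ∫ ω, minSq α (X ω) ∂P}

lemma distortion_nonneg (R : ℝ) : 0 ≤ distortion P X R := by
  apply Real.sInf_nonneg
  rintro _ ⟨α, -, -, rfl⟩
  exact integral_nonneg fun ω => minSq_nonneg _ _

lemma distortion_le {R : ℝ} {α : Finset H} (hα : α.Nonempty) (hc : (α.card : ℝ) ≤ exp R) :
    distortion P X R ≤ ∫ ω, minSq α (X ω) ∂P := by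
  refine csInf_le ⟨0, ?_⟩ ⟨α, hα, hc, rfl⟩
  rintro _ ⟨α, -, -, rfl⟩
  exact integral_nonneg fun ω => minSq_nonneg _ _

lemma le_distortion {R c : ℝ} (hR : 0 ≤ R)
    (h : ∀ α : Finset H, α.Nonempty → (α.card : ℝ) ≤ exp R → c ≤ ∫ ω, minSq α (X ω) ∂P) :
    c ≤ distortion P X R := by
  refine le_csInf ⟨_, {0}, by simp, by simpa using hR, rfl⟩ ?_
  rintro _ ⟨α, h1, h2, rfl⟩
  exact h α h1 h2

lemma exists_code_lt {R c : ℝ} (hR : 0 ≤ R) (h : distortion P X R < c) :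
    ∃ α : Finset H, α.Nonempty ∧ (α.card : ℝ) ≤ exp R ∧ ∫ ω, minSq α (X ω) ∂P < c := by
  by_contra! hc
  exact absurd (le_distortion hR hc) (not_le.2 h)

lemma quantErr_eq_sqrt_distortion [InnerProductSpace ℝ H] {n : ℕ} (hn : 1 ≤ n) :
    quantErr P X n = √(distortion P X (log n)) := by
  have hn0 : (0 : ℝ) < n := by exact_mod_cast hn
  have hlog : 0 ≤ log n := log_nonneg (by exact_mod_cast hn)
  have key : ∀ α : Finset H, α.card ≤ n ↔ (α.card : ℝ) ≤ exp (log n) := fun α => by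
    rw [exp_log hn0, Nat.cast_le]
  apply le_antisymm
  · apply Real.le_sqrt_of_sq_le
    refine le_distortion hlog fun α h1 h2 => ?_
    have h3 : quantErr P X n ≤ (∫ ω, minSq α (X ω) ∂P) ^ (1 / 2 : ℝ) := by
      refine csInf_le ⟨0, ?_⟩ ⟨α, h1, (key α).2 h2, rfl⟩
      rintro _ ⟨α, -, -, rfl⟩
      exact rpow_nonneg (integral_nonneg fun ω => minSq_nonneg α (X ω)) _
    have h4 : 0 ≤ quantErr P X n := by
      apply Real.sInf_nonneg
      rintro _ ⟨α, -, -, rfl⟩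
      exact rpow_nonneg (integral_nonneg fun ω => minSq_nonneg α (X ω)) _
    rw [← Real.sqrt_eq_rpow] at h3
    exact (Real.le_sqrt h4 (integral_nonneg fun ω => minSq_nonneg _ _)).1 h3
  · refine le_csInf ⟨_, {0}, by simp, by simpa using hn, rfl⟩ ?_
    rintro _ ⟨α, h1, h2, rfl⟩
    rw [← Real.sqrt_eq_rpow]
    exact Real.sqrt_le_sqrt (distortion_le h1 ((key α).1 h2))

lemma distortion_add_le [IsFiniteMeasure P] (hX : MemLp X 2 P) (hZ : MemLp Z 2 P)
    {R S η : ℝ} (hR : 0 ≤ R) (hS : 0 ≤ S) (hη : 0 < η) :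
    distortion P (fun ω => X ω + Z ω) (R + S) ≤
      (1 + η) * distortion P X R + (1 + 1 / η) * distortion P Z S := by
  classical
  apply le_of_forall_pos_le_add
  intro ε hε
  set δ : ℝ := ε / (2 + η + 1 / η) with hδ
  have hδ0 : 0 < δ := by positivity
  obtain ⟨α, hα, hαc, hαi⟩ := exists_code_lt hR (lt_add_of_pos_right (distortion P X R) hδ0)
  obtain ⟨γ, hγ, hγc, hγi⟩ := exists_code_lt hS (lt_add_of_pos_right (distortion P Z S) hδ0)
  have hcard : ((Finset.image₂ (· + ·) α γ).card : ℝ) ≤ exp (R + S) := by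
    rw [exp_add]
    calc ((Finset.image₂ (· + ·) α γ).card : ℝ) ≤ α.card * γ.card := by
          exact_mod_cast Finset.card_image₂_le _ _ _
      _ ≤ _ := by gcongr
  have hle : ∫ ω, minSq (Finset.image₂ (· + ·) α γ) (X ω + Z ω) ∂P ≤
      ∫ ω, ((1 + η) * minSq α (X ω) + (1 + 1 / η) * minSq γ (Z ω)) ∂P := by
    refine integral_mono (integrable_minSq (hX.add hZ) (hα.image₂ hγ))
      (((integrable_minSq hX hα).const_mul _).add ((integrable_minSq hZ hγ).const_mul _))
      fun ω => ?_
    obtain ⟨a, ha, hae⟩ := exists_minSq_eq hα (X ω)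
    obtain ⟨b, hb, hbe⟩ := exists_minSq_eq hγ (Z ω)
    have h1 := minSq_le (Finset.mem_image₂_of_mem (f := (· + ·)) ha hb) (X ω + Z ω)
    have h2 : ‖X ω + Z ω - (a + b)‖ ≤ ‖X ω - a‖ + ‖Z ω - b‖ := by
      rw [add_sub_add_comm]; exact norm_add_le _ _
    have h3 : ‖X ω + Z ω - (a + b)‖ ^ 2 ≤ (‖X ω - a‖ + ‖Z ω - b‖) ^ 2 := by gcongr
    have h4 : ∀ u v : ℝ, (u + v) ^ 2 ≤ (1 + η) * u ^ 2 + (1 + 1 / η) * v ^ 2 := fun u v => by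
      have : (1 + η) * u ^ 2 + (1 + 1 / η) * v ^ 2 - (u + v) ^ 2 = (η * u - v) ^ 2 / η := by
        field_simp; ring
      have h5 : 0 ≤ (η * u - v) ^ 2 / η := by positivity
      linarith
    simp only [hae, hbe]
    exact h1.trans (h3.trans (h4 _ _))
  rw [integral_add ((integrable_minSq hX hα).const_mul _) ((integrable_minSq hZ hγ).const_mul _),
    integral_const_mul, integral_const_mul] at hle
  refine (distortion_le (hα.image₂ hγ) hcard).trans (hle.trans ?_)
  have h6 : (1 + η) * δ + (1 + 1 / η) * δ = ε := by
    rw [hδ]; field_simp; ring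
  have h7 : 0 < 1 + 1 / η := by positivity
  nlinarith

lemma distortion_neg (R : ℝ) : distortion P (fun ω => -X ω) R ≤ distortion P X R := by
  classical
  by_cases hR : 0 ≤ R
  · refine le_distortion hR fun α h1 h2 => ?_
    refine (distortion_le (α := α.image Neg.neg) (h1.image _) ?_).trans (le_of_eq ?_)
    · exact le_trans (by exact_mod_cast Finset.card_image_le) h2
    · refine integral_congr_ae (ae_of_all _ fun ω => ?_)
      simp only [minSq, Finset.coe_image, Set.image_image]
      congr 1
      refine Set.image_congr fun a _ => ?_
      rw [← norm_neg]; congr 2; abel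
  · have : ∀ X : Ω → H, distortion P X R = 0 := fun X => by
      have : {r : ℝ | ∃ α : Finset H, α.Nonempty ∧ (α.card : ℝ) ≤ exp R ∧
          r = ∫ ω, minSq α (X ω) ∂P} = ∅ := by
        ext r
        simp only [Set.mem_ofPred_eq, Set.mem_empty_iff_false, iff_false]
        rintro ⟨α, h1, h2, -⟩
        have h3 : (1 : ℝ) ≤ α.card := by exact_mod_cast h1.card_pos
        have h4 : exp R < 1 := by simpa using hR
        linarith
      rw [distortion, this, Real.sInf_empty]
    rw [this, this]

lemma distortion_congr_ae (h : X =ᵐ[P] Z) (R : ℝ) : distortion P X R = distortion P Z R := by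
  unfold distortion
  have : ∀ α : Finset H, ∫ ω, minSq α (X ω) ∂P = ∫ ω, minSq α (Z ω) ∂P := fun α =>
    integral_congr_ae (h.mono fun ω hω => by simp only [hω])
  simp only [this]

lemma distortion_eq_of_map_eq [MeasurableSpace H] [BorelSpace H]
    {Ω' : Type*} [MeasurableSpace Ω'] {P' : Measure Ω'} {X' : Ω' → H}
    (hX : AEMeasurable X P) (hX' : AEMeasurable X' P')
    (h : P.map X = P'.map X') (R : ℝ) : distortion P X R = distortion P' X' R := by
  unfold distortion
  have : ∀ α : Finset H, ∫ ω, minSq α (X ω) ∂P = ∫ ω, minSq α (X' ω) ∂P' := fun α => by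
    have hm : ∀ ρ : Measure H, AEStronglyMeasurable (minSq α) ρ := fun ρ =>
      (continuous_minSq α).measurable.aestronglyMeasurable
    rw [← integral_map (f := minSq α) hX (hm _), h, integral_map hX' (hm _)]
  simp only [this]

end Distortion

section LowerBound

/-- Logarithm of the weight used in the Shannon-type lower bound for a centred Gaussian
coordinate of variance `v` at water level `θ`. -/
noncomputable def logWeight (θ v x : ℝ) : ℝ :=
  if θ ≤ v then 1 / 2 * log (v / θ) + x ^ 2 / (2 * v) else x ^ 2 / (2 * θ)

/-- Mean of `logWeight`. -/
noncomputable def meanLogWeight (θ v : ℝ) : ℝ :=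
  if θ ≤ v then 1 / 2 * log (v / θ) + 1 / 2 else v / (2 * θ)

lemma integral_sq_gaussianReal (v : ℝ≥0) : ∫ x, x ^ 2 ∂gaussianReal 0 v = v := by
  have h := variance_fun_id_gaussianReal (μ := 0) (v := v)
  rw [variance_of_integral_eq_zero aemeasurable_id' (by simp)] at h
  exact h

lemma integrable_pow_gaussianReal (v : ℝ≥0) (n : ℕ) :
    Integrable (fun x : ℝ => x ^ n) (gaussianReal 0 v) := by
  rcases eq_or_ne n 0 with rfl | hn
  · simp
  · have h := (memLp_id_gaussianReal (μ := 0) (v := v) n).integrable_norm_pow hn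
    refine h.mono (by fun_prop) (ae_of_all _ fun x => ?_)
    simp

lemma continuous_logWeight (θ v : ℝ) : Continuous (logWeight θ v) := by
  unfold logWeight; split_ifs <;> fun_prop

lemma integrable_logWeight (θ : ℝ) (v : ℝ≥0) :
    Integrable (logWeight θ v) (gaussianReal 0 v) := by
  have h := integrable_pow_gaussianReal v 2
  unfold logWeight
  split_ifs
  · exact (integrable_const _).add (h.div_const _)
  · exact h.div_const _

lemma integral_logWeight {θ : ℝ} (hθ : 0 < θ) (v : ℝ≥0) :
    ∫ x, logWeight θ v x ∂gaussianReal 0 v = meanLogWeight θ v := by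
  have h := integrable_pow_gaussianReal v 2
  unfold logWeight meanLogWeight
  split_ifs with hv
  · have hv0 : (v : ℝ) ≠ 0 := (hθ.trans_le hv).ne'
    rw [integral_add (integrable_const _) (h.div_const _), integral_div, integral_sq_gaussianReal]
    simp only [integral_const, probReal_univ, smul_eq_mul, one_mul]
    field_simp
  · rw [integral_div, integral_sq_gaussianReal]

lemma logWeight_sub_le {θ : ℝ} (hθ : 0 < θ) (v a x : ℝ) :
    logWeight θ v x - (x - a) ^ 2 / (2 * θ) ≤ |log (v / θ)| + a / θ * x := by
  have e : (x - a) ^ 2 / (2 * θ) = x ^ 2 / (2 * θ) - a / θ * x + a ^ 2 / (2 * θ) := by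
    field_simp; ring
  have e2 : 0 ≤ a ^ 2 / (2 * θ) := by positivity
  rw [e]
  unfold logWeight
  split_ifs with hv
  · have h1 : x ^ 2 / (2 * v) ≤ x ^ 2 / (2 * θ) := by gcongr
    have h2 := le_abs_self (log (v / θ))
    have h3 := abs_nonneg (log (v / θ))
    linarith
  · have h3 := abs_nonneg (log (v / θ))
    linarith

lemma integrable_exp_logWeight {θ : ℝ} (hθ : 0 < θ) (v : ℝ≥0) (a : ℝ) :
    Integrable (fun x => exp (logWeight θ v x - (x - a) ^ 2 / (2 * θ))) (gaussianReal 0 v) := by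
  have h := (integrable_exp_mul_gaussianReal (μ := 0) (v := v) (a / θ)).const_mul
    (exp |log (v / θ)|)
  refine h.mono ?_ (ae_of_all _ fun x => ?_)
  · have := continuous_logWeight θ v
    exact Continuous.aestronglyMeasurable (by fun_prop)
  · rw [Real.norm_of_nonneg (exp_nonneg _), Real.norm_of_nonneg (by positivity), ← exp_add]
    exact exp_le_exp.2 (logWeight_sub_le hθ v a x)

lemma integral_exp_logWeight_le {θ : ℝ} (hθ : 0 < θ) (v : ℝ≥0) (a : ℝ) :
    ∫ x, exp (logWeight θ v x - (x - a) ^ 2 / (2 * θ)) ∂gaussianReal 0 v ≤ 1 := by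
  unfold logWeight
  split_ifs with hv
  · have hv0 : 0 < (v : ℝ) := hθ.trans_le hv
    have hvn : v ≠ 0 := by exact_mod_cast hv0.ne'
    rw [integral_gaussianReal_eq_integral_smul hvn]
    have : ∀ x, gaussianPDFReal 0 v x •
        exp (1 / 2 * log (v / θ) + x ^ 2 / (2 * v) - (x - a) ^ 2 / (2 * θ)) =
        gaussianPDFReal a θ.toNNReal x := fun x => by
      have h1 : exp (1 / 2 * log (v / θ)) = √(v / θ) := by
        rw [Real.sqrt_eq_rpow, Real.rpow_def_of_pos (by positivity), mul_comm]
      rw [gaussianPDFReal, gaussianPDFReal, sub_eq_add_neg _ (_ / (2 * θ)), exp_add, exp_add, h1,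
        smul_eq_mul]
      simp only [sub_zero, Real.coe_toNNReal θ hθ.le]
      rw [show (√(2 * π * v))⁻¹ * exp (-x ^ 2 / (2 * v)) *
          (√(v / θ) * exp (x ^ 2 / (2 * v)) * exp (-((x - a) ^ 2 / (2 * θ)))) =
          ((√(2 * π * v))⁻¹ * √(v / θ)) * (exp (-x ^ 2 / (2 * v)) * exp (x ^ 2 / (2 * v))) *
            exp (-((x - a) ^ 2 / (2 * θ))) by ring, ← exp_add]
      have h2 : -x ^ 2 / (2 * (v : ℝ)) + x ^ 2 / (2 * v) = 0 := by ring
      rw [h2, exp_zero, mul_one, neg_div]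
      congr 1
      rw [← Real.sqrt_inv, ← Real.sqrt_inv, ← Real.sqrt_mul (by positivity)]
      congr 1
      field_simp
    simp_rw [this]
    rw [integral_gaussianPDFReal_eq_one]
    exact (Real.toNNReal_pos.2 hθ).ne'
  · have e : ∀ x : ℝ, exp (x ^ 2 / (2 * θ) - (x - a) ^ 2 / (2 * θ)) =
        exp (-(a ^ 2 / (2 * θ))) * exp (a / θ * x) := fun x => by
      rw [← exp_add]; congr 1; field_simp; ring
    simp_rw [e]
    rw [integral_const_mul]
    have h1 := congrFun (mgf_fun_id_gaussianReal (μ := 0) (v := v)) (a / θ)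
    rw [mgf] at h1
    rw [h1, ← exp_add, exp_le_one_iff]
    have hv' : (v : ℝ) / θ ≤ 1 := by rw [div_le_one hθ]; exact (not_le.1 hv).le
    have e3 : -(a ^ 2 / (2 * θ)) + (0 * (a / θ) + v * (a / θ) ^ 2 / 2) =
      -(a ^ 2 / (2 * θ)) * (1 - v / θ) := by field_simp; ring
    rw [e3]
    have : 0 ≤ a ^ 2 / (2 * θ) := by positivity
    nlinarith

variable {H : Type*} [NormedAddCommGroup H] [InnerProductSpace ℝ H]
variable {Ω : Type*} [MeasurableSpace Ω] {P : Measure Ω} [IsProbabilityMeasure P] {X : Ω → H}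

/-- Shannon-type lower bound for the distortion of a vector with independent centred Gaussian
coordinates along an orthonormal family. -/
theorem le_distortion_of_gaussian_coords {ι : Type*} [Fintype ι] {φ : ι → H}
    (hφ : Orthonormal ℝ φ) {v : ι → ℝ≥0} (hX : MemLp X 2 P)
    (hlaw : P.map (fun ω i => ⟪φ i, X ω⟫) = Measure.pi fun i => gaussianReal 0 (v i))
    {θ R : ℝ} (hθ : 0 < θ) (hR : 0 ≤ R) :
    2 * θ * (∑ i, meanLogWeight θ (v i) - R) ≤ distortion P X R := by
  have hm : AEMeasurable (fun ω i => ⟪φ i, X ω⟫) P := by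
    refine aemeasurable_pi_lambda _ fun i => ?_
    exact (hX.1.const_inner (𝕜 := ℝ) (c := φ i)).aemeasurable
  have hInt : ∀ {f : (ι → ℝ) → ℝ}, Integrable f (Measure.pi fun i => gaussianReal 0 (v i)) →
      Integrable (fun ω => f fun i => ⟪φ i, X ω⟫) P := fun {f} hf => by
    rw [← hlaw] at hf
    exact hf.comp_aemeasurable hm
  have hval : ∀ {f : (ι → ℝ) → ℝ}, Integrable f (Measure.pi fun i => gaussianReal 0 (v i)) →
      ∫ ω, f (fun i => ⟪φ i, X ω⟫) ∂P = ∫ x, f x ∂(Measure.pi fun i => gaussianReal 0 (v i)) :=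
    fun {f} hf => by
      rw [← hlaw] at hf ⊢
      rw [integral_map hm hf.1]
  refine le_distortion hR fun α hα hc => ?_
  have hM := integrable_minSq hX hα
  have hWi : ∀ i ∈ Finset.univ, Integrable (fun x : ι → ℝ => logWeight θ (v i) (x i))
      (Measure.pi fun i => gaussianReal 0 (v i)) := fun i _ =>
    integrable_comp_eval (μ := fun i => gaussianReal 0 (v i)) (integrable_logWeight θ (v i))
  have hW : Integrable (fun x : ι → ℝ => ∑ i, logWeight θ (v i) (x i))
      (Measure.pi fun i => gaussianReal 0 (v i)) := integrable_finsetSum _ hWi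
  have hWval : ∫ x : ι → ℝ, ∑ i, logWeight θ (v i) (x i)
      ∂(Measure.pi fun i => gaussianReal 0 (v i)) = ∑ i, meanLogWeight θ (v i) := by
    rw [integral_finsetSum _ hWi]
    refine Finset.sum_congr rfl fun i _ => ?_
    rw [integral_comp_eval (μ := fun i => gaussianReal 0 (v i))
      (f := logWeight θ (v i)) (continuous_logWeight _ _).aestronglyMeasurable,
      integral_logWeight hθ]
  have hE : ∀ a : H, Integrable (fun x : ι → ℝ =>
      ∏ i, exp (logWeight θ (v i) (x i) - (x i - ⟪φ i, a⟫) ^ 2 / (2 * θ)))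
      (Measure.pi fun i => gaussianReal 0 (v i)) := fun a =>
    Integrable.fintype_prod fun i => integrable_exp_logWeight hθ (v i) ⟪φ i, a⟫
  have hEval : ∀ a : H, ∫ x : ι → ℝ,
      ∏ i, exp (logWeight θ (v i) (x i) - (x i - ⟪φ i, a⟫) ^ 2 / (2 * θ))
      ∂(Measure.pi fun i => gaussianReal 0 (v i)) ≤ 1 := fun a => by
    rw [integral_fintype_prod_eq_prod
      (f := fun i x => exp (logWeight θ (v i) x - (x - ⟪φ i, a⟫) ^ 2 / (2 * θ)))]
    exact Finset.prod_le_one (fun i _ => integral_nonneg fun x => exp_nonneg _)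
      fun i _ => integral_exp_logWeight_le hθ _ _
  have hpt : ∀ ω, (∑ i, logWeight θ (v i) ⟪φ i, X ω⟫) - minSq α (X ω) / (2 * θ) - R + 1 ≤
      exp (-R) * ∑ a ∈ α,
        ∏ i, exp (logWeight θ (v i) ⟪φ i, X ω⟫ - (⟪φ i, X ω⟫ - ⟪φ i, a⟫) ^ 2 / (2 * θ)) := by
    intro ω
    refine (add_one_le_exp _).trans ?_
    rw [sub_eq_add_neg _ R, exp_add, mul_comm]
    refine mul_le_mul_of_nonneg_left ?_ (exp_nonneg _)
    obtain ⟨a, ha, hae⟩ := exists_minSq_eq hα (X ω)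
    refine le_trans ?_ (Finset.single_le_sum (f := fun a =>
      ∏ i, exp (logWeight θ (v i) ⟪φ i, X ω⟫ - (⟪φ i, X ω⟫ - ⟪φ i, a⟫) ^ 2 / (2 * θ)))
      (fun a _ => Finset.prod_nonneg fun i _ => exp_nonneg _) ha)
    rw [← exp_sum, exp_le_exp, Finset.sum_sub_distrib, ← Finset.sum_div, hae]
    have hb := hφ.sum_inner_products_le (s := Finset.univ) (X ω - a)
    simp only [inner_sub_right, Real.norm_eq_abs, sq_abs] at hb
    gcongr
  have hI1 : Integrable (fun ω =>
      (∑ i, logWeight θ (v i) ⟪φ i, X ω⟫) - minSq α (X ω) / (2 * θ) - R + 1) P :=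
    (((hInt hW).sub (hM.div_const _)).sub (integrable_const _)).add (integrable_const _)
  have hI2 : ∀ a ∈ α, Integrable (fun ω =>
      ∏ i, exp (logWeight θ (v i) ⟪φ i, X ω⟫ - (⟪φ i, X ω⟫ - ⟪φ i, a⟫) ^ 2 / (2 * θ))) P :=
    fun a _ => hInt (hE a)
  have hmono := integral_mono hI1 ((integrable_finsetSum _ hI2).const_mul (exp (-R))) hpt
  rw [integral_const_mul, integral_finsetSum _ hI2] at hmono
  have hsum : ∑ a ∈ α, ∫ ω,
      ∏ i, exp (logWeight θ (v i) ⟪φ i, X ω⟫ - (⟪φ i, X ω⟫ - ⟪φ i, a⟫) ^ 2 / (2 * θ)) ∂P ≤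
      exp R := by
    refine le_trans ?_ hc
    rw [← nsmul_one, ← Finset.sum_const]
    refine Finset.sum_le_sum fun a _ => ?_
    exact (hval (hE a)).trans_le (hEval a)
  have hlhs : ∫ ω, ((∑ i, logWeight θ (v i) ⟪φ i, X ω⟫) - minSq α (X ω) / (2 * θ) - R + 1) ∂P =
      ∑ i, meanLogWeight θ (v i) - (∫ ω, minSq α (X ω) ∂P) / (2 * θ) - R + 1 := by
    have hA : Integrable (fun ω => ∑ i, logWeight θ (v i) ⟪φ i, X ω⟫) P := hInt hW
    have hB : Integrable (fun ω => (∑ i, logWeight θ (v i) ⟪φ i, X ω⟫) -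
      minSq α (X ω) / (2 * θ)) P := hA.sub (hM.div_const _)
    have hC : Integrable (fun ω => (∑ i, logWeight θ (v i) ⟪φ i, X ω⟫) -
      minSq α (X ω) / (2 * θ) - R) P := hB.sub (integrable_const _)
    have hD : ∫ ω, ∑ i, logWeight θ (v i) ⟪φ i, X ω⟫ ∂P = ∑ i, meanLogWeight θ (v i) :=
      (hval hW).trans hWval
    rw [integral_add hC (integrable_const _), integral_sub hB (integrable_const _),
      integral_sub hA (hM.div_const _), integral_div, hD]
    simp
  rw [hlhs] at hmono
  have h1 : exp (-R) * ∑ a ∈ α, ∫ ω,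
      ∏ i, exp (logWeight θ (v i) ⟪φ i, X ω⟫ - (⟪φ i, X ω⟫ - ⟪φ i, a⟫) ^ 2 / (2 * θ)) ∂P ≤ 1 := by
    calc _ ≤ exp (-R) * exp R := by gcongr
      _ = 1 := by rw [← exp_add]; simp
  have h2 : ∑ i, meanLogWeight θ (v i) - R ≤ (∫ ω, minSq α (X ω) ∂P) / (2 * θ) := by linarith
  rw [le_div_iff₀ (by positivity)] at h2
  linarith

end LowerBound

section RandomCoding

open scoped ENNReal

lemma integrable_and_integral_of_pdf_mul {v w : ℝ≥0} (hv : v ≠ 0) (hw : w ≠ 0) {f : ℝ → ℝ}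
    {k m : ℝ} (h : ∀ x, gaussianPDFReal 0 v x * f x = k * gaussianPDFReal m w x) :
    Integrable f (gaussianReal 0 v) ∧ ∫ x, f x ∂gaussianReal 0 v = k := by
  constructor
  · rw [gaussianReal_of_var_ne_zero _ hv]
    rw [integrable_withDensity_iff_integrable_smul' (measurable_gaussianPDF 0 v)
      (ae_of_all _ fun _ => gaussianPDF_lt_top)]
    refine ((integrable_gaussianPDFReal m w).const_mul k).congr (ae_of_all _ fun x => ?_)
    simp only [toReal_gaussianPDF, smul_eq_mul, h]
  · rw [integral_gaussianReal_eq_integral_smul hv]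
    simp only [smul_eq_mul, h]
    rw [integral_const_mul, integral_gaussianPDFReal_eq_one _ hw, mul_one]

/-- The likelihood ratio of `N(a, θ)` against `N(0, v)` at `x`. -/
noncomputable def likelihood (θ v : ℝ≥0) (x a : ℝ) : ℝ :=
  exp (1 / 2 * log (v / θ) + x ^ 2 / (2 * v) - (x - a) ^ 2 / (2 * θ))

lemma likelihood_tilt {θ v : ℝ≥0} (hθ : 0 < θ) (hv : θ ≤ v) (a : ℝ) {c : ℝ} (hc : c < 1 / 2) :
    Integrable (fun x => exp (c * ((x - a) ^ 2 / θ)) * likelihood θ v x a) (gaussianReal 0 v) ∧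
    ∫ x, exp (c * ((x - a) ^ 2 / θ)) * likelihood θ v x a ∂gaussianReal 0 v =
      exp (-(1 / 2) * log (1 - 2 * c)) := by
  have hθ' : (0 : ℝ) < θ := by exact_mod_cast hθ
  have hv0 : 0 < v := hθ.trans_le hv
  have hv' : (0 : ℝ) < v := by exact_mod_cast hv0
  have hc' : 0 < 1 - 2 * c := by linarith
  set w : ℝ≥0 := (θ / (1 - 2 * c)).toNNReal
  have hw : (w : ℝ) = θ / (1 - 2 * c) := Real.coe_toNNReal _ (by positivity)
  have hw0 : w ≠ 0 := (Real.toNNReal_pos.2 (by positivity)).ne'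
  refine integrable_and_integral_of_pdf_mul hv0.ne' hw0 (m := a) fun x => ?_
  have e1 : ∀ u : ℝ, 0 < u → (√u)⁻¹ = exp (-(1 / 2) * log u) := fun u hu => by
    rw [Real.sqrt_eq_rpow, Real.rpow_def_of_pos hu, ← Real.exp_neg]; congr 1; ring
  rw [gaussianPDFReal, gaussianPDFReal, hw, likelihood, e1 _ (by positivity), e1 _ (by positivity),
    ← exp_add, ← exp_add, ← exp_add, ← exp_add, ← exp_add]
  congr 1
  rw [log_mul (x := 2 * π) (by positivity) hv'.ne',
    log_mul (x := 2 * π) (by positivity) (div_pos hθ' hc').ne',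
    log_div hv'.ne' hθ'.ne', log_div hθ'.ne' hc'.ne']
  field_simp
  ring

lemma integral_likelihood {θ v : ℝ≥0} (hθ : 0 < θ) (hv : θ ≤ v) (x : ℝ) :
    Integrable (fun a => likelihood θ v x a) (gaussianReal 0 (v - θ)) ∧
    ∫ a, likelihood θ v x a ∂gaussianReal 0 (v - θ) = 1 := by
  have hθ' : (0 : ℝ) < θ := by exact_mod_cast hθ
  have hv0 : 0 < v := hθ.trans_le hv
  have hv' : (0 : ℝ) < v := by exact_mod_cast hv0
  rcases hv.eq_or_lt with rfl | hlt
  · have : likelihood θ θ x 0 = 1 := by simp [likelihood, hθ'.ne']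
    simp only [tsub_self, gaussianReal_zero_var, integral_dirac, this, and_true]
    exact integrable_dirac (by simp)
  · have hlt' : (0 : ℝ) < v - θ := by
      have : (θ : ℝ) < v := by exact_mod_cast hlt
      linarith
    have hsub : ((v - θ : ℝ≥0) : ℝ) = v - θ := NNReal.coe_sub hv
    set w : ℝ≥0 := (θ * (v - θ) / v : ℝ).toNNReal
    have hw : (w : ℝ) = θ * (v - θ) / v := Real.coe_toNNReal _ (by positivity)
    have hw0 : w ≠ 0 := (Real.toNNReal_pos.2 (by positivity)).ne'
    refine integrable_and_integral_of_pdf_mul (tsub_pos_of_lt hlt).ne' hw0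
      (m := x * (v - θ) / v) fun a => ?_
    have e1 : ∀ u : ℝ, 0 < u → (√u)⁻¹ = exp (-(1 / 2) * log u) := fun u hu => by
      rw [Real.sqrt_eq_rpow, Real.rpow_def_of_pos hu, ← Real.exp_neg]; congr 1; ring
    rw [gaussianPDFReal, gaussianPDFReal, hw, hsub, likelihood, e1 _ (by positivity),
      e1 _ (by positivity), ← exp_add, ← exp_add, ← exp_add, one_mul]
    congr 1
    rw [log_mul (x := 2 * π) (by positivity) hlt'.ne',
      log_mul (x := 2 * π) (by positivity) (div_pos (mul_pos hθ' hlt') hv').ne',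
      log_div hv'.ne' hθ'.ne', log_div (mul_pos hθ' hlt').ne' hv'.ne', log_mul hθ'.ne' hlt'.ne']
    field_simp
    ring

lemma lintegral_pi_prod_ofReal {ι : Type*} [Fintype ι] {μ : ι → Measure ℝ}
    [∀ i, IsProbabilityMeasure (μ i)] {f : ι → ℝ → ℝ} (h0 : ∀ i x, 0 ≤ f i x)
    (hf : ∀ i, Integrable (f i) (μ i)) :
    ∫⁻ x, ENNReal.ofReal (∏ i, f i (x i)) ∂Measure.pi μ
      = ENNReal.ofReal (∏ i, ∫ x, f i x ∂μ i) := by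
  rw [← ofReal_integral_eq_lintegral_ofReal (Integrable.fintype_prod hf)
    (ae_of_all _ fun x => Finset.prod_nonneg fun i _ => h0 i (x i)), integral_fintype_prod_eq_prod]

/-- Iterated choice of codewords, each chosen at least as good as the average. -/
lemma exists_codewords {𝒳 𝒜 : Type*} [MeasurableSpace 𝒳] [MeasurableSpace 𝒜]
    (ν : Measure 𝒳) [SFinite ν] (Q : Measure 𝒜) [IsProbabilityMeasure Q]
    {f : 𝒳 → 𝒜 → ℝ≥0∞} (hf : Measurable (Function.uncurry f)) (n : ℕ) :
    ∀ {u : 𝒳 → ℝ≥0∞}, Measurable u → ∃ a : Fin n → 𝒜,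
      ∫⁻ x, u x * ∏ j, f x (a j) ∂ν ≤ ∫⁻ x, u x * (∫⁻ b, f x b ∂Q) ^ n ∂ν := by
  have hF : Measurable fun x => ∫⁻ b, f x b ∂Q := hf.lintegral_prod_right'
  induction n with
  | zero => intro u _; exact ⟨Fin.elim0, by simp⟩
  | succ n ih =>
    intro u hu
    have hfa : ∀ a, Measurable fun x => f x a := fun a =>
      hf.comp (measurable_id.prodMk measurable_const)
    have hm : Measurable (Function.uncurry fun a x => u x * f x a * (∫⁻ b, f x b ∂Q) ^ n) := by
      have h1 : Measurable fun z : 𝒜 × 𝒳 => f z.2 z.1 := hf.comp measurable_swap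
      have h2 : Measurable fun z : 𝒜 × 𝒳 => u z.2 := hu.comp measurable_snd
      have h3 : Measurable fun z : 𝒜 × 𝒳 => ∫⁻ b, f z.2 b ∂Q := hF.comp measurable_snd
      exact (h2.mul h1).mul (h3.pow_const n)
    obtain ⟨a, ha⟩ := exists_le_lintegral (μ := Q)
      (f := fun a => ∫⁻ x, u x * f x a * (∫⁻ b, f x b ∂Q) ^ n ∂ν)
      hm.lintegral_prod_right'.aemeasurable
    obtain ⟨l, hl⟩ := ih (hu.mul (hfa a))
    refine ⟨Fin.cons a l, ?_⟩
    simp only [Fin.prod_univ_succ, Fin.cons_zero, Fin.cons_succ]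
    calc _ = ∫⁻ x, u x * f x a * ∏ j, f x (l j) ∂ν := by simp only [mul_assoc]
      _ ≤ _ := hl
      _ ≤ _ := ha
      _ = ∫⁻ x, u x * (∫⁻ b, f x b ∂Q) ^ (n + 1) ∂ν := by
        rw [lintegral_lintegral_swap hm.aemeasurable]
        refine lintegral_congr fun x => ?_
        rw [lintegral_mul_const _ (by exact measurable_const.mul hf.of_uncurry_left),
          lintegral_const_mul _ hf.of_uncurry_left]
        ring

lemma one_sub_pow_le {p g M : ℝ} (hp : p ≤ 1) (hg0 : 0 ≤ g) (hg1 : g ≤ 1)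
    (hM : 0 < M) (hgp : g ≤ M * p) (n : ℕ) : (1 - p) ^ n ≤ 1 - g + exp (-(n / M)) := by
  have h1 : (1 - p) ^ n ≤ exp (-p) ^ n := by
    refine pow_le_pow_left₀ (by linarith) ?_ n
    linarith [add_one_le_exp (-p)]
  rw [← exp_nat_mul] at h1
  have h2 : exp (n * -p) ≤ exp (g * -(n / M) + (1 - g) * 0) := by
    rw [exp_le_exp]
    have : (n : ℝ) / M * g ≤ n / M * (M * p) := by gcongr
    have h3 : (n : ℝ) / M * (M * p) = n * p := by field_simp
    linarith
  have h3 := convexOn_exp.2 (Set.mem_univ (-(n / M))) (Set.mem_univ 0) hg0 (sub_nonneg.2 hg1)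
    (by ring)
  simp only [smul_eq_mul, exp_zero, mul_one] at h3
  rw [mul_zero] at h3 h2
  have := exp_nonneg (-(n / M))
  nlinarith

lemma neg_half_log_le {s : ℝ} (hs : |s| ≤ 1 / 4) :
    -(1 / 2) * log (1 - 2 * s) ≤ s + 4 * s ^ 2 := by
  have h : |2 * s| ≤ 1 / 2 := by rw [abs_mul]; norm_num; linarith
  have h1 := abs_log_sub_add_sum_range_le (x := 2 * s) (by linarith) 1
  simp at h1
  have h2 : (2 * |s|) ^ 2 / (1 - 2 * |s|) ≤ 2 * (2 * |s|) ^ 2 := by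
    rw [div_le_iff₀ (by linarith)]
    nlinarith [sq_nonneg |s|]
  have h3 := neg_le_of_abs_le (h1.trans h2)
  rw [mul_pow, sq_abs] at h3
  linarith

variable {ι : Type*} [Fintype ι]

lemma lintegral_tilt {θ : ℝ≥0} {v : ι → ℝ≥0} (hθ : 0 < θ) (hv : ∀ i, θ ≤ v i) (a : ι → ℝ)
    {c : ℝ} (hc : c < 1 / 2) :
    ∫⁻ x, ENNReal.ofReal (exp (c * ∑ i, (x i - a i) ^ 2 / θ)) *
      ENNReal.ofReal (∏ i, likelihood θ (v i) (x i) (a i))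
      ∂(Measure.pi fun i => gaussianReal 0 (v i)) =
    ENNReal.ofReal (exp (Fintype.card ι * (-(1 / 2) * log (1 - 2 * c)))) := by
  have h1 : ∀ x : ι → ℝ, ENNReal.ofReal (exp (c * ∑ i, (x i - a i) ^ 2 / θ)) *
      ENNReal.ofReal (∏ i, likelihood θ (v i) (x i) (a i)) =
      ENNReal.ofReal (∏ i, exp (c * ((x i - a i) ^ 2 / θ)) * likelihood θ (v i) (x i) (a i)) := by
    intro x
    rw [← ENNReal.ofReal_mul (exp_nonneg _), Finset.prod_mul_distrib, ← exp_sum, Finset.mul_sum]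
  simp_rw [h1]
  rw [lintegral_pi_prod_ofReal
    (f := fun i x => exp (c * ((x - a i) ^ 2 / θ)) * likelihood θ (v i) x (a i))
    (fun i x => by unfold likelihood; positivity) fun i => (likelihood_tilt hθ (hv i) _ hc).1]
  simp_rw [fun i => (likelihood_tilt hθ (hv i) (a i) hc).2]
  rw [Finset.prod_const, ← exp_nat_mul, Finset.card_univ]

lemma lintegral_likelihood {θ : ℝ≥0} {v : ι → ℝ≥0} (hθ : 0 < θ) (hv : ∀ i, θ ≤ v i)
    (x : ι → ℝ) :
    ∫⁻ a, ENNReal.ofReal (∏ i, likelihood θ (v i) (x i) (a i))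
      ∂(Measure.pi fun i => gaussianReal 0 (v i - θ)) = 1 := by
  rw [lintegral_pi_prod_ofReal (f := fun i a => likelihood θ (v i) (x i) a)
    (fun i x => by unfold likelihood; positivity) fun i => (integral_likelihood hθ (hv i) _).1]
  simp [(fun i => (integral_likelihood hθ (hv i) (x i)).2)]

lemma lintegral_exp_sq {v : ι → ℝ≥0} (hv : ∀ i, 0 < v i) {c : ℝ} (hc : c < 1 / 2) :
    ∫⁻ x, ENNReal.ofReal (exp (c * ∑ i, (x i) ^ 2 / v i))
      ∂(Measure.pi fun i => gaussianReal 0 (v i)) =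
    ENNReal.ofReal (exp (Fintype.card ι * (-(1 / 2) * log (1 - 2 * c)))) := by
  have h2 : ∀ i x, exp (c * ((x - 0) ^ 2 / v i)) * likelihood (v i) (v i) x 0 =
      exp (c * (x ^ 2 / v i)) := by
    intro i x
    have : (v i : ℝ) ≠ 0 := by exact_mod_cast (hv i).ne'
    simp [likelihood, this]
  have h := fun i => likelihood_tilt (hv i) le_rfl 0 hc
  simp_rw [h2] at h
  have h1 : ∀ x : ι → ℝ, exp (c * ∑ i, (x i) ^ 2 / v i) = ∏ i, exp (c * ((x i) ^ 2 / v i)) := by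
    intro x
    rw [← exp_sum, Finset.mul_sum]
  simp_rw [h1]
  rw [lintegral_pi_prod_ofReal (f := fun i x => exp (c * (x ^ 2 / v i)))
    (fun i x => exp_nonneg _) fun i => (h i).1]
  simp_rw [fun i => (h i).2]
  rw [Finset.prod_const, ← exp_nat_mul, Finset.card_univ]

lemma measurable_likelihood (θ : ℝ≥0) (v : ι → ℝ≥0) :
    Measurable (Function.uncurry fun (x a : ι → ℝ) =>
      ENNReal.ofReal (∏ i, likelihood θ (v i) (x i) (a i))) := by
  unfold likelihood Function.uncurry
  fun_prop

lemma lintegral_mul_le_three {𝒳 𝒜 : Type*} [MeasurableSpace 𝒳] [MeasurableSpace 𝒜]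
    (ν : Measure 𝒳) (Q : Measure 𝒜) [SFinite Q] {f h e₁ e₂ e₃ : 𝒳 → 𝒜 → ℝ≥0∞} {c₁ c₂ c₃ : ℝ≥0∞}
    (h₁ : Measurable (Function.uncurry fun x a => e₁ x a * h x a))
    (h₂ : Measurable (Function.uncurry fun x a => e₂ x a * h x a))
    (h₃ : Measurable (Function.uncurry fun x a => e₃ x a * h x a))
    (hf : ∀ x a, f x a ≤ c₁ * e₁ x a + c₂ * e₂ x a + c₃ * e₃ x a) :
    ∫⁻ x, ∫⁻ a, f x a * h x a ∂Q ∂ν ≤ c₁ * ∫⁻ x, ∫⁻ a, e₁ x a * h x a ∂Q ∂ν +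
      c₂ * ∫⁻ x, ∫⁻ a, e₂ x a * h x a ∂Q ∂ν + c₃ * ∫⁻ x, ∫⁻ a, e₃ x a * h x a ∂Q ∂ν := by
  have n₁ : Measurable fun x => ∫⁻ a, e₁ x a * h x a ∂Q := h₁.lintegral_prod_right'
  have n₂ : Measurable fun x => ∫⁻ a, e₂ x a * h x a ∂Q := h₂.lintegral_prod_right'
  have n₃ : Measurable fun x => ∫⁻ a, e₃ x a * h x a ∂Q := h₃.lintegral_prod_right'
  rw [← lintegral_const_mul _ n₁, ← lintegral_const_mul _ n₂, ← lintegral_const_mul _ n₃,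
    ← lintegral_add_left (by exact n₁.const_mul _),
    ← lintegral_add_left (by exact (n₁.const_mul _).add (n₂.const_mul _))]
  refine lintegral_mono fun x => ?_
  have m₁ : Measurable fun a => e₁ x a * h x a := h₁.of_uncurry_left
  have m₂ : Measurable fun a => e₂ x a * h x a := h₂.of_uncurry_left
  have m₃ : Measurable fun a => e₃ x a * h x a := h₃.of_uncurry_left
  simp only
  rw [← lintegral_const_mul _ m₁, ← lintegral_const_mul _ m₂, ← lintegral_const_mul _ m₃,
    ← lintegral_add_left (by exact m₁.const_mul _),
    ← lintegral_add_left (by exact (m₁.const_mul _).add (m₂.const_mul _))]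
  refine lintegral_mono fun a => ?_
  calc f x a * h x a ≤ (c₁ * e₁ x a + c₂ * e₂ x a + c₃ * e₃ x a) * h x a := by
        gcongr; exact hf x a
    _ = _ := by ring

/-- Random coding: a Gaussian vector is covered with high probability by a deterministic code. -/
theorem exists_code_pi {θ : ℝ≥0} {v : ι → ℝ≥0} (hθ : 0 < θ) (hv : ∀ i, θ ≤ v i) {ε : ℝ}
    (hε : 0 < ε) (hε1 : ε ≤ 1) {n : ℕ}
    (hn : exp (∑ i, 1 / 2 * log (v i / θ) + 2 * ε * Fintype.card ι) ≤ n) :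
    ∃ a : Fin n → ι → ℝ, (Measure.pi fun i => gaussianReal 0 (v i))
      {x | ∀ j, Fintype.card ι * θ * (1 + ε) < ∑ i, (x i - a j i) ^ 2} ≤
        ENNReal.ofReal (4 * exp (-(ε ^ 2 / 16 * Fintype.card ι))) := by
  set ν := Measure.pi fun i => gaussianReal 0 (v i)
  set Q := Measure.pi fun i => gaussianReal 0 (v i - θ)
  set d : ℝ := ((Fintype.card ι : ℕ) : ℝ) with hd
  have hd0 : 0 ≤ d := by positivity
  have hθ' : (0 : ℝ) < θ := by exact_mod_cast hθ
  have hv0 : ∀ i, 0 < v i := fun i => hθ.trans_le (hv i)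
  set S : (ι → ℝ) → (ι → ℝ) → ℝ := fun x a => ∑ i, (x i - a i) ^ 2 / θ with hS
  set T : (ι → ℝ) → ℝ := fun x => ∑ i, (x i) ^ 2 / v i with hT
  set h : (ι → ℝ) → (ι → ℝ) → ℝ≥0∞ :=
    fun x a => ENNReal.ofReal (∏ i, likelihood θ (v i) (x i) (a i)) with hh
  have hhm : Measurable (Function.uncurry h) := measurable_likelihood θ v
  have hSm : Measurable fun z : (ι → ℝ) × (ι → ℝ) => S z.1 z.2 := by simp only [hS]; fun_prop
  have hTm : Measurable fun z : (ι → ℝ) × (ι → ℝ) => T z.1 := by simp only [hT]; fun_prop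
  set G : Set ((ι → ℝ) × (ι → ℝ)) :=
    {z | S z.1 z.2 ≤ d * (1 + ε) ∧ d * (1 - ε) ≤ S z.1 z.2 ∧ T z.1 ≤ d * (1 + ε)} with hG
  have hGm : MeasurableSet G := (measurableSet_le hSm measurable_const).inter
    ((measurableSet_le measurable_const hSm).inter (measurableSet_le hTm measurable_const))
  set f : (ι → ℝ) → (ι → ℝ) → ℝ≥0∞ := fun x a => Gᶜ.indicator 1 (x, a) with hf
  set g : (ι → ℝ) → (ι → ℝ) → ℝ≥0∞ := fun x a => G.indicator 1 (x, a) with hg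
  have hfm : Measurable (Function.uncurry f) := measurable_one.indicator hGm.compl
  have hgm : Measurable (Function.uncurry g) := measurable_one.indicator hGm
  have hfg : ∀ x a, f x a + g x a = 1 := fun x a => by
    by_cases hz : (x, a) ∈ G <;> simp [hf, hg, hz]
  obtain ⟨a, ha⟩ := exists_codewords ν Q hfm n (u := fun _ => 1) measurable_const
  refine ⟨a, ?_⟩
  simp only [one_mul] at ha
  set δ := exp (-(ε ^ 2 / 16 * d)) with hδ
  -- the code misses only if every codeword fails
  have hmiss : ν {x | ∀ j, d * θ * (1 + ε) < ∑ i, (x i - a j i) ^ 2} ≤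
      ∫⁻ x, ∏ j, f x (a j) ∂ν := by
    have hms : MeasurableSet {x : ι → ℝ | ∀ j, d * θ * (1 + ε) < ∑ i, (x i - a j i) ^ 2} := by
      rw [Set.ofPred_forall]
      exact MeasurableSet.iInter fun j => measurableSet_lt measurable_const (by fun_prop)
    rw [← lintegral_indicator_one hms]
    refine lintegral_mono fun x => ?_
    by_cases hx : x ∈ {x : ι → ℝ | ∀ j, d * θ * (1 + ε) < ∑ i, (x i - a j i) ^ 2}
    · rw [Set.indicator_of_mem hx]
      refine (Finset.prod_eq_one fun j _ => ?_).ge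
      have hj : (x, a j) ∈ Gᶜ := fun hz => by
        have h1 : S x (a j) ≤ d * (1 + ε) := hz.1
        simp only [hS, ← Finset.sum_div] at h1
        rw [div_le_iff₀ hθ'] at h1
        have h2 := hx j
        linarith
      simp [hf, Set.indicator_of_mem hj]
    · rw [Set.indicator_of_notMem hx]; exact zero_le
  set M := exp (∑ i, 1 / 2 * log (v i / θ) + ε * d) with hM
  have hM0 : 0 < M := exp_pos _
  have hgh : ∀ x a, g x a * h x a ≤ ENNReal.ofReal M * g x a := by
    intro x b
    by_cases hz : (x, b) ∈ G
    · simp only [hg, Set.indicator_of_mem hz, Pi.one_apply, one_mul, mul_one, hh]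
      refine ENNReal.ofReal_le_ofReal ?_
      unfold likelihood
      rw [← exp_sum, hM, exp_le_exp]
      obtain ⟨-, h2, h3⟩ := hz
      have e : ∑ i, (1 / 2 * log (v i / θ) + x i ^ 2 / (2 * v i) - (x i - b i) ^ 2 / (2 * θ)) =
          ∑ i, 1 / 2 * log (v i / θ) + 1 / 2 * T x - 1 / 2 * S x b := by
        rw [Finset.sum_sub_distrib, Finset.sum_add_distrib, hT, hS]
        simp only [Finset.mul_sum]
        congr 1
        · congr 1
          exact Finset.sum_congr rfl fun i _ => by ring
        · exact Finset.sum_congr rfl fun i _ => by ring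
      rw [e]
      simp only at h2 h3
      linarith
    · simp [hg, hz]
  have hkey : ∀ x, (∫⁻ b, f x b ∂Q) ^ n ≤
      ∫⁻ b, f x b * h x b ∂Q + ENNReal.ofReal (exp (-(n / M))) := by
    intro x
    have hfx : Measurable (f x) := hfm.of_uncurry_left
    have hgx : Measurable (g x) := hgm.of_uncurry_left
    have hhx : Measurable (h x) := hhm.of_uncurry_left
    have e1 : ∫⁻ b, f x b ∂Q + ∫⁻ b, g x b ∂Q = 1 := by
      rw [← lintegral_add_left hfx]; simp [hfg]
    have e2 : ∫⁻ b, f x b * h x b ∂Q + ∫⁻ b, g x b * h x b ∂Q = 1 := by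
      rw [← lintegral_add_left (by exact hfx.mul hhx)]
      simp only [← add_mul, hfg, one_mul]
      exact lintegral_likelihood hθ hv x
    have e3 : ∫⁻ b, g x b * h x b ∂Q ≤ ENNReal.ofReal M * ∫⁻ b, g x b ∂Q := by
      rw [← lintegral_const_mul _ hgx]
      exact lintegral_mono fun b => hgh x b
    generalize ∫⁻ b, f x b ∂Q = A at *
    generalize ∫⁻ b, g x b ∂Q = B at *
    generalize ∫⁻ b, f x b * h x b ∂Q = C at *
    generalize ∫⁻ b, g x b * h x b ∂Q = D at *
    have hA : A ≠ ∞ := by rintro rfl; simp at e1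
    have hB : B ≠ ∞ := by rintro rfl; simp at e1
    have hC : C ≠ ∞ := by rintro rfl; simp at e2
    have hD : D ≠ ∞ := by rintro rfl; simp at e2
    lift A to ℝ≥0 using hA
    lift B to ℝ≥0 using hB
    lift C to ℝ≥0 using hC
    lift D to ℝ≥0 using hD
    have r1 : (A : ℝ) + B = 1 := by exact_mod_cast e1
    have r2 : (C : ℝ) + D = 1 := by exact_mod_cast e2
    have r3 : (D : ℝ) ≤ M * B := by
      have := ENNReal.toReal_mono (by finiteness) e3
      simpa [ENNReal.toReal_mul, hM0.le] using this
    have := one_sub_pow_le (p := B) (g := D) (by linarith [A.2]) D.2 (by linarith [C.2]) hM0 r3 n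
    rw [show (1 : ℝ) - B = A by linarith, show (1 : ℝ) - D = C by linarith] at this
    have h5 := ENNReal.ofReal_le_ofReal this
    rw [ENNReal.ofReal_add (by positivity) (exp_nonneg _), ENNReal.ofReal_coe_nnreal,
      ENNReal.ofReal_pow (by positivity), ENNReal.ofReal_coe_nnreal] at h5
    exact h5
  have hs : |ε / 8| ≤ 1 / 4 := by rw [abs_of_pos (by positivity)]; linarith
  have hs' : |-(ε / 8)| ≤ 1 / 4 := by rwa [abs_neg]
  have hf3 : ∀ x b, f x b ≤ ENNReal.ofReal (exp (-(ε / 8 * (d * (1 + ε))))) *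
      ENNReal.ofReal (exp (ε / 8 * S x b)) +
      ENNReal.ofReal (exp (ε / 8 * (d * (1 - ε)))) * ENNReal.ofReal (exp (-(ε / 8) * S x b)) +
      ENNReal.ofReal (exp (-(ε / 8 * (d * (1 + ε))))) * ENNReal.ofReal (exp (ε / 8 * T x)) := by
    intro x b
    by_cases hz : (x, b) ∈ G
    · simp [hf, hz]
    · have h1 : f x b = ENNReal.ofReal 1 := by simp [hf, hz]
      rw [h1, ← ENNReal.ofReal_mul (exp_nonneg _), ← ENNReal.ofReal_mul (exp_nonneg _),
        ← ENNReal.ofReal_mul (exp_nonneg _), ← exp_add, ← exp_add, ← exp_add,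
        ← ENNReal.ofReal_add (exp_nonneg _) (exp_nonneg _),
        ← ENNReal.ofReal_add (by positivity) (exp_nonneg _)]
      refine ENNReal.ofReal_le_ofReal ?_
      have p1 := exp_pos (-(ε / 8 * (d * (1 + ε))) + ε / 8 * S x b)
      have p2 := exp_pos (ε / 8 * (d * (1 - ε)) + -(ε / 8) * S x b)
      have p3 := exp_pos (-(ε / 8 * (d * (1 + ε))) + ε / 8 * T x)
      have h3 : d * (1 + ε) < S x b ∨ S x b < d * (1 - ε) ∨ d * (1 + ε) < T x := by
        by_contra! hcon
        exact hz hcon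
      rcases h3 with h3 | h3 | h3
      · have := one_le_exp (x := -(ε / 8 * (d * (1 + ε))) + ε / 8 * S x b) (by nlinarith)
        linarith
      · have := one_le_exp (x := ε / 8 * (d * (1 - ε)) + -(ε / 8) * S x b) (by nlinarith)
        linarith
      · have := one_le_exp (x := -(ε / 8 * (d * (1 + ε))) + ε / 8 * T x) (by nlinarith)
        linarith
  have hbad : ∫⁻ x, ∫⁻ b, f x b * h x b ∂Q ∂ν ≤ ENNReal.ofReal (3 * δ) := by
    have hSe : ∀ c : ℝ, Measurable (Function.uncurry fun x b =>
        ENNReal.ofReal (exp (c * S x b)) * h x b) := fun c =>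
      (ENNReal.measurable_ofReal.comp (measurable_exp.comp (measurable_const.mul hSm))).mul hhm
    have hTe : Measurable (Function.uncurry fun x b =>
        ENNReal.ofReal (exp (ε / 8 * T x)) * h x b) :=
      (ENNReal.measurable_ofReal.comp (measurable_exp.comp (measurable_const.mul hTm))).mul hhm
    have t1 : ∀ c : ℝ, c < 1 / 2 → ∫⁻ x, ∫⁻ b, ENNReal.ofReal (exp (c * S x b)) * h x b ∂Q ∂ν =
        ENNReal.ofReal (exp (d * (-(1 / 2) * log (1 - 2 * c)))) := by
      intro c hc
      rw [lintegral_lintegral_swap (hSe c).aemeasurable]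
      simp only [hS, hh, ν, lintegral_tilt hθ hv _ hc]
      simp [hd]
    have t2 : ∫⁻ x, ∫⁻ b, ENNReal.ofReal (exp (ε / 8 * T x)) * h x b ∂Q ∂ν =
        ENNReal.ofReal (exp (d * (-(1 / 2) * log (1 - 2 * (ε / 8))))) := by
      have : ∀ x, ∫⁻ b, ENNReal.ofReal (exp (ε / 8 * T x)) * h x b ∂Q =
          ENNReal.ofReal (exp (ε / 8 * T x)) := fun x => by
        rw [lintegral_const_mul _ hhm.of_uncurry_left]
        simp only [hh, Q, lintegral_likelihood hθ hv x, mul_one]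
      simp_rw [this]
      exact lintegral_exp_sq hv0 (by linarith)
    refine (lintegral_mul_le_three ν Q (hSe _) (hSe _) hTe hf3).trans ?_
    rw [t1 _ (by linarith), t1 _ (by linarith), t2, ← ENNReal.ofReal_mul (exp_nonneg _),
      ← ENNReal.ofReal_mul (exp_nonneg _), ← exp_add, ← exp_add,
      ← ENNReal.ofReal_add (exp_nonneg _) (exp_nonneg _),
      ← ENNReal.ofReal_add (by positivity) (exp_nonneg _)]
    refine ENNReal.ofReal_le_ofReal ?_
    have q1 := mul_le_mul_of_nonneg_left (neg_half_log_le hs) hd0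
    have q2 := mul_le_mul_of_nonneg_left (neg_half_log_le hs') hd0
    have k1 : exp (-(ε / 8 * (d * (1 + ε))) + d * (-(1 / 2) * log (1 - 2 * (ε / 8)))) ≤ δ := by
      rw [hδ, exp_le_exp]; linarith
    have k2 : exp (ε / 8 * (d * (1 - ε)) + d * (-(1 / 2) * log (1 - 2 * -(ε / 8)))) ≤ δ := by
      rw [hδ, exp_le_exp]; linarith
    linarith
  have hL : exp (-(n / M)) ≤ δ := by
    rw [hδ, exp_le_exp, neg_le_neg_iff]
    have h1 : exp (ε * d) ≤ n / M := by
      rw [le_div_iff₀ hM0, hM, ← exp_add]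
      refine le_trans (le_of_eq ?_) hn
      congr 1; ring
    have h2 := add_one_le_exp (ε * d)
    have h3 : ε ^ 2 / 16 * d ≤ ε * d := by
      refine mul_le_mul_of_nonneg_right ?_ hd0
      nlinarith
    linarith
  calc _ ≤ _ := hmiss
    _ ≤ _ := ha
    _ ≤ ∫⁻ x, (∫⁻ b, f x b * h x b ∂Q + ENNReal.ofReal (exp (-(n / M)))) ∂ν := lintegral_mono hkey
    _ = ∫⁻ x, ∫⁻ b, f x b * h x b ∂Q ∂ν + ENNReal.ofReal (exp (-(n / M))) := by
      rw [lintegral_add_right _ measurable_const]; simp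
    _ ≤ ENNReal.ofReal (3 * δ) + ENNReal.ofReal δ :=
      add_le_add hbad (ENNReal.ofReal_le_ofReal hL)
    _ = _ := by
      rw [← ENNReal.ofReal_add (by positivity) (by positivity)]
      congr 1; ring

end RandomCoding

section UpperBound

lemma integral_pow_four_gaussianReal_le (v : ℝ≥0) :
    ∫ x, x ^ 4 ∂gaussianReal 0 v ≤ 48 * exp (v / 2) := by
  have h1 : ∀ x : ℝ, x ^ 4 ≤ 24 * exp (1 * x) + 24 * exp (-1 * x) := fun x => by
    have h := pow_div_factorial_le_exp |x| (abs_nonneg x) 4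
    have h2 : exp |x| ≤ exp (1 * x) + exp (-1 * x) := by
      rcases abs_cases x with ⟨h, -⟩ | ⟨h, -⟩ <;> rw [h]
      · simpa using exp_nonneg (-x)
      · simpa using exp_nonneg x
    rw [show |x| ^ 4 = x ^ 4 from Even.pow_abs (by decide) x] at h
    norm_num [Nat.factorial] at h
    norm_num at h2 ⊢
    linarith
  have hi := fun c : ℝ => (integrable_exp_mul_gaussianReal (μ := 0) (v := v) c).const_mul 24
  have h2 := integral_mono (integrable_pow_gaussianReal v 4) ((hi 1).add (hi (-1))) h1
  have h3 := fun c : ℝ => congrFun (mgf_fun_id_gaussianReal (μ := 0) (v := v)) c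
  simp only [mgf] at h3
  simp only [Pi.add_apply] at h2
  rw [integral_add (hi 1) (hi (-1)), integral_const_mul, integral_const_mul, h3, h3] at h2
  norm_num at h2
  linarith

variable {H : Type*} [NormedAddCommGroup H] [InnerProductSpace ℝ H]
variable {Ω : Type*} [MeasurableSpace Ω] {P : Measure Ω} [IsProbabilityMeasure P] {X : Ω → H}

lemma norm_sub_sum_sq {ι : Type*} [Fintype ι] {φ : ι → H} (hφ : Orthonormal ℝ φ) (x : H)
    (a : ι → ℝ) : ‖x - ∑ i, a i • φ i‖ ^ 2 =
      ∑ i, (⟪φ i, x⟫ - a i) ^ 2 + (‖x‖ ^ 2 - ∑ i, ⟪φ i, x⟫ ^ 2) := by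
  have h1 : ‖∑ i, a i • φ i‖ ^ 2 = ∑ i, a i ^ 2 := by
    rw [← real_inner_self_eq_norm_sq, hφ.inner_sum]
    simp [pow_two]
  have h2 : ⟪x, ∑ i, a i • φ i⟫ = ∑ i, a i * ⟪φ i, x⟫ := by
    rw [inner_sum]
    exact Finset.sum_congr rfl fun i _ => by rw [real_inner_smul_right, real_inner_comm]
  rw [norm_sub_sq_real, h1, h2]
  simp only [sub_sq, Finset.sum_add_distrib, Finset.sum_sub_distrib]
  have h3 : ∑ i, 2 * ⟪φ i, x⟫ * a i = 2 * ∑ i, a i * ⟪φ i, x⟫ := by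
    rw [Finset.mul_sum]; exact Finset.sum_congr rfl fun i _ => by ring
  rw [h3]; ring

/-- Random-coding upper bound for the distortion of a vector with independent centred Gaussian
coordinates along an orthonormal family. -/
theorem distortion_le_of_gaussian_coords {ι : Type*} [Fintype ι] {φ : ι → H}
    (hφ : Orthonormal ℝ φ) {v : ι → ℝ≥0} (hX : MemLp X 2 P)
    (hlaw : P.map (fun ω i => ⟪φ i, X ω⟫) = Measure.pi fun i => gaussianReal 0 (v i))
    {θ : ℝ≥0} (hθ : 0 < θ) (hv : ∀ i, θ ≤ v i) (hv1 : ∀ i, v i ≤ 1) {ε R : ℝ}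
    (hε : 0 < ε) (hε1 : ε ≤ 1)
    (hR : ∑ i, 1 / 2 * log (v i / θ) + 2 * ε * Fintype.card ι + 2 ≤ R) :
    distortion P X R ≤ Fintype.card ι * θ * (1 + ε) +
      exp (-(ε ^ 2 / 32 * Fintype.card ι)) * (96 * Fintype.card ι ^ 2 + 4) +
      (∫ ω, ‖X ω‖ ^ 2 ∂P - ∑ i, (v i : ℝ)) := by
  classical
  set ν := Measure.pi fun i => gaussianReal 0 (v i) with hν
  set d : ℝ := ((Fintype.card ι : ℕ) : ℝ) with hd
  have hd0 : 0 ≤ d := by positivity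
  have hθ' : (0 : ℝ) < θ := by exact_mod_cast hθ
  have hm : AEMeasurable (fun ω i => ⟪φ i, X ω⟫) P := by
    refine aemeasurable_pi_lambda _ fun i => ?_
    exact (hX.1.const_inner (𝕜 := ℝ) (c := φ i)).aemeasurable
  have hInt : ∀ {f : (ι → ℝ) → ℝ}, Integrable f ν →
      Integrable (fun ω => f fun i => ⟪φ i, X ω⟫) P := fun {f} hf => by
    rw [← hlaw] at hf
    exact hf.comp_aemeasurable hm
  have hval : ∀ {f : (ι → ℝ) → ℝ}, Integrable f ν →
      ∫ ω, f (fun i => ⟪φ i, X ω⟫) ∂P = ∫ x, f x ∂ν :=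
    fun {f} hf => by
      rw [← hlaw] at hf ⊢
      rw [integral_map hm hf.1]
  set y := ∑ i, 1 / 2 * log (v i / θ) + 2 * ε * d with hy
  have hy0 : 0 ≤ y := by
    refine add_nonneg (Finset.sum_nonneg fun i _ => ?_) (by positivity)
    have : 0 ≤ log (v i / θ) := log_nonneg (by
      rw [le_div_iff₀ hθ', one_mul]; exact_mod_cast hv i)
    positivity
  obtain ⟨n, hn⟩ : ∃ n, n = ⌈exp y⌉₊ := ⟨_, rfl⟩
  obtain ⟨a, ha⟩ := exists_code_pi hθ hv hε hε1 (n := n) (hn ▸ Nat.le_ceil _)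
  rw [← hν, ← hd] at ha
  set B : Set (ι → ℝ) := {x | ∀ j, d * θ * (1 + ε) < ∑ i, (x i - a j i) ^ 2} with hB
  have hBm : MeasurableSet B := by
    rw [hB, Set.ofPred_forall]
    exact MeasurableSet.iInter fun j => measurableSet_lt measurable_const (by fun_prop)
  set α : Finset H := insert 0 (Finset.univ.image fun j => ∑ i, a j i • φ i) with hα
  have hαn : α.Nonempty := ⟨0, by simp [hα]⟩
  have hcard : (α.card : ℝ) ≤ exp R := by
    have h1 : α.card ≤ n + 1 := by
      refine (Finset.card_insert_le _ _).trans ?_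
      have := Finset.card_image_le (s := Finset.univ) (f := fun j : Fin n => ∑ i, a j i • φ i)
      simpa using this
    have h2 : (n : ℝ) < exp y + 1 := hn ▸ Nat.ceil_lt_add_one (exp_nonneg _)
    have h3 : exp y * 3 ≤ exp R := by
      calc exp y * 3 ≤ exp y * exp 2 := by
            gcongr; linarith [add_one_le_exp (2 : ℝ)]
        _ = exp (y + 2) := by rw [exp_add y 2]
        _ ≤ exp R := exp_le_exp.2 hR
    have h4 : 1 ≤ exp y := one_le_exp hy0
    have h5 : (α.card : ℝ) ≤ n + 1 := by exact_mod_cast h1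
    linarith
  refine (distortion_le hαn hcard).trans ?_
  set t := exp (-(ε ^ 2 / 32 * d)) with ht
  have ht0 : 0 < t := exp_pos _
  set w : (ι → ℝ) → ℝ := fun x => ∑ i, x i ^ 2 with hw
  have hw0 : ∀ x, 0 ≤ w x := fun x => Finset.sum_nonneg fun i _ => sq_nonneg _
  have hpt : ∀ ω, minSq α (X ω) ≤ d * θ * (1 + ε) + t * (d * ∑ i, ⟪φ i, X ω⟫ ^ 4) +
      t⁻¹ * B.indicator 1 (fun i => ⟪φ i, X ω⟫) + (‖X ω‖ ^ 2 - ∑ i, ⟪φ i, X ω⟫ ^ 2) := by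
    intro ω
    have hcs : (∑ i, ⟪φ i, X ω⟫ ^ 2) ^ 2 ≤ d * ∑ i, ⟪φ i, X ω⟫ ^ 4 := by
      have := sq_sum_le_card_mul_sum_sq (s := Finset.univ) (f := fun i => ⟪φ i, X ω⟫ ^ 2)
      simpa [← pow_mul, hd] using this
    have hcs' := mul_le_mul_of_nonneg_left hcs ht0.le
    by_cases hz : (fun i => ⟪φ i, X ω⟫) ∈ B
    · have h1 := minSq_le (α := α) (a := 0) (by simp [hα]) (X ω)
      rw [sub_zero] at h1
      rw [Set.indicator_of_mem hz]
      have hW := hw0 fun i => ⟪φ i, X ω⟫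
      simp only [hw] at hW
      set W := ∑ i, ⟪φ i, X ω⟫ ^ 2
      have h2 : 2 * W ≤ t * W ^ 2 + t⁻¹ := by
        have h3 : 0 ≤ t⁻¹ * (t * W - 1) ^ 2 := by positivity
        have h4 : t⁻¹ * (t * W - 1) ^ 2 = t * W ^ 2 - 2 * W + t⁻¹ := by field_simp; ring
        linarith
      have h5 : 0 ≤ d * θ * (1 + ε) := by positivity
      simp only [Pi.one_apply, mul_one]
      linarith
    · rw [Set.indicator_of_notMem hz]
      have h1 : ∃ j, ∑ i, (⟪φ i, X ω⟫ - a j i) ^ 2 ≤ d * θ * (1 + ε) := by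
        by_contra! hcon
        exact hz hcon
      obtain ⟨j, hj⟩ := h1
      have h2 := minSq_le (α := α) (a := ∑ i, a j i • φ i) (by simp [hα]) (X ω)
      rw [norm_sub_sum_sq hφ] at h2
      have h3 := sq_nonneg (∑ i, ⟪φ i, X ω⟫ ^ 2)
      have h4 : 0 ≤ t * (∑ i, ⟪φ i, X ω⟫ ^ 2) ^ 2 := by positivity
      linarith
  have hq : ∀ k : ℕ, ∀ i ∈ Finset.univ, Integrable (fun x : ι → ℝ => x i ^ k) ν := fun k i _ =>
    integrable_comp_eval (μ := fun i => gaussianReal 0 (v i)) (f := fun x => x ^ k)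
      (integrable_pow_gaussianReal (v i) k)
  have hqv : ∀ k i, ∫ x : ι → ℝ, x i ^ k ∂ν = ∫ x, x ^ k ∂gaussianReal 0 (v i) := fun k i =>
    integral_comp_eval (μ := fun i => gaussianReal 0 (v i)) (f := fun x => x ^ k)
      (by fun_prop)
  have hS := fun k => integrable_finsetSum Finset.univ (hq k)
  have hBi : Integrable (B.indicator (1 : (ι → ℝ) → ℝ)) ν :=
    (integrable_const (1 : ℝ)).indicator hBm
  have hI4 : Integrable (fun ω => ∑ i, ⟪φ i, X ω⟫ ^ 4) P := hInt (hS 4)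
  have hI2 : Integrable (fun ω => ∑ i, ⟪φ i, X ω⟫ ^ 2) P := hInt (hS 2)
  have hIB : Integrable (fun ω => B.indicator (1 : (ι → ℝ) → ℝ) (fun i => ⟪φ i, X ω⟫)) P :=
    hInt hBi
  have hIX : Integrable (fun ω => ‖X ω‖ ^ 2) P := hX.integrable_norm_pow (by norm_num)
  have hJ1 : Integrable (fun ω => d * θ * (1 + ε) + t * (d * ∑ i, ⟪φ i, X ω⟫ ^ 4)) P :=
    (integrable_const _).add ((hI4.const_mul _).const_mul _)
  have hJ2 : Integrable (fun ω => d * θ * (1 + ε) + t * (d * ∑ i, ⟪φ i, X ω⟫ ^ 4) +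
      t⁻¹ * B.indicator 1 (fun i => ⟪φ i, X ω⟫)) P := hJ1.add (hIB.const_mul _)
  have hmono := integral_mono (integrable_minSq hX hαn) (hJ2.add (hIX.sub hI2)) hpt
  refine hmono.trans ?_
  have e4 : ∫ ω, ∑ i, ⟪φ i, X ω⟫ ^ 4 ∂P ≤ 96 * d := by
    rw [show ∫ ω, ∑ i, ⟪φ i, X ω⟫ ^ 4 ∂P = _ from hval (hS 4), integral_finsetSum _ (hq 4)]
    simp_rw [hqv]
    calc _ ≤ ∑ i : ι, (96 : ℝ) := by
          refine Finset.sum_le_sum fun i _ => (integral_pow_four_gaussianReal_le (v i)).trans ?_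
          have h1 : (v i : ℝ) ≤ 1 := by exact_mod_cast hv1 i
          have h2 : exp (v i / 2) ≤ 2 := by
            have : exp ((v i : ℝ) / 2) ≤ exp (log 2) := exp_le_exp.2 (by
              have := log_two_gt_d9; linarith)
            rwa [exp_log (by norm_num)] at this
          linarith
      _ = _ := by simp [hd, mul_comm]
  have e2 : ∫ ω, ∑ i, ⟪φ i, X ω⟫ ^ 2 ∂P = ∑ i, (v i : ℝ) := by
    rw [show ∫ ω, ∑ i, ⟪φ i, X ω⟫ ^ 2 ∂P = _ from hval (hS 2), integral_finsetSum _ (hq 2)]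
    simp_rw [hqv, integral_sq_gaussianReal]
  have eB : ∫ ω, B.indicator (1 : (ι → ℝ) → ℝ) (fun i => ⟪φ i, X ω⟫) ∂P ≤ 4 * t ^ 2 := by
    rw [show ∫ ω, B.indicator (1 : (ι → ℝ) → ℝ) (fun i => ⟪φ i, X ω⟫) ∂P = _ from hval hBi,
      integral_indicator_one hBm, measureReal_def]
    refine ENNReal.toReal_le_of_le_ofReal (by positivity) (ha.trans_eq ?_)
    rw [ht, ← exp_nat_mul]
    congr 3
    push_cast; ring
  have hfin : ∫ ω, (d * θ * (1 + ε) + t * (d * ∑ i, ⟪φ i, X ω⟫ ^ 4) +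
      t⁻¹ * B.indicator 1 (fun i => ⟪φ i, X ω⟫) + (‖X ω‖ ^ 2 - ∑ i, ⟪φ i, X ω⟫ ^ 2)) ∂P =
      d * θ * (1 + ε) + t * (d * ∫ ω, ∑ i, ⟪φ i, X ω⟫ ^ 4 ∂P) +
      t⁻¹ * ∫ ω, B.indicator (1 : (ι → ℝ) → ℝ) (fun i => ⟪φ i, X ω⟫) ∂P +
      (∫ ω, ‖X ω‖ ^ 2 ∂P - ∫ ω, ∑ i, ⟪φ i, X ω⟫ ^ 2 ∂P) := by
    have hJ3 : Integrable (fun ω => ‖X ω‖ ^ 2 - ∑ i, ⟪φ i, X ω⟫ ^ 2) P := hIX.sub hI2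
    rw [integral_add hJ2 hJ3, integral_sub hIX hI2, integral_add hJ1 (hIB.const_mul _),
      integral_add (integrable_const _) ((hI4.const_mul _).const_mul _), integral_const_mul,
      integral_const_mul]
    have hc := integral_const_mul (μ := P) t⁻¹
      fun ω => B.indicator (1 : (ι → ℝ) → ℝ) (fun i => ⟪φ i, X ω⟫)
    rw [hc]
    simp [integral_const_mul]
  refine (le_of_eq hfin).trans ?_
  rw [e2]
  have k1 : t * (d * ∫ ω, ∑ i, ⟪φ i, X ω⟫ ^ 4 ∂P) ≤ t * (d * (96 * d)) := by gcongr
  have k2 : t⁻¹ * ∫ ω, B.indicator (1 : (ι → ℝ) → ℝ) (fun i => ⟪φ i, X ω⟫) ∂P ≤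
      t⁻¹ * (4 * t ^ 2) := by gcongr
  have k3 : t⁻¹ * (4 * t ^ 2) = 4 * t := by field_simp
  linarith

end UpperBound

section WhiteNoise

variable (ι : Type*)

/-- The law of a family of independent standard normal variables. -/
noncomputable def noiseMeasure : Measure (ι → ℝ) := Measure.infinitePi fun _ => gaussianReal 0 1

instance : IsProbabilityMeasure (noiseMeasure ι) := by
  unfold noiseMeasure; infer_instance

variable {ι} {H : Type*} [NormedAddCommGroup H] [InnerProductSpace ℝ H]

lemma map_eval_noiseMeasure (k : ι) :
    (noiseMeasure ι).map (fun ω => ω k) = gaussianReal 0 1 :=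
  Measure.infinitePi_map_eval (μ := fun _ : ι => gaussianReal 0 1) k

lemma map_restrict_noiseMeasure (F : Finset ι) :
    (noiseMeasure ι).map F.restrict = Measure.pi fun _ : F => gaussianReal 0 1 :=
  Measure.infinitePi_map_restrict (μ := fun _ : ι => gaussianReal 0 1)

lemma memLp_eval (k : ι) : MemLp (fun ω : ι → ℝ => ω k) 2 (noiseMeasure ι) := by
  have h : MemLp (id : ℝ → ℝ) 2 ((noiseMeasure ι).map fun ω => ω k) := by
    rw [map_eval_noiseMeasure]
    exact_mod_cast memLp_id_gaussianReal (μ := 0) (v := 1) 2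
  exact h.comp_of_map (measurable_pi_apply k).aemeasurable

lemma integral_eval_mul_self (k : ι) : ∫ ω, ω k * ω k ∂noiseMeasure ι = 1 := by
  have h := integral_map (μ := noiseMeasure ι) (φ := fun ω => ω k) (f := fun x : ℝ => x ^ 2)
    (measurable_pi_apply k).aemeasurable (by fun_prop)
  rw [map_eval_noiseMeasure, integral_sq_gaussianReal] at h
  simpa [sq] using h.symm

lemma integral_eval_mul_eval [DecidableEq ι] {j k : ι} (hjk : j ≠ k) :
    ∫ ω, ω j * ω k ∂noiseMeasure ι = 0 := by
  have hind : iIndepFun (fun (i : ι) (ω : ι → ℝ) => ω i) (noiseMeasure ι) :=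
    iIndepFun_infinitePi (P := fun _ : ι => gaussianReal 0 1) (X := fun _ x => x)
      (fun _ => measurable_id)
  have h := (hind.indepFun hjk).integral_mul_eq_mul_integral
    (memLp_eval j).1 (memLp_eval k).1
  have h0 : ∫ ω, ω j ∂noiseMeasure ι = 0 := by
    have h := integral_map (μ := noiseMeasure ι) (φ := fun ω => ω j) (f := fun x : ℝ => x)
      (measurable_pi_apply j).aemeasurable (by fun_prop)
    rw [map_eval_noiseMeasure, integral_id_gaussianReal] at h
    exact h.symm
  simpa [h0] using h

lemma memLp_eval_smul (k : ι) (h : H) :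
    MemLp (fun ω : ι → ℝ => ω k • h) 2 (noiseMeasure ι) :=
  ((ContinuousLinearMap.id ℝ ℝ).smulRight h).comp_memLp' (memLp_eval k)

variable (H) in
/-- The isometric embedding `h ↦ ω k • h`. -/
noncomputable def noiseEmbedding (k : ι) : H →ₗᵢ[ℝ] Lp H 2 (noiseMeasure ι) where
  toFun h := (memLp_eval_smul k h).toLp
  map_add' x y := by
    rw [← MemLp.toLp_add]
    congr 1
    ext ω
    simp
  map_smul' c x := by
    rw [RingHom.id_apply, ← MemLp.toLp_const_smul]
    congr 1
    ext ω
    simp [smul_comm c]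
  norm_map' x := by
    have h : ‖(memLp_eval_smul k x).toLp‖ ^ 2 = ‖x‖ ^ 2 := by
      rw [← real_inner_self_eq_norm_sq, L2.inner_def, ← mul_one (‖x‖ ^ 2),
        ← integral_eval_mul_self k, ← integral_const_mul]
      refine integral_congr_ae ?_
      filter_upwards [(memLp_eval_smul k x).coeFn_toLp] with ω hω
      rw [hω, real_inner_smul_left, real_inner_smul_right, real_inner_self_eq_norm_sq]
      ring
    exact (sq_eq_sq₀ (norm_nonneg _) (norm_nonneg _)).1 h

lemma noiseEmbedding_ae (k : ι) (h : H) :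
    noiseEmbedding H k h =ᵐ[noiseMeasure ι] fun ω => ω k • h :=
  (memLp_eval_smul k h).coeFn_toLp

lemma orthogonalFamily_noiseEmbedding :
    OrthogonalFamily ℝ (fun _ : ι => H) (noiseEmbedding H (ι := ι)) := by
  classical
  intro j k hjk x y
  rw [L2.inner_def]
  have : ∀ᵐ ω ∂noiseMeasure ι, ⟪noiseEmbedding H j x ω, noiseEmbedding H k y ω⟫
      = ω j * ω k * ⟪x, y⟫ := by
    filter_upwards [noiseEmbedding_ae j x, noiseEmbedding_ae k y] with ω h1 h2
    rw [h1, h2, real_inner_smul_left, real_inner_smul_right]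
    ring
  rw [integral_congr_ae this, integral_mul_const, integral_eval_mul_eval hjk, zero_mul]

lemma summable_inner_sq (t : lp (fun _ : ι => H) 2) (f : H) :
    Summable fun k => ⟪f, t k⟫ ^ 2 := by
  have h := (lp.hasSum_inner (𝕜 := ℝ) t t).summable
  simp only [real_inner_self_eq_norm_sq] at h
  refine Summable.of_nonneg_of_le (fun k => sq_nonneg _) (fun k => ?_) (h.mul_left (‖f‖ ^ 2))
  rw [← mul_pow, ← sq_abs]
  exact pow_le_pow_left₀ (abs_nonneg _) (abs_real_inner_le_norm _ _) 2

variable [CompleteSpace H]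

/-- The Gaussian series `∑ ω k • t k`. -/
noncomputable def gaussianSeries : lp (fun _ : ι => H) 2 →ₗᵢ[ℝ] Lp H 2 (noiseMeasure ι) :=
  (orthogonalFamily_noiseEmbedding (ι := ι) (H := H)).linearIsometry

lemma hasSum_gaussianSeries (t : lp (fun _ : ι => H) 2) :
    HasSum (fun k => noiseEmbedding H k (t k)) (gaussianSeries t) :=
  (orthogonalFamily_noiseEmbedding (ι := ι) (H := H)).hasSum_linearIsometry t

lemma memLp_gaussianSeries (t : lp (fun _ : ι => H) 2) :
    MemLp (gaussianSeries t) 2 (noiseMeasure ι) := Lp.memLp _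

lemma integral_norm_sq_gaussianSeries (t : lp (fun _ : ι => H) 2) :
    ∫ ω, ‖gaussianSeries t ω‖ ^ 2 ∂noiseMeasure ι = ∑' k, ‖t k‖ ^ 2 := by
  have h1 : ‖gaussianSeries t‖ ^ 2 = ‖t‖ ^ 2 := by rw [LinearIsometry.norm_map]
  rw [← real_inner_self_eq_norm_sq, ← real_inner_self_eq_norm_sq, L2.inner_def,
    lp.inner_eq_tsum] at h1
  simpa only [real_inner_self_eq_norm_sq] using h1

lemma hasSum_inner_gaussianSeries (t : lp (fun _ : ι => H) 2) (f : H) :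
    HasSum (fun k => ⟪f, t k⟫ • (memLp_eval k).toLp)
      ((innerSL ℝ f).compLpL 2 (noiseMeasure ι) (gaussianSeries t)) := by
  have h := (hasSum_gaussianSeries t).mapL ((innerSL ℝ f).compLpL 2 (noiseMeasure ι))
  refine h.congr_fun fun k => ?_
  rw [← MemLp.toLp_const_smul]
  refine Lp.ext ?_
  filter_upwards [ContinuousLinearMap.coeFn_compLpL (innerSL ℝ f) (noiseEmbedding H k (t k)),
    noiseEmbedding_ae k (t k), ((memLp_eval k).const_smul ⟪f, t k⟫).coeFn_toLp] with ω h1 h2 h3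
  rw [h1, h2, h3]
  simp [mul_comm]

lemma inner_gaussianSeries_ae (t : lp (fun _ : ι => H) 2) (f : H) :
    (innerSL ℝ f).compLpL 2 (noiseMeasure ι) (gaussianSeries t)
      =ᵐ[noiseMeasure ι] fun ω => ⟪f, gaussianSeries t ω⟫ := by
  filter_upwards [ContinuousLinearMap.coeFn_compLpL (innerSL ℝ f) (gaussianSeries t)] with ω h1
  rw [h1]
  simp

lemma norm_integral_cexp_sub_le {Ω : Type*} [MeasurableSpace Ω] {P : Measure Ω}
    [IsProbabilityMeasure P] (u : ℝ) (X Z : Lp ℝ 2 P) :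
    ‖(∫ ω, Complex.exp (u * X ω * Complex.I) ∂P) - ∫ ω, Complex.exp (u * Z ω * Complex.I) ∂P‖
      ≤ |u| * ‖X - Z‖ := by
  have hInt : ∀ X : Lp ℝ 2 P, Integrable (fun ω => Complex.exp (u * X ω * Complex.I)) P := by
    intro X
    refine Integrable.of_bound (C := 1) ?_ (Eventually.of_forall fun ω => ?_)
    · have := (Lp.aestronglyMeasurable X)
      exact Complex.continuous_exp.comp_aestronglyMeasurable
        (((Complex.continuous_ofReal.comp_aestronglyMeasurable this).const_mul _).mul_const _)
    · rw [← Complex.ofReal_mul, Complex.norm_exp_ofReal_mul_I]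
  rw [← integral_sub (hInt X) (hInt Z)]
  have hXZ : Integrable (fun ω => ‖(X - Z) ω‖) P :=
    ((Lp.memLp (X - Z)).integrable (by norm_num)).norm
  calc ‖∫ ω, (Complex.exp (u * X ω * Complex.I) - Complex.exp (u * Z ω * Complex.I)) ∂P‖
      ≤ ∫ ω, |u| * ‖(X - Z) ω‖ ∂P := by
        refine norm_integral_le_of_norm_le (hXZ.const_mul _) ?_
        filter_upwards [Lp.coeFn_sub X Z] with ω hω
        rw [hω]
        have h1 : Complex.exp (u * X ω * Complex.I) - Complex.exp (u * Z ω * Complex.I)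
            = Complex.exp ((u * Z ω : ℝ) * Complex.I) *
              (Complex.exp (Complex.I * ((u * (X ω - Z ω) : ℝ) : ℂ)) - 1) := by
          rw [mul_sub, ← Complex.exp_add, mul_one]
          congr 2
          · push_cast; ring
          · push_cast; ring
        rw [h1, norm_mul, Complex.norm_exp_ofReal_mul_I, one_mul]
        refine (Real.norm_exp_I_mul_ofReal_sub_one_le).trans ?_
        rw [norm_mul, Pi.sub_apply, Real.norm_eq_abs u]
    _ = |u| * ∫ ω, ‖(X - Z) ω‖ ∂P := integral_const_mul _ _
    _ ≤ |u| * ‖X - Z‖ := by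
        gcongr
        rw [Lp.norm_def, integral_norm_eq_lintegral_enorm (Lp.aestronglyMeasurable _),
          ← eLpNorm_one_eq_lintegral_enorm]
        exact ENNReal.toReal_mono (Lp.eLpNorm_ne_top _)
          (eLpNorm_le_eLpNorm_of_exponent_le (by norm_num) (Lp.aestronglyMeasurable _))

lemma integral_cexp_sum_noise (F : Finset ι) (c : ι → ℝ) (u : ℝ) :
    ∫ ω, Complex.exp (u * (∑ k ∈ F, c k * ω k : ℝ) * Complex.I) ∂noiseMeasure ι
      = Complex.exp (-((∑ k ∈ F, c k ^ 2 : ℝ) * u ^ 2 / 2)) := by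
  have h1 : ∀ ω : ι → ℝ, Complex.exp (u * (∑ k ∈ F, c k * ω k : ℝ) * Complex.I)
      = (fun x : F → ℝ => ∏ k : F, Complex.exp ((u * c k : ℝ) * x k * Complex.I))
        (F.restrict ω) := by
    intro ω
    simp only [Finset.restrict]
    rw [← Complex.exp_sum, Finset.sum_coe_sort F (fun k => ((u * c k : ℝ) : ℂ) * ω k * Complex.I)]
    congr 1
    push_cast
    rw [Finset.mul_sum, Finset.sum_mul]
    exact Finset.sum_congr rfl fun k _ => by ring
  simp_rw [h1]
  rw [← integral_map (μ := noiseMeasure ι) (φ := F.restrict)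
    (f := fun x : F → ℝ => ∏ k : F, Complex.exp ((u * c k : ℝ) * x k * Complex.I))
    (by fun_prop) (Continuous.aestronglyMeasurable (by fun_prop)), map_restrict_noiseMeasure,
    integral_fintype_prod_eq_prod (fun (k : F) (x : ℝ) =>
      Complex.exp ((u * c k : ℝ) * x * Complex.I))]
  simp_rw [← charFun_apply_real, charFun_gaussianReal]
  rw [← Complex.exp_sum,
    Finset.sum_coe_sort F (fun k => ((u * c k : ℝ) : ℂ) * (0 : ℝ) * Complex.I
      - ((1 : ℝ≥0) : ℝ) * ((u * c k : ℝ) : ℂ) ^ 2 / 2)]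
  congr 1
  push_cast
  rw [Finset.sum_mul, Finset.sum_div, ← Finset.sum_neg_distrib]
  exact Finset.sum_congr rfl fun k _ => by simp; ring

/-- One-dimensional marginals of a Gaussian series. -/
lemma map_inner_gaussianSeries (t : lp (fun _ : ι => H) 2) (f : H) :
    (noiseMeasure ι).map (fun ω => ⟪f, gaussianSeries t ω⟫)
      = gaussianReal 0 (∑' k, ⟪f, t k⟫ ^ 2).toNNReal := by
  have hm : AEMeasurable (fun ω => ⟪f, gaussianSeries t ω⟫) (noiseMeasure ι) :=
    ((memLp_gaussianSeries t).1.const_inner (c := f)).aemeasurable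
  have : IsProbabilityMeasure ((noiseMeasure ι).map (fun ω => ⟪f, gaussianSeries t ω⟫)) :=
    Measure.isProbabilityMeasure_map hm
  refine Measure.ext_of_charFun ?_
  ext u
  rw [charFun_apply_real, charFun_gaussianReal, integral_map hm (by fun_prop),
    Real.coe_toNNReal _ (tsum_nonneg fun k => sq_nonneg _)]
  set L := (innerSL ℝ f).compLpL 2 (noiseMeasure ι) (gaussianSeries t) with hL
  have hcongr : ∫ ω, Complex.exp (u * (⟪f, gaussianSeries t ω⟫ : ℝ) * Complex.I) ∂noiseMeasure ι
      = ∫ ω, Complex.exp (u * L ω * Complex.I) ∂noiseMeasure ι := by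
    refine integral_congr_ae ?_
    filter_upwards [inner_gaussianSeries_ae t f] with ω hω
    rw [hL, hω]
  rw [hcongr]
  have hsum := hasSum_inner_gaussianSeries t f
  set s : Finset ι → Lp ℝ 2 (noiseMeasure ι) :=
    fun F => ∑ k ∈ F, ⟪f, t k⟫ • (memLp_eval k).toLp with hs
  have hlim : Tendsto (fun F => ∫ ω, Complex.exp (u * s F ω * Complex.I) ∂noiseMeasure ι) atTop
      (nhds (∫ ω, Complex.exp (u * L ω * Complex.I) ∂noiseMeasure ι)) := by
    have h0 : Tendsto (fun F => |u| * ‖s F - L‖) atTop (nhds 0) := by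
      simpa using (tendsto_iff_norm_sub_tendsto_zero.1 hsum).const_mul |u|
    exact tendsto_iff_norm_sub_tendsto_zero.2 (squeeze_zero (fun _ => norm_nonneg _)
      (fun F => norm_integral_cexp_sub_le u (s F) L) h0)
  refine tendsto_nhds_unique hlim ?_
  have hval : ∀ F, ∫ ω, Complex.exp (u * s F ω * Complex.I) ∂noiseMeasure ι
      = Complex.exp (-((∑ k ∈ F, ⟪f, t k⟫ ^ 2 : ℝ) * u ^ 2 / 2)) := by
    intro F
    rw [← integral_cexp_sum_noise F (fun k => ⟪f, t k⟫) u]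
    refine integral_congr_ae ?_
    have h1 : s F =ᵐ[noiseMeasure ι] fun ω => ∑ k ∈ F, ⟪f, t k⟫ * ω k := by
      have h2 : ∀ᵐ ω ∂noiseMeasure ι, ∀ k ∈ F,
          (⟪f, t k⟫ • (memLp_eval k).toLp : Lp ℝ 2 (noiseMeasure ι)) ω = ⟪f, t k⟫ * ω k := by
        refine (ae_ball_iff F.countable_toSet).2 fun k _ => ?_
        filter_upwards [Lp.coeFn_smul ⟪f, t k⟫ (memLp_eval k).toLp, (memLp_eval k).coeFn_toLp]
          with ω h1 h2
        rw [h1, Pi.smul_apply, h2, smul_eq_mul]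
      filter_upwards [h2, Lp.coeFn_finsetSum F fun k => ⟪f, t k⟫ • (memLp_eval k).toLp]
        with ω h3 h4
      rw [hs, h4]
      simp only [Finset.sum_apply]
      exact Finset.sum_congr rfl h3
    filter_upwards [h1] with ω hω
    rw [hω]
  simp_rw [hval]
  have hsq : Tendsto (fun F : Finset ι => ∑ k ∈ F, ⟪f, t k⟫ ^ 2) atTop
      (nhds (∑' k, ⟪f, t k⟫ ^ 2)) := (summable_inner_sq t f).hasSum
  have hc : Continuous fun x : ℝ => Complex.exp (-((x : ℂ) * u ^ 2 / 2)) := by fun_prop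
  have := (hc.tendsto _).comp hsq
  rw [Complex.ofReal_zero, mul_zero, zero_mul, zero_sub]
  exact this

lemma integral_inner_sq_gaussianSeries (t : lp (fun _ : ι => H) 2) (f : H) :
    ∫ ω, ⟪f, gaussianSeries t ω⟫ ^ 2 ∂noiseMeasure ι = ∑' k, ⟪f, t k⟫ ^ 2 := by
  have hm : AEMeasurable (fun ω => ⟪f, gaussianSeries t ω⟫) (noiseMeasure ι) :=
    ((memLp_gaussianSeries t).1.const_inner (c := f)).aemeasurable
  have h := integral_map (μ := noiseMeasure ι) (φ := fun ω => ⟪f, gaussianSeries t ω⟫)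
    (f := fun x : ℝ => x ^ 2) hm (by fun_prop)
  rw [map_inner_gaussianSeries, integral_sq_gaussianReal,
    Real.coe_toNNReal _ (tsum_nonneg fun k => sq_nonneg _)] at h
  exact h.symm

/-- If the coefficients are multiples of an orthonormal family, the coordinates of the series are
independent. -/
lemma inner_gaussianSeries_of_orthonormal {φ : ι → H} (hφ : Orthonormal ℝ φ) {r : ι → ℝ}
    (t : lp (fun _ : ι => H) 2) (ht : ∀ k, t k = r k • φ k) (i : ι) :
    (fun ω => ⟪φ i, gaussianSeries t ω⟫) =ᵐ[noiseMeasure ι] fun ω => r i * ω i := by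
  classical
  have h := hasSum_inner_gaussianSeries t (φ i)
  have h2 : HasSum (fun k => ⟪φ i, t k⟫ • (memLp_eval k).toLp)
      (r i • (memLp_eval i).toLp : Lp ℝ 2 (noiseMeasure ι)) := by
    have h3 := hasSum_single (f := fun k => ⟪φ i, t k⟫ • (memLp_eval k).toLp) i (fun k hk => by
      rw [ht, real_inner_smul_right, hφ.2 hk.symm, mul_zero, zero_smul])
    simpa [ht, real_inner_smul_right, hφ.1 i] using h3
  have h4 := h.unique h2
  have h5 := inner_gaussianSeries_ae t (φ i)
  rw [h4] at h5
  filter_upwards [h5, Lp.coeFn_smul (r i) (memLp_eval i).toLp, (memLp_eval i).coeFn_toLp]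
    with ω h1 h2 h3
  rw [← h1, h2, Pi.smul_apply, h3, smul_eq_mul]

lemma map_inner_gaussianSeries_of_orthonormal {φ : ι → H} (hφ : Orthonormal ℝ φ) {r : ι → ℝ}
    (t : lp (fun _ : ι => H) 2) (ht : ∀ k, t k = r k • φ k) (F : Finset ι) :
    (noiseMeasure ι).map (fun ω (i : F) => ⟪φ i, gaussianSeries t ω⟫)
      = Measure.pi fun i : F => gaussianReal 0 (r i ^ 2).toNNReal := by
  have h1 : (fun ω (i : F) => ⟪φ i, gaussianSeries t ω⟫)
      =ᵐ[noiseMeasure ι] (fun x (i : F) => r i * x i) ∘ F.restrict := by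
    have h2 : ∀ᵐ ω ∂noiseMeasure ι, ∀ i : F, ⟪φ i, gaussianSeries t ω⟫ = r i * ω i :=
      ae_all_iff.2 fun i => inner_gaussianSeries_of_orthonormal hφ t ht i
    filter_upwards [h2] with ω hω
    ext i
    simp [hω i]
  rw [Measure.map_congr h1, ← Measure.map_map (by fun_prop) (by fun_prop),
    map_restrict_noiseMeasure]
  have h3 := Measure.pi_map_pi (μ := fun _ : F => gaussianReal 0 1)
    (f := fun (i : F) (x : ℝ) => r i * x) (fun i => by fun_prop)
  rw [h3]
  congr 1
  ext1 i
  rw [gaussianReal_map_const_mul]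
  congr 1
  · simp
  · ext
    simp [Real.coe_toNNReal _ (sq_nonneg (r i))]

end WhiteNoise

section Kernels

instance : IsProbabilityMeasure μ01 := ⟨by simp [μ01]⟩

lemma ae_mem_Icc : ∀ᵐ x ∂μ01, x ∈ Set.Icc (0 : ℝ) 1 := ae_restrict_mem measurableSet_Icc

lemma integral_μ01 {E : Type*} [NormedAddCommGroup E] [NormedSpace ℝ E] (f : ℝ → E) :
    ∫ x, f x ∂μ01 = ∫ x in (0 : ℝ)..1, f x := by
  rw [μ01, integral_Icc_eq_integral_Ioc, intervalIntegral.integral_of_le zero_le_one]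

/-- The functions `cos + sin` at integer frequencies. -/
noncomputable def cas (k : ℤ) (y : ℝ) : ℝ := cos (2 * π * k * y) + sin (2 * π * k * y)

@[fun_prop]
lemma continuous_cas (k : ℤ) : Continuous (cas k) := by unfold cas; fun_prop

lemma abs_cas_le (k : ℤ) (y : ℝ) : |cas k y| ≤ 2 := by
  refine (abs_add_le _ _).trans ?_
  linarith [abs_cos_le_one (2 * π * k * y), abs_sin_le_one (2 * π * k * y)]

/-- Parseval's identity for the real trigonometric system `cas`. -/
lemma hasSum_integral_cas_sq {f : ℝ → ℝ} (hf : MemLp f 2 μ01) :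
    HasSum (fun k : ℤ => (∫ y, cas k y * f y ∂μ01) ^ 2) (∫ y, f y ^ 2 ∂μ01) := by
  have hfi : Integrable f μ01 := hf.integrable (by norm_num)
  set A : ℤ → ℝ := fun k => ∫ y, cos (2 * π * k * y) * f y ∂μ01 with hA
  set B : ℤ → ℝ := fun k => ∫ y, sin (2 * π * k * y) * f y ∂μ01 with hB
  have hc : ∀ k : ℤ, Integrable (fun y => cos (2 * π * k * y) * f y) μ01 := fun k =>
    hfi.bdd_mul (c := 1) (by fun_prop) (Eventually.of_forall fun y => abs_cos_le_one _)
  have hs : ∀ k : ℤ, Integrable (fun y => sin (2 * π * k * y) * f y) μ01 := fun k =>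
    hfi.bdd_mul (c := 1) (by fun_prop) (Eventually.of_forall fun y => abs_sin_le_one _)
  have hAB : ∀ k, ∫ y, cas k y * f y ∂μ01 = A k + B k := by
    intro k
    rw [hA, hB, ← integral_add (hc k) (hs k)]
    simp only [cas, add_mul]
  have hAneg : ∀ k, A (-k) = A k := by
    intro k
    simp only [hA, Int.cast_neg, mul_neg, neg_mul, cos_neg]
  have hBneg : ∀ k, B (-k) = - B k := by
    intro k
    simp only [hB, Int.cast_neg, mul_neg, neg_mul, sin_neg, integral_neg]
  have hfC : MemLp (fun y => (f y : ℂ)) 2 (volume.restrict (Set.Ioc 0 1)) := by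
    have h1 : volume.restrict (Set.Ioc (0 : ℝ) 1) = μ01 := by
      rw [μ01, Measure.restrict_congr_set Ioc_ae_eq_Icc]
    rw [h1]
    exact hf.ofReal
  have hnorm : ∀ k, ‖fourierCoeffOn zero_lt_one (fun y => (f y : ℂ)) k‖ ^ 2
      = A k ^ 2 + B k ^ 2 := by
    intro k
    have h1 : fourierCoeffOn zero_lt_one (fun y => (f y : ℂ)) k
        = (A k : ℂ) - (B k : ℂ) * Complex.I := by
      rw [fourierCoeffOn_eq_integral, ← integral_μ01]
      simp only [hA, hB]
      rw [← integral_complex_ofReal, ← integral_complex_ofReal, ← integral_mul_const,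
        ← integral_sub]
      · simp only [sub_zero, div_one, one_smul]
        refine integral_congr_ae (Eventually.of_forall fun y => ?_)
        have h2 : (fourier (-k) : C(AddCircle (1 - 0 : ℝ), ℂ)) (y : AddCircle (1 - 0 : ℝ))
            = cos (2 * π * k * y) - sin (2 * π * k * y) * Complex.I := by
          rw [fourier_coe_apply]
          have h3 : 2 * (π : ℂ) * Complex.I * ((-k : ℤ) : ℂ) * y / ((1 - 0 : ℝ) : ℂ)
              = ((-(2 * π * k * y) : ℝ) : ℂ) * Complex.I := by push_cast; ring
          rw [h3, Complex.exp_mul_I, ← Complex.ofReal_cos, ← Complex.ofReal_sin, cos_neg, sin_neg]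
          push_cast
          ring
        simp only [smul_eq_mul]
        rw [h2]
        push_cast
        ring
      · exact (hc k).ofReal
      · exact (hs k).ofReal.mul_const _
    rw [h1, ← Complex.normSq_eq_norm_sq, Complex.normSq_apply]
    simp
    ring
  have hsum := hasSum_sq_fourierCoeffOn zero_lt_one hfC
  simp only [hnorm, sub_zero, inv_one, one_smul, Complex.norm_real, Real.norm_eq_abs, sq_abs]
    at hsum
  rw [← integral_μ01] at hsum
  have hABsum : Summable fun k => 2 * (A k * B k) := by
    refine Summable.of_norm_bounded hsum.summable fun k => ?_
    rw [Real.norm_eq_abs, abs_le]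
    constructor <;> nlinarith [sq_nonneg (A k + B k), sq_nonneg (A k - B k)]
  have h0 : ∑' k, 2 * (A k * B k) = 0 := by
    have h1 := (Equiv.neg ℤ).tsum_eq fun k => 2 * (A k * B k)
    simp only [Equiv.neg_apply, hAneg, hBneg, mul_neg, tsum_neg] at h1
    linarith
  have h2 := hABsum.hasSum
  rw [h0] at h2
  have h3 := hsum.add h2
  rw [add_zero] at h3
  refine h3.congr_fun fun k => ?_
  rw [hAB]
  ring

/-- Measurable kernels which are bounded on the unit square. -/
structure BddKernel (g : ℝ → ℝ → ℝ) : Prop where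
  meas : Measurable (Function.uncurry g)
  bdd : ∃ C, ∀ x ∈ Set.Icc (0 : ℝ) 1, ∀ y ∈ Set.Icc (0 : ℝ) 1, |g x y| ≤ C

lemma BddKernel.sub {g h : ℝ → ℝ → ℝ} (hg : BddKernel g) (hh : BddKernel h) :
    BddKernel (fun x y => g x y - h x y) := by
  obtain ⟨C, hC⟩ := hg.bdd
  obtain ⟨D, hD⟩ := hh.bdd
  refine ⟨hg.meas.sub hh.meas, C + D, fun x hx y hy => ?_⟩
  exact (abs_sub _ _).trans (add_le_add (hC x hx y hy) (hD x hx y hy))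

variable {g : ℝ → ℝ → ℝ}

lemma BddKernel.meas_left (hg : BddKernel g) (y : ℝ) : Measurable fun x => g x y :=
  hg.meas.comp (measurable_id.prodMk measurable_const)

lemma BddKernel.meas_right (hg : BddKernel g) (x : ℝ) : Measurable (g x) :=
  hg.meas.comp (measurable_const.prodMk measurable_id)

lemma BddKernel.memLp_left (hg : BddKernel g) {y : ℝ} (hy : y ∈ Set.Icc (0 : ℝ) 1) :
    MemLp (fun x => g x y) 2 μ01 := by
  obtain ⟨C, hC⟩ := hg.bdd
  exact MemLp.of_bound (hg.meas_left y).aestronglyMeasurable C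
    (ae_mem_Icc.mono fun x hx => hC x hx y hy)

lemma BddKernel.memLp_right (hg : BddKernel g) {x : ℝ} (hx : x ∈ Set.Icc (0 : ℝ) 1) :
    MemLp (g x) 2 μ01 := by
  obtain ⟨C, hC⟩ := hg.bdd
  exact MemLp.of_bound (hg.meas_right x).aestronglyMeasurable C
    (ae_mem_Icc.mono fun y hy => hC x hx y hy)

/-- The function `x ↦ ∫ cas k y * g x y dy`. -/
noncomputable def kernelFun (g : ℝ → ℝ → ℝ) (k : ℤ) (x : ℝ) : ℝ := ∫ y, cas k y * g x y ∂μ01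

lemma BddKernel.measurable_kernelFun (hg : BddKernel g) (k : ℤ) : Measurable (kernelFun g k) := by
  have h : StronglyMeasurable (Function.uncurry fun x y => cas k y * g x y) :=
    (((continuous_cas k).measurable.comp measurable_snd).mul hg.meas).stronglyMeasurable
  exact h.integral_prod_right.measurable

lemma BddKernel.abs_kernelFun_le (hg : BddKernel g) :
    ∃ C, ∀ k, ∀ x ∈ Set.Icc (0 : ℝ) 1, |kernelFun g k x| ≤ C := by
  obtain ⟨C, hC⟩ := hg.bdd
  refine ⟨2 * C, fun k x hx => ?_⟩
  have h := norm_integral_le_of_norm_le_const (μ := μ01) (f := fun y => cas k y * g x y)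
    (C := 2 * C) (ae_mem_Icc.mono fun y hy => by
      rw [norm_mul]
      exact mul_le_mul (abs_cas_le k y) (hC x hx y hy) (norm_nonneg _) (by norm_num))
  simpa [kernelFun] using h

lemma BddKernel.memLp_kernelFun (hg : BddKernel g) (k : ℤ) : MemLp (kernelFun g k) 2 μ01 := by
  obtain ⟨C, hC⟩ := hg.abs_kernelFun_le
  exact MemLp.of_bound (hg.measurable_kernelFun k).aestronglyMeasurable C
    (ae_mem_Icc.mono fun x hx => hC k x hx)

lemma BddKernel.hasSum_kernelFun_sq (hg : BddKernel g) {x : ℝ} (hx : x ∈ Set.Icc (0 : ℝ) 1) :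
    HasSum (fun k => kernelFun g k x ^ 2) (∫ y, g x y ^ 2 ∂μ01) :=
  hasSum_integral_cas_sq (hg.memLp_right hx)

lemma BddKernel.hasSum_integral_kernelFun_sq (hg : BddKernel g) :
    HasSum (fun k => ∫ x, kernelFun g k x ^ 2 ∂μ01) (∫ x, ∫ y, g x y ^ 2 ∂μ01 ∂μ01) := by
  have hi : ∀ k, Integrable (fun x => kernelFun g k x ^ 2) μ01 := fun k =>
    (hg.memLp_kernelFun k).integrable_sq
  obtain ⟨C, hC⟩ := hg.bdd
  have hs : Summable fun k => ∫ x, kernelFun g k x ^ 2 ∂μ01 := by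
    refine summable_of_sum_le (c := C ^ 2) (fun k => integral_nonneg fun x => sq_nonneg _)
      fun F => ?_
    rw [← integral_finsetSum _ fun k _ => hi k]
    have h1 : ∀ᵐ x ∂μ01, ∑ k ∈ F, kernelFun g k x ^ 2 ≤ C ^ 2 := by
      filter_upwards [ae_mem_Icc] with x hx
      have h2 := hg.hasSum_kernelFun_sq hx
      refine (sum_le_hasSum F (fun k _ => sq_nonneg _) h2).trans ?_
      have h3 : ∫ y, g x y ^ 2 ∂μ01 ≤ ∫ y, C ^ 2 ∂μ01 :=
        integral_mono_ae (hg.memLp_right hx).integrable_sq (integrable_const _)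
          (ae_mem_Icc.mono fun y hy => by
            show g x y ^ 2 ≤ C ^ 2
            rw [← sq_abs]
            exact pow_le_pow_left₀ (abs_nonneg _) (hC x hx y hy) 2)
      simpa using h3
    have h4 := integral_mono_ae (integrable_finsetSum _ fun k _ => hi k) (integrable_const (C ^ 2))
      h1
    simpa using h4
  have h := hasSum_integral_of_summable_integral_norm hi (by simpa using hs)
  have h5 : ∫ x, ∫ y, g x y ^ 2 ∂μ01 ∂μ01 = ∫ x, ∑' k, kernelFun g k x ^ 2 ∂μ01 := ?_
  · rw [h5]
    exact h
  refine integral_congr_ae ?_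
  filter_upwards [ae_mem_Icc] with x hx
  exact (hg.hasSum_kernelFun_sq hx).tsum_eq.symm

lemma norm_sq_toLp {f : ℝ → ℝ} (hf : MemLp f 2 μ01) : ‖hf.toLp‖ ^ 2 = ∫ x, f x ^ 2 ∂μ01 := by
  rw [← real_inner_self_eq_norm_sq, L2.inner_def]
  refine integral_congr_ae ?_
  filter_upwards [hf.coeFn_toLp] with x hx
  rw [hx]
  simp [sq]

lemma inner_toLp {f : ℝ → ℝ} (hf : MemLp f 2 μ01) (h : Lp ℝ 2 μ01) :
    ⟪h, hf.toLp⟫ = ∫ x, h x * f x ∂μ01 := by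
  rw [L2.inner_def]
  refine integral_congr_ae ?_
  filter_upwards [hf.coeFn_toLp] with x hx
  rw [hx]
  simp [mul_comm]

/-- The coefficient sequence of a kernel in the second variable. -/
noncomputable def BddKernel.seq (hg : BddKernel g) : lp (fun _ : ℤ => Lp ℝ 2 μ01) 2 :=
  ⟨fun k => (hg.memLp_kernelFun k).toLp, by
    refine memℓp_gen ?_
    have h := hg.hasSum_integral_kernelFun_sq.summable
    simpa [← norm_sq_toLp (hg.memLp_kernelFun _)] using h⟩

lemma BddKernel.seq_apply (hg : BddKernel g) (k : ℤ) :
    hg.seq k = (hg.memLp_kernelFun k).toLp := rfl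

lemma BddKernel.tsum_norm_sq_seq (hg : BddKernel g) :
    ∑' k, ‖hg.seq k‖ ^ 2 = ∫ x, ∫ y, g x y ^ 2 ∂μ01 ∂μ01 := by
  simp only [BddKernel.seq_apply, norm_sq_toLp]
  exact hg.hasSum_integral_kernelFun_sq.tsum_eq

lemma BddKernel.integrable_mul_kernel (hg : BddKernel g) {f e : ℝ → ℝ} (hf : Integrable f μ01)
    (he : Integrable e μ01) :
    Integrable (Function.uncurry fun x y => f x * (e y * g x y)) (μ01.prod μ01) := by
  obtain ⟨C, hC⟩ := hg.bdd
  have h := (hf.mul_prod he).mul_bdd (g := Function.uncurry g) (c := C)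
    hg.meas.aestronglyMeasurable ?_
  · refine h.congr (Eventually.of_forall fun z => ?_)
    simp [Function.uncurry, mul_assoc]
  · have h1 : ∀ᵐ z ∂(μ01.prod μ01), z.1 ∈ Set.Icc (0 : ℝ) 1 ∧ z.2 ∈ Set.Icc (0 : ℝ) 1 :=
      (Measure.quasiMeasurePreserving_fst.ae ae_mem_Icc).and
        (Measure.quasiMeasurePreserving_snd.ae ae_mem_Icc)
    filter_upwards [h1] with z hz
    exact hC z.1 hz.1 z.2 hz.2

lemma BddKernel.inner_seq (hg : BddKernel g) (f : Lp ℝ 2 μ01) (k : ℤ) :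
    ⟪f, hg.seq k⟫ = ∫ y, cas k y * ∫ x, f x * g x y ∂μ01 ∂μ01 := by
  rw [BddKernel.seq_apply, inner_toLp]
  have hf : Integrable f μ01 := (Lp.memLp f).integrable (by norm_num)
  have hc : Integrable (cas k) μ01 := Integrable.of_bound (C := 2)
    (continuous_cas k).aestronglyMeasurable (Eventually.of_forall fun y => abs_cas_le k y)
  have h := integral_integral_swap (hg.integrable_mul_kernel hf hc)
  simp only [kernelFun, ← integral_const_mul] at h ⊢
  rw [h]
  simp only [mul_left_comm]

lemma BddKernel.memLp_integral_mul (hg : BddKernel g) (f : Lp ℝ 2 μ01) :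
    MemLp (fun y => ∫ x, f x * g x y ∂μ01) 2 μ01 := by
  have hf : Integrable f μ01 := (Lp.memLp f).integrable (by norm_num)
  obtain ⟨C, hC⟩ := hg.bdd
  have hi := hg.integrable_mul_kernel hf (integrable_const (1 : ℝ))
  simp only [one_mul] at hi
  refine MemLp.of_bound hi.integral_prod_right.aestronglyMeasurable (∫ x, ‖f x‖ * C ∂μ01) ?_
  filter_upwards [ae_mem_Icc] with y hy
  refine norm_integral_le_of_norm_le (hf.norm.mul_const C) ?_
  filter_upwards [ae_mem_Icc] with x hx
  rw [norm_mul]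
  exact mul_le_mul_of_nonneg_left (hC x hx y hy) (norm_nonneg _)

lemma BddKernel.tsum_inner_sq_seq (hg : BddKernel g) (f : Lp ℝ 2 μ01) :
    ∑' k, ⟪f, hg.seq k⟫ ^ 2 = ∫ y, (∫ x, f x * g x y ∂μ01) ^ 2 ∂μ01 := by
  simp only [hg.inner_seq]
  exact (hasSum_integral_cas_sq (hg.memLp_integral_mul f)).tsum_eq

lemma BddKernel.seq_sub {h : ℝ → ℝ → ℝ} (hg : BddKernel g) (hh : BddKernel h) :
    (hg.sub hh).seq = hg.seq - hh.seq := by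
  ext1
  funext k
  rw [lp.coeFn_sub, Pi.sub_apply]
  simp only [BddKernel.seq_apply]
  rw [← MemLp.toLp_sub]
  refine (MemLp.toLp_eq_toLp_iff _ _).2 ?_
  filter_upwards [ae_mem_Icc] with x hx
  have hb : ∀ {g : ℝ → ℝ → ℝ}, BddKernel g → Integrable (fun y => cas k y * g x y) μ01 := by
    intro g hg
    exact ((hg.memLp_right hx).integrable (by norm_num)).bdd_mul (c := 2)
      (continuous_cas k).aestronglyMeasurable (Eventually.of_forall fun y => abs_cas_le k y)
  simp only [kernelFun, Pi.sub_apply, mul_sub]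
  exact integral_sub (hb hg) (hb hh)

end Kernels

section Brownian

lemma charFun_map_eq_integral_inner {H : Type*} [NormedAddCommGroup H] [InnerProductSpace ℝ H]
    [MeasurableSpace H] [BorelSpace H] [SecondCountableTopology H] {Ω : Type*} [MeasurableSpace Ω]
    {P : Measure Ω} {X : Ω → H} (hX : AEStronglyMeasurable X P) (f : H) :
    charFun (P.map X) f
      = ∫ x : ℝ, Complex.exp (x * Complex.I) ∂(P.map fun ω => ⟪f, X ω⟫) := by
  rw [charFun_apply, integral_map hX.aemeasurable
    (Continuous.aestronglyMeasurable (by fun_prop)),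
    integral_map (hX.const_inner (c := f)).aemeasurable
    (Continuous.aestronglyMeasurable (by fun_prop))]
  simp only [real_inner_comm]

lemma distortion_eq_of_map_inner_eq {H : Type*} [NormedAddCommGroup H] [InnerProductSpace ℝ H]
    [CompleteSpace H] [SecondCountableTopology H] {Ω Ω' : Type*} [MeasurableSpace Ω]
    [MeasurableSpace Ω'] {P : Measure Ω} {P' : Measure Ω'} [IsProbabilityMeasure P]
    [IsProbabilityMeasure P'] {X : Ω → H} {X' : Ω' → H} (hX : AEStronglyMeasurable X P)
    (hX' : AEStronglyMeasurable X' P')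
    (h : ∀ f : H, P.map (fun ω => ⟪f, X ω⟫) = P'.map (fun ω => ⟪f, X' ω⟫)) (R : ℝ) :
    distortion P X R = distortion P' X' R := by
  let _ : MeasurableSpace H := borel H
  have : BorelSpace H := ⟨rfl⟩
  have := Measure.isProbabilityMeasure_map hX.aemeasurable
  have := Measure.isProbabilityMeasure_map hX'.aemeasurable
  refine distortion_eq_of_map_eq hX.aemeasurable hX'.aemeasurable
    (Measure.ext_of_charFun (funext fun f => ?_)) R
  rw [charFun_map_eq_integral_inner hX, charFun_map_eq_integral_inner hX', h f]

/-- The kernel `(x - y)₊ ^ β / Γ(β + 1)` of fractional integration of white noise. -/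
noncomputable def rlKernel (β x y : ℝ) : ℝ := max (x - y) 0 ^ β / Gamma (β + 1)

variable {β : ℝ}

lemma bddKernel_rlKernel (hβ : 0 < β) : BddKernel (rlKernel β) := by
  have hΓ : 0 < Gamma (β + 1) := Gamma_pos_of_pos (by linarith)
  refine ⟨?_, 1 / Gamma (β + 1), fun x hx y hy => ?_⟩
  · unfold Function.uncurry rlKernel
    fun_prop
  · unfold rlKernel
    rw [abs_div, abs_of_pos hΓ, abs_of_nonneg (rpow_nonneg (le_max_right _ _) _)]
    gcongr
    refine rpow_le_one (le_max_right _ _) ?_ hβ.le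
    exact max_le (by linarith [hx.2, hy.1]) zero_le_one

lemma integral_rpow_sub_indicator (hβ : 0 < β) {t y : ℝ} (ht : 0 ≤ t) (hy : 0 ≤ y) :
    ∫ v in (0 : ℝ)..t, (t - v) ^ (β - 1) * (Set.Ioi y).indicator 1 v
      = max (t - y) 0 ^ β / β := by
  rcases le_total t y with h | h
  · rw [max_eq_right (by linarith), zero_rpow hβ.ne', zero_div]
    rw [intervalIntegral.integral_of_le ht]
    refine setIntegral_eq_zero_of_forall_eq_zero fun v hv => ?_
    rw [Set.indicator_of_notMem (by simpa using hv.2.trans h), mul_zero]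
  · rw [max_eq_left (by linarith)]
    have h1 : ∀ a b : ℝ, IntervalIntegrable (fun v => (t - v) ^ (β - 1)) volume a b := by
      intro a b
      have := (intervalIntegral.intervalIntegrable_rpow' (a := t - a) (b := t - b)
        (r := β - 1) (by linarith)).comp_sub_left t
      simpa using this
    have h2 : ∫ v in (0 : ℝ)..t, (t - v) ^ (β - 1) * (Set.Ioi y).indicator 1 v
        = ∫ v in y..t, (t - v) ^ (β - 1) := by
      rw [intervalIntegral.integral_of_le ht, intervalIntegral.integral_of_le h]
      have h3 : ∀ v, (t - v) ^ (β - 1) * (Set.Ioi y).indicator 1 v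
          = (Set.Ioi y).indicator (fun v => (t - v) ^ (β - 1)) v := by
        intro v
        by_cases hv : v ∈ Set.Ioi y
        · simp [hv]
        · simp [hv]
      simp only [h3]
      rw [setIntegral_indicator measurableSet_Ioi]
      congr 2
      ext v
      simp only [Set.mem_inter_iff, Set.mem_Ioc, Set.mem_Ioi]
      constructor
      · rintro ⟨⟨_, h1⟩, h2⟩; exact ⟨h2, h1⟩
      · rintro ⟨h1, h2⟩; exact ⟨⟨by linarith, h2⟩, h1⟩
    rw [h2, intervalIntegral.integral_comp_sub_left (fun v => v ^ (β - 1)), sub_self,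
      integral_rpow (Or.inl (by linarith))]
    simp [zero_rpow hβ.ne']

lemma integral_rpow_sub_mul_integral (hβ : 0 < β) {t : ℝ} (ht : 0 ≤ t)
    {w : ℝ → ℝ} (hw : Measurable w) {C : ℝ} (hC : ∀ y ∈ Set.Icc (0 : ℝ) 1, |w y| ≤ C) :
    ∫ v in (0 : ℝ)..t, (t - v) ^ (β - 1) * ∫ y, (Set.Ioi y).indicator 1 v * w y ∂μ01
      = ∫ y, w y * (max (t - y) 0 ^ β / β) ∂μ01 := by
  have hInt : Integrable (fun v => (t - v) ^ (β - 1)) (volume.restrict (Set.Ioc 0 t)) := by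
    have := (intervalIntegral.intervalIntegrable_rpow' (a := t - 0) (b := t - t)
        (r := β - 1) (by linarith)).comp_sub_left t
    simp only [sub_sub_cancel] at this
    exact (intervalIntegrable_iff_integrableOn_Ioc_of_le ht).1 this
  have hwi : Integrable w μ01 := Integrable.of_bound hw.aestronglyMeasurable C
    (ae_mem_Icc.mono hC)
  have hset : MeasurableSet {z : ℝ × ℝ | z.2 < z.1} :=
    measurableSet_lt measurable_snd measurable_fst
  have h2 : Integrable (Function.uncurry fun v y => (t - v) ^ (β - 1) *
      ((Set.Ioi y).indicator 1 v * w y)) ((volume.restrict (Set.Ioc 0 t)).prod μ01) := by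
    refine ((hInt.mul_prod hwi).indicator hset).congr (Eventually.of_forall fun z => ?_)
    by_cases hz : z.2 < z.1
    · simp [Function.uncurry, hz]
    · simp [Function.uncurry, hz]
  rw [intervalIntegral.integral_of_le ht]
  simp only [← integral_const_mul]
  rw [integral_integral_swap h2]
  refine integral_congr_ae ?_
  filter_upwards [ae_mem_Icc] with y hy
  rw [← integral_rpow_sub_indicator hβ ht hy.1, intervalIntegral.integral_of_le ht,
    ← integral_const_mul]
  refine integral_congr_ae (Eventually.of_forall fun v => ?_)
  simp only
  ring

lemma integral_indicator_mul_indicator {u v : ℝ} (hu : u ∈ Set.Icc (0 : ℝ) 1)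
    (hv : v ∈ Set.Icc (0 : ℝ) 1) :
    ∫ y, (Set.Ioi y).indicator 1 v * (Set.Ioi y).indicator (1 : ℝ → ℝ) u ∂μ01 = min u v := by
  have h : ∀ y, (Set.Ioi y).indicator 1 v * (Set.Ioi y).indicator (1 : ℝ → ℝ) u
      = (Set.Iio (min u v)).indicator 1 y := by
    intro y
    by_cases h1 : y < v <;> by_cases h2 : y < u <;> simp [Set.indicator, h1, h2]
  simp only [h]
  rw [integral_indicator_one measurableSet_Iio, μ01, measureReal_restrict_apply measurableSet_Iio]
  have : Set.Iio (min u v) ∩ Set.Icc 0 1 = Set.Ico 0 (min u v) := by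
    ext y
    simp only [Set.mem_inter_iff, Set.mem_Iio, Set.mem_Icc, Set.mem_Ico]
    constructor
    · rintro ⟨h1, h2, _⟩; exact ⟨h2, h1⟩
    · rintro ⟨h1, h2⟩; exact ⟨h2, h1, (h2.le.trans (min_le_left _ _)).trans hu.2⟩
  rw [this, Real.volume_real_Ico_of_le (le_min hu.1 hv.1), sub_zero]

/-- The covariance kernel as an integral over the white-noise variable. -/
lemma fibmKernel_eq_integral (hβ : 0 < β) {s t : ℝ} (hs : s ∈ Set.Icc (0 : ℝ) 1)
    (ht : t ∈ Set.Icc (0 : ℝ) 1) :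
    fibmKernel β s t = ∫ y, rlKernel β s y * rlKernel β t y ∂μ01 := by
  have hinner : ∀ u ∈ Set.Icc (0 : ℝ) 1,
      ∫ v in (0 : ℝ)..t, (t - v) ^ (β - 1) * min u v
        = ∫ y, (Set.Ioi y).indicator 1 u * (max (t - y) 0 ^ β / β) ∂μ01 := by
    intro u hu
    have hm : Measurable fun y : ℝ => (Set.Ioi y).indicator (1 : ℝ → ℝ) u := by
      have : (fun y : ℝ => (Set.Ioi y).indicator (1 : ℝ → ℝ) u) = (Set.Iio u).indicator 1 := by
        ext y
        by_cases h : y < u <;> simp [Set.indicator, h]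
      rw [this]
      exact measurable_one.indicator measurableSet_Iio
    rw [← integral_rpow_sub_mul_integral hβ ht.1 hm (C := 1)]
    · refine intervalIntegral.integral_congr fun v hv => ?_
      rw [Set.uIcc_of_le ht.1] at hv
      rw [integral_indicator_mul_indicator hu ⟨hv.1, hv.2.trans ht.2⟩]
    · intro y _
      by_cases h : y < u <;> simp [Set.indicator, h]
  unfold fibmKernel
  have h1 : ∫ u in (0 : ℝ)..s, (∫ v in (0 : ℝ)..t, (s - u) ^ (β - 1) * (t - v) ^ (β - 1) * min u v)
      = ∫ u in (0 : ℝ)..s, (s - u) ^ (β - 1) *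
        ∫ y, (Set.Ioi y).indicator 1 u * (max (t - y) 0 ^ β / β) ∂μ01 := by
    refine intervalIntegral.integral_congr fun u hu => ?_
    rw [Set.uIcc_of_le hs.1] at hu
    rw [← hinner u ⟨hu.1, hu.2.trans hs.2⟩, ← intervalIntegral.integral_const_mul]
    simp only [mul_assoc]
  rw [h1, integral_rpow_sub_mul_integral hβ hs.1 (by fun_prop) (C := 1 / β),
    ← integral_const_mul]
  · refine integral_congr_ae (Eventually.of_forall fun y => ?_)
    simp only [rlKernel, Gamma_add_one hβ.ne']
    field_simp
  · intro y hy
    rw [abs_of_nonneg (div_nonneg (rpow_nonneg (le_max_right _ _) _) hβ.le)]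
    gcongr
    exact rpow_le_one (le_max_right _ _) (max_le (by linarith [ht.2, hy.1]) zero_le_one) hβ.le

lemma integral_fibmKernel (hβ : 0 < β) (f : Lp ℝ 2 μ01) :
    ∫ s in (0:ℝ)..1, (∫ t in (0:ℝ)..1, f s * fibmKernel β s t * f t)
      = ∫ y, (∫ x, f x * rlKernel β x y ∂μ01) ^ 2 ∂μ01 := by
  have hg := bddKernel_rlKernel hβ
  have hf : Integrable f μ01 := (Lp.memLp f).integrable (by norm_num)
  set F : ℝ → ℝ := fun y => ∫ x, f x * rlKernel β x y ∂μ01 with hF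
  have hFi : Integrable F μ01 := (hg.memLp_integral_mul f).integrable (by norm_num)
  have hrow : ∀ s ∈ Set.Icc (0 : ℝ) 1, ∫ t, f s * fibmKernel β s t * f t ∂μ01
      = ∫ y, f s * (F y * rlKernel β s y) ∂μ01 := by
    intro s hs
    have h1 : ∀ᵐ t ∂μ01, f s * fibmKernel β s t * f t
        = ∫ y, f s * (f t * (rlKernel β s y * rlKernel β t y)) ∂μ01 := by
      filter_upwards [ae_mem_Icc] with t ht
      rw [fibmKernel_eq_integral hβ hs ht, integral_const_mul, integral_const_mul]
      ring
    rw [integral_congr_ae h1]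
    simp only [integral_const_mul]
    congr 1
    simp only [← integral_const_mul]
    rw [integral_integral_swap (hg.integrable_mul_kernel hf
      ((hg.memLp_right hs).integrable (by norm_num)))]
    refine integral_congr_ae (Eventually.of_forall fun y => ?_)
    simp only [hF, ← integral_mul_const]
    refine integral_congr_ae (Eventually.of_forall fun y => ?_)
    simp only
    ring
  simp only [← integral_μ01]
  rw [integral_congr_ae (ae_mem_Icc.mono hrow), integral_integral_swap
    (hg.integrable_mul_kernel hf hFi)]
  refine integral_congr_ae (Eventually.of_forall fun y => ?_)
  change ∫ x, f x * (F y * rlKernel β x y) ∂μ01 = F y ^ 2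
  rw [sq]
  nth_rewrite 2 [hF]
  rw [← integral_const_mul]
  refine integral_congr_ae (Eventually.of_forall fun x => ?_)
  simp only
  ring

/-- The distortion of a fractionally integrated Brownian motion is that of a Gaussian series. -/
lemma distortion_eq_gaussianSeries (hβ : 0 < β) {Ω : Type*} [MeasurableSpace Ω] {P : Measure Ω}
    [IsProbabilityMeasure P] {Y : Ω → Lp ℝ 2 μ01} (hYmeas : AEStronglyMeasurable Y P)
    (hGauss : ∀ f : Lp ℝ 2 μ01, ∃ v : ℝ≥0,
      Measure.map (fun ω => ⟪f, Y ω⟫) P = gaussianReal 0 v)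
    (hcov : ∀ f g : Lp ℝ 2 μ01,
      (∫ ω, ⟪f, Y ω⟫ * ⟪g, Y ω⟫ ∂P)
        = ∫ s in (0:ℝ)..1, (∫ t in (0:ℝ)..1, f s * fibmKernel β s t * g t)) (R : ℝ) :
    distortion P Y R
      = distortion (noiseMeasure ℤ) (gaussianSeries (bddKernel_rlKernel hβ).seq) R := by
  have : Fact ((2 : ENNReal) ≠ ⊤) := ⟨by norm_num⟩
  refine distortion_eq_of_map_inner_eq hYmeas (memLp_gaussianSeries _).1 (fun f => ?_) R
  obtain ⟨v, hv⟩ := hGauss f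
  rw [map_inner_gaussianSeries, hv]
  congr 1
  have h1 := integral_map (μ := P) (φ := fun ω => ⟪f, Y ω⟫) (f := fun x : ℝ => x ^ 2)
    (hYmeas.const_inner (c := f)).aemeasurable (by fun_prop)
  rw [hv, integral_sq_gaussianReal] at h1
  simp only [sq] at h1
  rw [hcov, integral_fibmKernel hβ, ← (bddKernel_rlKernel hβ).tsum_inner_sq_seq] at h1
  rw [← h1, Real.toNNReal_coe]

end Brownian

section Periodic

/-- The Gamma density of shape `β + 1`. -/
noncomputable def gammaDens (β u : ℝ) : ℝ := max u 0 ^ β * exp (-u) / Gamma (β + 1)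

/-- The periodization of the Gamma density, as a convolution kernel on the unit interval. -/
noncomputable def perKernel (β x y : ℝ) : ℝ := ∑' m : ℕ, gammaDens β (x - y + m)

variable {β : ℝ}

lemma gammaDens_nonneg (hβ : 0 < β) (u : ℝ) : 0 ≤ gammaDens β u := by
  have hΓ : 0 < Gamma (β + 1) := Gamma_pos_of_pos (by linarith)
  unfold gammaDens
  have : 0 ≤ max u 0 ^ β := rpow_nonneg (le_max_right _ _) _
  positivity

lemma gammaDens_of_nonpos (hβ : 0 < β) {u : ℝ} (hu : u ≤ 0) : gammaDens β u = 0 := by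
  simp [gammaDens, max_eq_right hu, zero_rpow hβ.ne']

@[fun_prop]
lemma measurable_gammaDens (β : ℝ) : Measurable (gammaDens β) := by
  unfold gammaDens
  fun_prop

/-- A power is dominated by an exponential. -/
lemma exists_rpow_le_exp_half (a : ℝ) : ∃ C > 0, ∀ u : ℝ, 1 ≤ u → u ^ a ≤ C * exp (u / 2) := by
  obtain ⟨n, hn⟩ := exists_nat_ge a
  refine ⟨2 ^ n * n.factorial, by positivity, fun u hu => ?_⟩
  have h1 : u ^ a ≤ u ^ n := by
    rw [← rpow_natCast]
    exact rpow_le_rpow_of_exponent_le hu hn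
  have h2 : (u / 2) ^ n / n.factorial ≤ exp (u / 2) :=
    pow_div_factorial_le_exp _ (by linarith) n
  have h3 : u ^ n = 2 ^ n * n.factorial * ((u / 2) ^ n / n.factorial) := by
    have : (n.factorial : ℝ) ≠ 0 := by positivity
    field_simp
    rw [← mul_pow]
    congr 1
    ring
  rw [h3] at h1
  exact h1.trans (by gcongr)

lemma exists_gammaDens_le (hβ : 0 < β) : ∃ C > 0, ∀ u, gammaDens β u ≤ C * exp (-u / 2) := by
  have hΓ : 0 < Gamma (β + 1) := Gamma_pos_of_pos (by linarith)
  obtain ⟨C, hC, h⟩ := exists_rpow_le_exp_half β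
  refine ⟨(C + 1) / Gamma (β + 1), by positivity, fun u => ?_⟩
  rcases le_total u 0 with hu | hu
  · rw [gammaDens_of_nonpos hβ hu]
    positivity
  · unfold gammaDens
    rw [max_eq_left hu]
    have h1 : u ^ β ≤ (C + 1) * exp (u / 2) := by
      rcases le_total u 1 with h1 | h1
      · have h2 := rpow_le_one hu h1 hβ.le
        have h3 := one_le_exp (show 0 ≤ u / 2 by linarith)
        nlinarith
      · have := h u h1
        have h3 := exp_pos (u / 2)
        nlinarith
    rw [div_mul_eq_mul_div]
    refine div_le_div_of_nonneg_right ?_ hΓ.le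
    calc u ^ β * exp (-u) ≤ (C + 1) * exp (u / 2) * exp (-u) := by gcongr
      _ = (C + 1) * exp (-u / 2) := by rw [mul_assoc, ← exp_add]; ring_nf

lemma exists_gammaDens_shift_le (hβ : 0 < β) :
    ∃ C > 0, ∀ z, -1 ≤ z → ∀ m : ℕ, gammaDens β (z + m) ≤ C * exp (-(1 / 2)) ^ m := by
  obtain ⟨C, hC, h⟩ := exists_gammaDens_le hβ
  refine ⟨C * exp (1 / 2), by positivity, fun z hz m => (h _).trans ?_⟩
  rw [mul_assoc, ← exp_nat_mul, ← exp_add]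
  gcongr
  linarith

lemma summable_exp_half_pow : Summable fun m : ℕ => exp (-(1 / 2)) ^ m :=
  summable_geometric_of_lt_one (exp_pos _).le (Real.exp_lt_one_iff.2 (by norm_num))

lemma summable_gammaDens_shift (hβ : 0 < β) {z : ℝ} (hz : -1 ≤ z) :
    Summable fun m : ℕ => gammaDens β (z + m) := by
  obtain ⟨C, hC, h⟩ := exists_gammaDens_shift_le hβ
  exact Summable.of_nonneg_of_le (fun m => gammaDens_nonneg hβ _) (h z hz)
    (summable_exp_half_pow.mul_left C)

lemma bddKernel_perKernel (hβ : 0 < β) : BddKernel (perKernel β) := by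
  obtain ⟨C, hC, h⟩ := exists_gammaDens_shift_le hβ
  refine ⟨?_, ∑' m : ℕ, C * exp (-(1 / 2)) ^ m, fun x hx y hy => ?_⟩
  · unfold Function.uncurry perKernel
    exact Measurable.tsum fun m => (measurable_gammaDens β).comp (by fun_prop)
  · have hz : -1 ≤ x - y := by linarith [hx.1, hy.2]
    unfold perKernel
    rw [abs_of_nonneg (tsum_nonneg fun m => gammaDens_nonneg hβ _)]
    exact (summable_gammaDens_shift hβ hz).tsum_le_tsum (h _ hz)
      (summable_exp_half_pow.mul_left C)

lemma integrable_gammaDens (hβ : 0 < β) : Integrable (gammaDens β) := by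
  have h := (GammaIntegral_convergent (s := β + 1) (by linarith)).div_const (Gamma (β + 1))
  refine ((integrable_indicator_iff measurableSet_Ioi).2 h).congr
    (Eventually.of_forall fun u => ?_)
  by_cases hu : 0 < u
  · simp [hu, gammaDens, max_eq_left hu.le, mul_comm]
  · simp [hu, gammaDens_of_nonpos hβ (not_lt.1 hu)]

lemma integral_mul_gammaDens (hβ : 0 < β) (f : ℝ → ℂ) :
    ∫ u, f u * (gammaDens β u : ℂ)
      = ∫ u in Set.Ioi (0 : ℝ), f u * (u ^ β * exp (-u) / Gamma (β + 1) : ℝ) := by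
  rw [← integral_indicator measurableSet_Ioi]
  refine integral_congr_ae (Eventually.of_forall fun u => ?_)
  by_cases hu : 0 < u
  · simp [hu, gammaDens, max_eq_left hu.le]
  · simp [hu, gammaDens_of_nonpos hβ (not_lt.1 hu)]

/-- Cosine transform of the Gamma density at integer frequencies. -/
noncomputable def cosCoef (β : ℝ) (k : ℤ) : ℝ := ∫ u, cos (2 * π * k * u) * gammaDens β u

/-- Sine transform of the Gamma density at integer frequencies. -/
noncomputable def sinCoef (β : ℝ) (k : ℤ) : ℝ := ∫ u, sin (2 * π * k * u) * gammaDens β u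

lemma integrable_cos_gammaDens (hβ : 0 < β) (k : ℤ) :
    Integrable fun u => cos (2 * π * k * u) * gammaDens β u :=
  (integrable_gammaDens hβ).bdd_mul (c := 1) (by fun_prop)
    (Eventually.of_forall fun y => abs_cos_le_one _)

lemma integrable_sin_gammaDens (hβ : 0 < β) (k : ℤ) :
    Integrable fun u => sin (2 * π * k * u) * gammaDens β u :=
  (integrable_gammaDens hβ).bdd_mul (c := 1) (by fun_prop)
    (Eventually.of_forall fun y => abs_sin_le_one _)

lemma cosCoef_neg (k : ℤ) : cosCoef β (-k) = cosCoef β k := by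
  simp only [cosCoef, Int.cast_neg, mul_neg, neg_mul, cos_neg]

lemma sinCoef_neg (k : ℤ) : sinCoef β (-k) = -sinCoef β k := by
  simp only [sinCoef, Int.cast_neg, mul_neg, neg_mul, sin_neg, integral_neg]

/-- The law with density `gammaDens β`. -/
noncomputable def gammaLaw (β : ℝ) : Measure ℝ :=
  volume.withDensity fun u => ((gammaDens β u).toNNReal : ENNReal)

lemma integral_gammaLaw (hβ : 0 < β) (f : ℝ → ℂ) :
    ∫ u, f u ∂gammaLaw β = ∫ u, f u * (gammaDens β u : ℂ) := by
  unfold gammaLaw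
  rw [integral_withDensity_eq_integral_smul (by fun_prop)]
  refine integral_congr_ae (Eventually.of_forall fun u => ?_)
  simp only [NNReal.smul_def, Real.coe_toNNReal _ (gammaDens_nonneg hβ u), Complex.real_smul]
  ring

lemma mem_integrableExpSet_gammaLaw (hβ : 0 < β) {t : ℝ} (ht : t < 1) :
    t ∈ integrableExpSet id (gammaLaw β) := by
  unfold integrableExpSet gammaLaw
  rw [Set.mem_ofPred_eq, integrable_withDensity_iff_integrable_smul (by fun_prop)]
  have h := (integrableOn_rpow_mul_exp_neg_mul_rpow (s := β) (p := 1) (b := 1 - t)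
    (by linarith) one_pos (by linarith)).div_const (Gamma (β + 1))
  refine ((integrable_indicator_iff measurableSet_Ioi).2 h).congr
    (Eventually.of_forall fun u => ?_)
  simp only [NNReal.smul_def, Real.coe_toNNReal _ (gammaDens_nonneg hβ u), smul_eq_mul, id]
  by_cases hu : 0 < u
  · have : exp (-(1 - t) * u) = exp (-u) * exp (t * u) := by
      rw [← exp_add]
      ring_nf
    simp only [Set.mem_Ioi, hu, Set.indicator_of_mem, rpow_one, this, gammaDens,
      max_eq_left hu.le]
    ring
  · simp [hu, gammaDens_of_nonpos hβ (not_lt.1 hu)]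

lemma complexMGF_gammaLaw_ofReal (hβ : 0 < β) {t : ℝ} (ht : t < 1) :
    complexMGF id (gammaLaw β) t = (1 / (1 - t : ℂ)) ^ ((β + 1 : ℝ) : ℂ) := by
  have hΓ : 0 < Gamma (β + 1) := Gamma_pos_of_pos (by linarith)
  unfold complexMGF
  rw [integral_gammaLaw hβ, integral_mul_gammaDens hβ]
  have hr : 0 < 1 - t := by linarith
  have h := Complex.integral_cpow_mul_exp_neg_mul_Ioi (a := ((β + 1 : ℝ) : ℂ))
    (r := 1 - t) (by simpa using by linarith) hr
  rw [Complex.Gamma_ofReal] at h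
  have hΓ' : (Gamma (β + 1) : ℂ) ≠ 0 := by exact_mod_cast hΓ.ne'
  rw [Complex.ofReal_sub, Complex.ofReal_one] at h
  rw [eq_comm, ← mul_div_cancel_right₀ ((1 / (1 - t : ℂ)) ^ ((β + 1 : ℝ) : ℂ)) hΓ',
    ← h, ← integral_div]
  refine setIntegral_congr_fun measurableSet_Ioi fun u hu => ?_
  have h1 : ((β + 1 : ℝ) : ℂ) - 1 = (β : ℂ) := by push_cast; ring
  simp only [h1, id]
  rw [← Complex.ofReal_cpow (le_of_lt hu)]
  have h2 : Complex.exp (-((1 - t) * u)) = Complex.exp (t * u) * (exp (-u) : ℝ) := by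
    rw [Complex.ofReal_exp, ← Complex.exp_add]
    congr 1
    push_cast
    ring
  rw [h2]
  push_cast
  ring

lemma complexMGF_gammaLaw (hβ : 0 < β) {z : ℂ} (hz : z.re < 1) :
    complexMGF id (gammaLaw β) z = (1 / (1 - z)) ^ ((β + 1 : ℝ) : ℂ) := by
  have hopen : IsOpen {z : ℂ | z.re < 1} := isOpen_lt Complex.continuous_re continuous_const
  have hI : Set.Iio (1 : ℝ) ⊆ interior (integrableExpSet id (gammaLaw β)) :=
    isOpen_Iio.subset_interior_iff.2 fun t ht => mem_integrableExpSet_gammaLaw hβ ht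
  have h1 : AnalyticOnNhd ℂ (complexMGF id (gammaLaw β)) {z : ℂ | z.re < 1} :=
    analyticOnNhd_complexMGF.mono fun w hw => hI hw
  have h2 : AnalyticOnNhd ℂ (fun z : ℂ => (1 / (1 - z)) ^ ((β + 1 : ℝ) : ℂ))
      {z : ℂ | z.re < 1} := by
    refine DifferentiableOn.analyticOnNhd (fun w hw => ?_) hopen
    have hre : 0 < (1 - w).re := by
      have : w.re < 1 := hw
      simpa using this
    have hne : 1 - w ≠ 0 := fun h0 => by simp [h0] at hre
    refine (DifferentiableAt.cpow (f := fun w : ℂ => 1 / (1 - w)) ?_ (by fun_prop)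
      ?_).differentiableWithinAt
    · exact (by fun_prop : DifferentiableAt ℂ (fun _ : ℂ => (1 : ℂ)) w).div (by fun_prop) hne
    · left
      rw [one_div, Complex.inv_re]
      exact div_pos hre (Complex.normSq_pos.2 hne)
  refine AnalyticOnNhd.eqOn_of_preconnected_of_frequently_eq h1 h2
    ((convex_Iio (1 : ℝ)).linear_preimage Complex.reLm).isPreconnected
    (z₀ := ((0 : ℝ) : ℂ)) (by simp) ?_ hz
  have h_real : ∃ᶠ x : ℝ in nhdsWithin 0 {0}ᶜ, complexMGF id (gammaLaw β) x
      = (1 / (1 - (x : ℂ))) ^ ((β + 1 : ℝ) : ℂ) := by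
    refine Eventually.frequently ?_
    filter_upwards [mem_nhdsWithin_of_mem_nhds (Iio_mem_nhds (show (0 : ℝ) < 1 by norm_num))]
      with x hx
    exact complexMGF_gammaLaw_ofReal hβ hx
  rw [frequently_iff_seq_forall] at h_real ⊢
  obtain ⟨xs, hx_tendsto, hx_eq⟩ := h_real
  refine ⟨fun n => xs n, ?_, fun n => hx_eq n⟩
  rw [tendsto_nhdsWithin_iff] at hx_tendsto ⊢
  constructor
  · exact (Complex.continuous_ofReal.tendsto 0).comp hx_tendsto.1
  · simpa using hx_tendsto.2

lemma integral_cexp_gammaDens (hβ : 0 < β) (k : ℤ) :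
    ∫ u : ℝ, Complex.exp (-(2 * π * k * u * Complex.I)) * (gammaDens β u : ℂ)
      = (1 / (1 + 2 * π * k * Complex.I)) ^ ((β + 1 : ℝ) : ℂ) := by
  have h := complexMGF_gammaLaw hβ (z := -(2 * π * k * Complex.I)) (by simp)
  rw [sub_neg_eq_add] at h
  rw [← h, complexMGF, integral_gammaLaw hβ]
  refine integral_congr_ae (Eventually.of_forall fun u => ?_)
  simp only [id]
  congr 2
  ring

/-- Eigenvalues of the periodic convolution operator. -/
noncomputable def eigval (β : ℝ) (k : ℤ) : ℝ := (1 + (2 * π * k) ^ 2) ^ (-(β + 1))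

lemma eigval_pos (k : ℤ) : 0 < eigval β k := rpow_pos_of_pos (by positivity) _

lemma cosCoef_sq_add_sinCoef_sq (hβ : 0 < β) (k : ℤ) :
    cosCoef β k ^ 2 + sinCoef β k ^ 2 = eigval β k := by
  have h1 : (cosCoef β k : ℂ) - sinCoef β k * Complex.I
      = (1 / (1 + 2 * π * k * Complex.I)) ^ ((β + 1 : ℝ) : ℂ) := by
    rw [← integral_cexp_gammaDens hβ k]
    unfold cosCoef sinCoef
    rw [← integral_complex_ofReal, ← integral_complex_ofReal, ← integral_mul_const,
      ← integral_sub]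
    · refine integral_congr_ae (Eventually.of_forall fun u => ?_)
      have h3 : -(2 * π * k * u * Complex.I)
          = ((-(2 * π * k * u) : ℝ) : ℂ) * Complex.I := by push_cast; ring
      simp only
      rw [h3, Complex.exp_mul_I, ← Complex.ofReal_cos, ← Complex.ofReal_sin, cos_neg, sin_neg]
      push_cast
      ring
    · exact (integrable_cos_gammaDens hβ k).ofReal
    · exact (integrable_sin_gammaDens hβ k).ofReal.mul_const _
  have h2 : cosCoef β k ^ 2 + sinCoef β k ^ 2
      = ‖(cosCoef β k : ℂ) - sinCoef β k * Complex.I‖ ^ 2 := by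
    rw [← Complex.normSq_eq_norm_sq, Complex.normSq_apply]
    simp
    ring
  have h3 : ‖(1 + 2 * π * k * Complex.I : ℂ)‖ ^ 2 = 1 + (2 * π * k) ^ 2 := by
    rw [← Complex.normSq_eq_norm_sq, Complex.normSq_apply]
    simp
    ring
  rw [h2, h1, Complex.norm_cpow_real, norm_div, norm_one, one_div, eigval, ← h3,
    inv_rpow (norm_nonneg _), ← rpow_neg (norm_nonneg _), ← rpow_natCast, ← rpow_natCast,
    ← rpow_mul (norm_nonneg _), ← rpow_mul (norm_nonneg _)]
  ring_nf

/-- The kernel functions of the periodized kernel. -/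
lemma kernelFun_perKernel (hβ : 0 < β) (k : ℤ) {x : ℝ} (hx : x ∈ Set.Icc (0 : ℝ) 1) :
    kernelFun (perKernel β) k x = cosCoef β k * cas k x - sinCoef β k * cas (-k) x := by
  set F : ℝ → ℝ := fun u => cas k (x - u) * gammaDens β u with hF
  have hFi : Integrable F := (integrable_gammaDens hβ).bdd_mul (c := 2) (by fun_prop)
    (Eventually.of_forall fun y => abs_cas_le k _)
  have hFF : ∫ u, F u = cosCoef β k * cas k x - sinCoef β k * cas (-k) x := by
    unfold cosCoef sinCoef
    rw [← integral_mul_const, ← integral_mul_const, ← integral_sub]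
    · refine integral_congr_ae (Eventually.of_forall fun u => ?_)
      simp only [hF, cas, Int.cast_neg, mul_neg, neg_mul, cos_neg, sin_neg, mul_sub, cos_sub,
        sin_sub]
      ring
    · exact (integrable_cos_gammaDens hβ k).mul_const _
    · exact (integrable_sin_gammaDens hβ k).mul_const _
  have hper : ∀ (m : ℤ) (y : ℝ), cas k (y - m) = cas k y := by
    intro m y
    have h1 : 2 * π * k * (y - m) = 2 * π * k * y - ((k * m : ℤ) : ℝ) * (2 * π) := by
      push_cast; ring
    simp only [cas]
    rw [h1, cos_sub_int_mul_two_pi, sin_sub_int_mul_two_pi]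
  have hblock : ∀ m : ℤ, ∫ u in (x - 1 + m)..(x - 1 + m + 1), F u
      = ∫ y, cas k y * gammaDens β (x - y + m) ∂μ01 := by
    intro m
    rw [integral_μ01]
    have h1 : ∀ y, cas k y * gammaDens β (x - y + m) = F (x + m - y) := by
      intro y
      simp only [hF]
      rw [show x - (x + m - y) = y - m by ring, hper, show x + m - y = x - y + m by ring]
    simp only [h1]
    rw [intervalIntegral.integral_comp_sub_left (fun u => F u)]
    congr 1 <;> ring
  have h1 := hFi.hasSum_intervalIntegral (x - 1)
  simp only [hblock] at h1
  have h2 : HasSum (fun m : ℕ => ∫ y, cas k y * gammaDens β (x - y + m) ∂μ01) (∫ u, F u) := by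
    have h3 := (Function.Injective.hasSum_iff (g := fun m : ℕ => (m : ℤ)) Nat.cast_injective
      (f := fun m : ℤ => ∫ y, cas k y * gammaDens β (x - y + m) ∂μ01) (a := ∫ u, F u) ?_).2 h1
    · simpa [Function.comp_def] using h3
    · intro m hm
      have hm' : (m : ℝ) ≤ -1 := by
        have : m < 0 := by
          by_contra hc
          exact hm ⟨m.toNat, by simpa using (not_lt.1 hc)⟩
        exact_mod_cast Int.le_sub_one_of_lt this
      have h4 : ∀ᵐ y ∂μ01, cas k y * gammaDens β (x - y + m) = 0 := by
        filter_upwards [ae_mem_Icc] with y hy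
        rw [gammaDens_of_nonpos hβ (by linarith [hx.2, hy.1]), mul_zero]
      rw [integral_congr_ae h4, integral_zero]
  rw [← hFF, ← h2.tsum_eq]
  obtain ⟨C, hC, hbound⟩ := exists_gammaDens_shift_le hβ
  have hb2 : ∀ m : ℕ, ∀ᵐ y ∂μ01, ‖cas k y * gammaDens β (x - y + m)‖
      ≤ 2 * (C * exp (-(1 / 2)) ^ m) := by
    intro m
    filter_upwards [ae_mem_Icc] with y hy
    rw [norm_mul, Real.norm_eq_abs, Real.norm_eq_abs, abs_of_nonneg (gammaDens_nonneg hβ _)]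
    exact mul_le_mul (abs_cas_le k y) (hbound _ (by linarith [hx.1, hy.2]) m)
      (gammaDens_nonneg hβ _) (by norm_num)
  have hInt : ∀ m : ℕ, Integrable (fun y => cas k y * gammaDens β (x - y + m)) μ01 := fun m =>
    Integrable.of_bound (((continuous_cas k).measurable.mul
      ((measurable_gammaDens β).comp (by fun_prop))).aestronglyMeasurable) _ (hb2 m)
  have hsumm : Summable fun m : ℕ => ∫ y, ‖cas k y * gammaDens β (x - y + m)‖ ∂μ01 := by
    refine Summable.of_nonneg_of_le (fun m => integral_nonneg fun y => norm_nonneg _) (fun m => ?_)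
      ((summable_exp_half_pow.mul_left C).mul_left 2)
    have := integral_mono_ae (hInt m).norm (integrable_const _) (hb2 m)
    simpa using this
  rw [(hasSum_integral_of_summable_integral_norm hInt hsumm).tsum_eq]
  unfold kernelFun perKernel
  simp only [tsum_mul_left]

lemma integral_cos_int (m : ℤ) :
    ∫ y, cos (2 * π * m * y) ∂μ01 = if m = 0 then 1 else 0 := by
  split_ifs with h
  · simp [h]
  · have hm : (2 * π * m : ℝ) ≠ 0 := by
      have : (m : ℝ) ≠ 0 := by exact_mod_cast h
      positivity
    rw [integral_μ01, intervalIntegral.integral_comp_mul_left cos hm, integral_cos]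
    have : 2 * π * m = ((2 * m : ℤ) : ℝ) * π := by push_cast; ring
    rw [mul_one, mul_zero, this, sin_int_mul_pi]
    simp

lemma integral_sin_int (m : ℤ) : ∫ y, sin (2 * π * m * y) ∂μ01 = 0 := by
  by_cases h : m = 0
  · simp [h]
  · have hm : (2 * π * m : ℝ) ≠ 0 := by
      have : (m : ℝ) ≠ 0 := by exact_mod_cast h
      positivity
    rw [integral_μ01, intervalIntegral.integral_comp_mul_left sin hm, integral_sin]
    have : 2 * π * m = (m : ℝ) * (2 * π) := by ring
    rw [mul_one, mul_zero, this, cos_int_mul_two_pi]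
    simp

lemma integral_cas_mul_cas (j k : ℤ) :
    ∫ y, cas j y * cas k y ∂μ01 = if j = k then 1 else 0 := by
  have h : ∀ y, cas j y * cas k y
      = cos (2 * π * (j - k : ℤ) * y) + sin (2 * π * (j + k : ℤ) * y) := by
    intro y
    have h1 : 2 * π * (j - k : ℤ) * y = 2 * π * j * y - 2 * π * k * y := by push_cast; ring
    have h2 : 2 * π * (j + k : ℤ) * y = 2 * π * j * y + 2 * π * k * y := by push_cast; ring
    rw [h1, h2, cos_sub, sin_add]
    simp only [cas]
    ring
  simp only [h]
  rw [integral_add, integral_cos_int, integral_sin_int, add_zero]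
  · simp only [sub_eq_zero]
  · exact Integrable.of_bound (C := 1) (by fun_prop)
      (Eventually.of_forall fun y => abs_cos_le_one _)
  · exact Integrable.of_bound (C := 1) (by fun_prop)
      (Eventually.of_forall fun y => abs_sin_le_one _)

lemma integrable_cas_mul_cas (j k : ℤ) : Integrable (fun y => cas j y * cas k y) μ01 := by
  refine Integrable.of_bound (C := 2 * 2) (by fun_prop) (Eventually.of_forall fun y => ?_)
  rw [norm_mul]
  exact mul_le_mul (abs_cas_le j y) (abs_cas_le k y) (norm_nonneg _) (by norm_num)

lemma inner_seq_perKernel (hβ : 0 < β) (j k : ℤ) :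
    ⟪(bddKernel_perKernel hβ).seq j, (bddKernel_perKernel hβ).seq k⟫
      = if j = k then eigval β k else 0 := by
  have hg := bddKernel_perKernel hβ
  rw [hg.seq_apply k, inner_toLp]
  have h1 : ∀ᵐ x ∂μ01, hg.seq j x * kernelFun (perKernel β) k x
      = cosCoef β j * cosCoef β k * (cas j x * cas k x)
        - cosCoef β j * sinCoef β k * (cas j x * cas (-k) x)
        - sinCoef β j * cosCoef β k * (cas (-j) x * cas k x)
        + sinCoef β j * sinCoef β k * (cas (-j) x * cas (-k) x) := by
    filter_upwards [ae_mem_Icc, (hg.memLp_kernelFun j).coeFn_toLp] with x hx hx2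
    rw [hg.seq_apply, hx2, kernelFun_perKernel hβ j hx, kernelFun_perKernel hβ k hx]
    ring
  rw [integral_congr_ae h1, integral_add (by
      exact (((integrable_cas_mul_cas _ _).const_mul _).sub
        ((integrable_cas_mul_cas _ _).const_mul _)).sub ((integrable_cas_mul_cas _ _).const_mul _))
      ((integrable_cas_mul_cas _ _).const_mul _),
    integral_sub (by
      exact (((integrable_cas_mul_cas _ _).const_mul _).sub
        ((integrable_cas_mul_cas _ _).const_mul _))) ((integrable_cas_mul_cas _ _).const_mul _),
    integral_sub ((integrable_cas_mul_cas _ _).const_mul _)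
      ((integrable_cas_mul_cas _ _).const_mul _)]
  simp only [integral_const_mul, integral_cas_mul_cas]
  by_cases h : j = k
  · subst h
    rw [← cosCoef_sq_add_sinCoef_sq hβ]
    by_cases h0 : j = -j
    · have : j = 0 := by omega
      subst this
      simp [sinCoef]
      ring
    · simp [h0, Ne.symm h0]
      ring
  · by_cases h0 : j = -k
    · subst h0
      simp [h, Ne.symm h, cosCoef_neg, sinCoef_neg]
      ring
    · have h3 : ¬ (-j = k) := fun hc => h0 (by omega)
      simp [h, h0, h3]

/-- The coefficients of the periodized kernel are multiples of an orthonormal family. -/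
lemma exists_orthonormal_seq_perKernel (hβ : 0 < β) :
    ∃ φ : ℤ → Lp ℝ 2 μ01, Orthonormal ℝ φ ∧
      ∀ k, (bddKernel_perKernel hβ).seq k = √(eigval β k) • φ k := by
  have hpos : ∀ k, 0 < √(eigval β k) := fun k => Real.sqrt_pos.2 (eigval_pos k)
  refine ⟨fun k => (√(eigval β k))⁻¹ • (bddKernel_perKernel hβ).seq k, ?_, fun k => ?_⟩
  · rw [orthonormal_iff_ite]
    intro j k
    rw [real_inner_smul_left, real_inner_smul_right, inner_seq_perKernel hβ]
    split_ifs with h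
    · subst h
      rw [← mul_assoc, ← mul_inv, Real.mul_self_sqrt (eigval_pos j).le,
        inv_mul_cancel₀ (eigval_pos j).ne']
    · simp
  · rw [smul_smul, mul_inv_cancel₀ (hpos k).ne', one_smul]

end Periodic

section PolynomialApproximation

/-- `f` is within `ε` of a polynomial of degree less than `d` on `[x₀, x₀ + h]`. -/
def PolyApprox (d : ℕ) (x₀ h : ℝ) (f : ℝ → ℝ) (ε : ℝ) : Prop :=
  ∃ c : ℕ → ℝ, ∀ x ∈ Set.Icc x₀ (x₀ + h), |f x - ∑ j ∈ Finset.range d, c j * x ^ j| ≤ ε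

variable {d : ℕ} {x₀ h : ℝ} {f g : ℝ → ℝ} {ε ε' : ℝ}

lemma polyApprox_of_abs_le (hf : ∀ x ∈ Set.Icc x₀ (x₀ + h), |f x| ≤ ε) :
    PolyApprox d x₀ h f ε := ⟨0, by simpa using hf⟩

lemma PolyApprox.mono (hf : PolyApprox d x₀ h f ε) (hε : ε ≤ ε') : PolyApprox d x₀ h f ε' := by
  obtain ⟨c, hc⟩ := hf
  exact ⟨c, fun x hx => (hc x hx).trans hε⟩

lemma PolyApprox.congr (hf : PolyApprox d x₀ h f ε)
    (hfg : ∀ x ∈ Set.Icc x₀ (x₀ + h), f x = g x) : PolyApprox d x₀ h g ε := by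
  obtain ⟨c, hc⟩ := hf
  exact ⟨c, fun x hx => hfg x hx ▸ hc x hx⟩

lemma PolyApprox.add (hf : PolyApprox d x₀ h f ε) (hg : PolyApprox d x₀ h g ε') :
    PolyApprox d x₀ h (fun x => f x + g x) (ε + ε') := by
  obtain ⟨c, hc⟩ := hf
  obtain ⟨c', hc'⟩ := hg
  refine ⟨fun j => c j + c' j, fun x hx => ?_⟩
  have h1 : f x + g x - ∑ j ∈ Finset.range d, (c j + c' j) * x ^ j
      = (f x - ∑ j ∈ Finset.range d, c j * x ^ j)
        + (g x - ∑ j ∈ Finset.range d, c' j * x ^ j) := by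
    simp only [add_mul, Finset.sum_add_distrib]
    ring
  rw [h1]
  exact (abs_add_le _ _).trans (add_le_add (hc x hx) (hc' x hx))

lemma PolyApprox.const_mul (hf : PolyApprox d x₀ h f ε) (a : ℝ) :
    PolyApprox d x₀ h (fun x => a * f x) (|a| * ε) := by
  obtain ⟨c, hc⟩ := hf
  refine ⟨fun j => a * c j, fun x hx => ?_⟩
  have h1 : a * f x - ∑ j ∈ Finset.range d, a * c j * x ^ j
      = a * (f x - ∑ j ∈ Finset.range d, c j * x ^ j) := by
    simp only [mul_assoc, ← Finset.mul_sum]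
    ring
  rw [h1, abs_mul]
  exact mul_le_mul_of_nonneg_left (hc x hx) (abs_nonneg a)

lemma PolyApprox.sum {ι : Type*} (s : Finset ι) {F : ι → ℝ → ℝ} {e : ι → ℝ}
    (hF : ∀ i ∈ s, PolyApprox d x₀ h (F i) (e i)) :
    PolyApprox d x₀ h (fun x => ∑ i ∈ s, F i x) (∑ i ∈ s, e i) := by
  classical
  induction s using Finset.induction_on with
  | empty => exact polyApprox_of_abs_le (by simp)
  | insert i s hi ih =>
    simp only [Finset.sum_insert hi]
    exact (hF i (Finset.mem_insert_self _ _)).add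
      (ih fun j hj => hF j (Finset.mem_insert_of_mem hj))

/-- Approximating a derivative gives an approximation of the function, one degree higher. -/
lemma PolyApprox.of_hasDerivAt {f' : ℝ → ℝ} (hh : 0 ≤ h)
    (hf : ∀ x ∈ Set.Icc x₀ (x₀ + h), HasDerivAt f (f' x) x) (hε : 0 ≤ ε)
    (hf' : PolyApprox d x₀ h f' ε) : PolyApprox (d + 1) x₀ h f (ε * h) := by
  obtain ⟨c, hc⟩ := hf'
  set P : ℝ → ℝ := fun x => ∑ j ∈ Finset.range d, c j / (j + 1) * x ^ (j + 1) with hP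
  have hPd : ∀ x, HasDerivAt P (∑ j ∈ Finset.range d, c j * x ^ j) x := by
    intro x
    refine HasDerivAt.fun_sum fun j _ => ?_
    have h1 := (hasDerivAt_pow (j + 1) x).const_mul (c j / (j + 1))
    refine h1.congr_deriv ?_
    have : (j + 1 : ℝ) ≠ 0 := by positivity
    rw [Nat.add_sub_cancel, Nat.cast_add, Nat.cast_one, ← mul_assoc, div_mul_cancel₀ _ this]
  refine ⟨fun j => if j = 0 then f x₀ - P x₀ else c (j - 1) / j, fun x hx => ?_⟩
  have h2 : ∑ j ∈ Finset.range (d + 1), (if j = 0 then f x₀ - P x₀ else c (j - 1) / j) * x ^ j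
      = P x + (f x₀ - P x₀) := by
    rw [Finset.sum_range_succ']
    simp [hP]
  rw [h2]
  have h3 := Convex.norm_image_sub_le_of_norm_hasDerivWithin_le (𝕜 := ℝ)
    (f := fun x => f x - P x) (C := ε) (s := Set.Icc x₀ (x₀ + h)) (x := x₀) (y := x)
    (fun y hy => ((hf y hy).sub (hPd y)).hasDerivWithinAt)
    (fun y hy => hc y hy) (convex_Icc _ _) ⟨le_rfl, by linarith⟩ hx
  rw [show f x - (P x + (f x₀ - P x₀)) = (f x - P x) - (f x₀ - P x₀) by ring]
  refine h3.trans (mul_le_mul_of_nonneg_left ?_ hε)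
  rw [Real.norm_eq_abs, abs_of_nonneg (by linarith [hx.1])]
  linarith [hx.2]

/-- Polynomial approximation of `u ^ a * exp (-c u)` away from the origin. -/
lemma exists_polyApprox_rpow_mul_exp (d : ℕ) {c : ℝ} (hc : c = 0 ∨ c = 1) (n : ℕ) {a : ℝ}
    (ha : -(n : ℝ) ≤ a) : ∃ C ≥ 0, ∀ L ≥ 1, ∀ h ≥ 0, ∀ x₀ s : ℝ, 1 ≤ L * (x₀ + s) →
      (c = 1 ∨ x₀ + s + h ≤ 2) →
      PolyApprox d x₀ h (fun x => (x + s) ^ a * exp (-(c * (x + s))))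
        (C * h ^ d * L ^ (n + d) * exp (-(c * (x₀ + s) / 2))) := by
  induction d generalizing n a with
  | zero =>
    obtain ⟨C, hC, hexp⟩ := exists_rpow_le_exp_half a
    refine ⟨(C + 1) * exp 1, by positivity, fun L hL h hh x₀ s hu hcase =>
      polyApprox_of_abs_le fun x hx => ?_⟩
    have hL0 : 0 < L := by linarith
    have hu0 : 0 < x₀ + s := pos_of_mul_pos_right (by linarith) hL0.le
    have hxu : x₀ + s ≤ x + s := by linarith [hx.1]
    have hxu0 : 0 < x + s := by linarith
    have hLn : 1 ≤ L ^ n := one_le_pow₀ hL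
    have h1 : (x + s) ^ a ≤ (C + 1) * L ^ n * exp ((x + s) / 2) := by
      have he : 1 ≤ exp ((x + s) / 2) := one_le_exp (by linarith)
      rcases le_total 1 (x + s) with h1 | h1
      · calc (x + s) ^ a ≤ C * exp ((x + s) / 2) := hexp _ h1
          _ ≤ (C + 1) * L ^ n * exp ((x + s) / 2) := by
            gcongr
            nlinarith
      · have h2 : (x + s) ^ a ≤ L ^ n := by
          calc (x + s) ^ a ≤ (x + s) ^ (-(n : ℝ)) := rpow_le_rpow_of_exponent_ge hxu0 h1 ha
            _ = ((x + s)⁻¹) ^ n := by rw [rpow_neg hxu0.le, rpow_natCast, inv_pow]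
            _ ≤ L ^ n := by
              gcongr
              rw [inv_le_comm₀ hxu0 hL0, inv_le_iff_one_le_mul₀ hL0]
              nlinarith
        calc (x + s) ^ a ≤ 1 * L ^ n * 1 := by simpa using h2
          _ ≤ (C + 1) * L ^ n * exp ((x + s) / 2) := by
            gcongr
            linarith
    rw [abs_of_nonneg (by positivity), pow_zero, mul_one, add_zero]
    calc (x + s) ^ a * exp (-(c * (x + s)))
        ≤ (C + 1) * L ^ n * exp ((x + s) / 2) * exp (-(c * (x + s))) := by gcongr
      _ = (C + 1) * L ^ n * exp ((x + s) / 2 - c * (x + s)) := by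
        rw [mul_assoc _ (exp _), ← exp_add, ← sub_eq_add_neg]
      _ ≤ (C + 1) * L ^ n * exp (1 + -(c * (x₀ + s) / 2)) := by
        gcongr
        rcases hc with rfl | rfl
        · have := hcase.resolve_left (by norm_num)
          linarith [hx.2]
        · linarith
      _ = _ := by
        rw [exp_add]
        ring
  | succ d ih =>
    obtain ⟨C₁, hC₁, h₁⟩ := ih (n + 1) (a := a - 1) (by push_cast; linarith)
    obtain ⟨C₂, hC₂, h₂⟩ := ih n ha
    refine ⟨|a| * C₁ + |-c| * C₂, by positivity, fun L hL h hh x₀ s hu hcase => ?_⟩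
    have hL0 : 0 < L := by linarith
    have hu0 : 0 < x₀ + s := pos_of_mul_pos_right (by linarith) hL0.le
    have hd := ((h₁ L hL h hh x₀ s hu hcase).const_mul a).add
      ((h₂ L hL h hh x₀ s hu hcase).const_mul (-c))
    have hderiv := hd.of_hasDerivAt (f := fun x => (x + s) ^ a * exp (-(c * (x + s)))) hh
      (fun x hx => ?_) (by positivity)
    · refine hderiv.mono ?_
      have hLL : L ^ (n + d) ≤ L ^ (n + 1 + d) := pow_le_pow_right₀ hL (by omega)
      calc _ ≤ (|a| * (C₁ * h ^ d * L ^ (n + 1 + d) * exp (-(c * (x₀ + s) / 2)))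
            + |-c| * (C₂ * h ^ d * L ^ (n + 1 + d) * exp (-(c * (x₀ + s) / 2)))) * h := by
            gcongr
        _ = _ := by
          rw [show n + (d + 1) = n + 1 + d by omega]
          ring
    · have hxu0 : 0 < x + s := by linarith [hx.1]
      have e1 : HasDerivAt (fun x => x + s) 1 x := (hasDerivAt_id x).add_const s
      have e2 := e1.rpow_const (p := a) (Or.inl hxu0.ne')
      have e3 : HasDerivAt (fun x => exp (-(c * (x + s)))) (exp (-(c * (x + s))) * -(c * 1)) x :=
        ((e1.const_mul c).neg).exp
      refine (e2.mul e3).congr_deriv ?_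
      ring

end PolynomialApproximation

section KernelDifference

variable {β : ℝ}

lemma exists_polyApprox_gammaDens (hβ : 0 < β) (d : ℕ) : ∃ C ≥ 0, ∀ L ≥ 1, ∀ h ≥ 0,
    ∀ x₀ s : ℝ, 1 ≤ L * (x₀ + s) →
      PolyApprox d x₀ h (fun x => gammaDens β (x + s))
        (C * h ^ d * L ^ d * exp (-((x₀ + s) / 2))) := by
  have hΓ : 0 < Gamma (β + 1) := Gamma_pos_of_pos (by linarith)
  obtain ⟨C, hC, h⟩ := exists_polyApprox_rpow_mul_exp d (Or.inr rfl : (1 : ℝ) = 0 ∨ (1 : ℝ) = 1) 0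
    (a := β) (by simpa using hβ.le)
  refine ⟨|(Gamma (β + 1))⁻¹| * C, by positivity, fun L hL h' hh x₀ s hu => ?_⟩
  have hL0 : 0 < L := by linarith
  have hu0 : 0 < x₀ + s := pos_of_mul_pos_right (by linarith) hL0.le
  refine (((h L hL h' hh x₀ s hu (Or.inl rfl)).const_mul (Gamma (β + 1))⁻¹).mono
    (le_of_eq ?_)).congr fun x hx => ?_
  · rw [zero_add, one_mul]
    ring
  · simp only [gammaDens, max_eq_left (show 0 ≤ x + s by linarith [hx.1]), one_mul]
    field_simp

lemma exists_polyApprox_diag (hβ : 0 < β) (d : ℕ) : ∃ C ≥ 0, ∀ L ≥ 1, ∀ h ≥ 0, h * L ≤ 1 →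
    ∀ x₀ y : ℝ, x₀ + h ≤ 1 → 0 ≤ y →
      PolyApprox d x₀ h (fun x => gammaDens β (x - y) - rlKernel β x y)
        (C * (h ^ d * L ^ d + L⁻¹ ^ (β + 1))) := by
  have hΓ : 0 < Gamma (β + 1) := Gamma_pos_of_pos (by linarith)
  obtain ⟨C₁, hC₁, h₁⟩ := exists_polyApprox_gammaDens hβ d
  obtain ⟨C₀, hC₀, h₀⟩ := exists_polyApprox_rpow_mul_exp d
    (Or.inl rfl : (0 : ℝ) = 0 ∨ (0 : ℝ) = 1) 0 (a := β) (by simpa using hβ.le)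
  refine ⟨C₁ + |-(Gamma (β + 1))⁻¹| * C₀ + 2 ^ (β + 1) / Gamma (β + 1), by positivity,
    fun L hL h hh hhL x₀ y hx₀ hy => ?_⟩
  have hL0 : 0 < L := by linarith
  rcases le_total 1 (L * (x₀ + -y)) with hfar | hnear
  · have hu0 : 0 < x₀ + -y := pos_of_mul_pos_right (by linarith) hL0.le
    have e1 := h₁ L hL h hh x₀ (-y) hfar
    have e2 := (h₀ L hL h hh x₀ (-y) hfar (Or.inr (by linarith))).const_mul (-(Gamma (β + 1))⁻¹)
    refine ((e1.add e2).mono ?_).congr fun x hx => ?_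
    · have he : exp (-((x₀ + -y) / 2)) ≤ 1 := exp_le_one_iff.2 (by linarith)
      simp only [zero_mul, zero_div, neg_zero, exp_zero, mul_one, zero_add]
      have p1 : 0 ≤ h ^ d * L ^ d := by positivity
      have p2 : 0 ≤ L⁻¹ ^ (β + 1) := by positivity
      have p3 : 0 ≤ 2 ^ (β + 1) / Gamma (β + 1) := by positivity
      have p4 : 0 ≤ |-(Gamma (β + 1))⁻¹| * C₀ := by positivity
      have p5 : C₁ * h ^ d * L ^ d * exp (-((x₀ + -y) / 2)) ≤ C₁ * h ^ d * L ^ d * 1 := by gcongr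
      have p6 := mul_nonneg p3 p1
      have p7 := mul_nonneg (add_nonneg (add_nonneg hC₁ p4) p3) p2
      linarith
    · have : 0 ≤ x + -y := by linarith [hx.1]
      simp only [rlKernel, zero_mul, neg_zero, exp_zero, mul_one, ← sub_eq_add_neg] at this ⊢
      rw [max_eq_left this]
      field_simp
      ring
  · refine polyApprox_of_abs_le fun x hx => ?_
    have hb : |gammaDens β (x - y) - rlKernel β x y| ≤
        2 ^ (β + 1) / Gamma (β + 1) * L⁻¹ ^ (β + 1) := by
      have hz2 : x - y ≤ 2 * L⁻¹ := by
        have h1 : x₀ - y ≤ L⁻¹ := by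
          rw [← one_div, le_div_iff₀ hL0]
          linarith
        have h2 : h ≤ L⁻¹ := by
          rw [← one_div, le_div_iff₀ hL0]
          exact hhL
        linarith [hx.2]
      rcases le_total (x - y) 0 with hz | hz
      · rw [gammaDens_of_nonpos hβ hz, rlKernel, max_eq_right hz, zero_rpow hβ.ne']
        simp only [zero_div, sub_zero, abs_zero]
        positivity
      · rw [gammaDens, rlKernel, max_eq_left hz, ← sub_div, abs_div, abs_of_pos hΓ,
          div_mul_eq_mul_div]
        refine div_le_div_of_nonneg_right ?_ hΓ.le
        have h1 : |(x - y) ^ β * exp (-(x - y)) - (x - y) ^ β| ≤ (x - y) ^ β * (x - y) := by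
          rw [← mul_sub_one, abs_mul, abs_of_nonneg (rpow_nonneg hz β)]
          refine mul_le_mul_of_nonneg_left ?_ (rpow_nonneg hz β)
          have := one_sub_le_exp_neg (x - y)
          have h2 : exp (-(x - y)) ≤ 1 := exp_le_one_iff.2 (by linarith)
          rw [abs_le]
          constructor <;> linarith
        refine h1.trans ?_
        rw [← rpow_add_one' hz (by linarith), ← mul_rpow (by norm_num) (by positivity)]
        exact rpow_le_rpow hz hz2 (by linarith)
    refine hb.trans ?_
    have p1 : 0 ≤ h ^ d * L ^ d := by positivity
    have p2 : 0 ≤ L⁻¹ ^ (β + 1) := by positivity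
    have p3 : 0 ≤ 2 ^ (β + 1) / Gamma (β + 1) := by positivity
    have p4 : 0 ≤ |-(Gamma (β + 1))⁻¹| * C₀ := by positivity
    have p6 := mul_nonneg (add_nonneg (add_nonneg hC₁ p4) p3) p1
    have p7 := mul_nonneg (add_nonneg hC₁ p4) p2
    linarith

lemma exists_polyApprox_corner (hβ : 0 < β) (d : ℕ) : ∃ C ≥ 0, ∀ L ≥ 1, ∀ h ≥ 0, h * L ≤ 1 →
    ∀ x₀ y : ℝ, 0 ≤ x₀ → y ≤ 1 →
      PolyApprox d x₀ h (fun x => gammaDens β (x - y + 1))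
        (C * (h ^ d * L ^ d) + if x₀ < L⁻¹ ∧ 1 - L⁻¹ < y then C * L⁻¹ ^ β else 0) := by
  have hΓ : 0 < Gamma (β + 1) := Gamma_pos_of_pos (by linarith)
  obtain ⟨C₁, hC₁, h₁⟩ := exists_polyApprox_gammaDens hβ d
  refine ⟨C₁ + 2 ^ β / Gamma (β + 1), by positivity, fun L hL h hh hhL x₀ y hx₀ hy => ?_⟩
  have hL0 : 0 < L := by linarith
  have p3 : 0 ≤ 2 ^ β / Gamma (β + 1) := by positivity
  have p1 : 0 ≤ h ^ d * L ^ d := by positivity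
  have p2 : 0 ≤ L⁻¹ ^ β := by positivity
  have p6 := mul_nonneg p3 p1
  have p7 := mul_nonneg hC₁ p2
  by_cases hfar : 1 ≤ L * (x₀ + (1 - y))
  · have e1 := h₁ L hL h hh x₀ (1 - y) hfar
    refine (e1.mono ?_).congr fun x hx => by rw [show x + (1 - y) = x - y + 1 by ring]
    have he : exp (-((x₀ + (1 - y)) / 2)) ≤ 1 := exp_le_one_iff.2 (by linarith)
    have p5 : C₁ * h ^ d * L ^ d * exp (-((x₀ + (1 - y)) / 2)) ≤ C₁ * h ^ d * L ^ d * 1 := by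
      gcongr
    split_ifs
    · have := mul_nonneg p3 p2
      linarith
    · linarith
  · refine polyApprox_of_abs_le fun x hx => ?_
    have hlt : x₀ + (1 - y) < L⁻¹ := by
      rw [← one_div, lt_div_iff₀ hL0]
      linarith
    rw [if_pos ⟨by linarith, by linarith⟩]
    have hb : gammaDens β (x - y + 1) ≤ 2 ^ β / Gamma (β + 1) * L⁻¹ ^ β := by
      have hz2 : x - y + 1 ≤ 2 * L⁻¹ := by
        have h2 : h ≤ L⁻¹ := by
          rw [← one_div, le_div_iff₀ hL0]
          exact hhL
        linarith [hx.2]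
      have hz : 0 ≤ x - y + 1 := by linarith [hx.1]
      rw [gammaDens, max_eq_left hz, div_mul_eq_mul_div]
      refine div_le_div_of_nonneg_right ?_ hΓ.le
      rw [← mul_rpow (by norm_num) (by positivity)]
      have he : exp (-(x - y + 1)) ≤ 1 := exp_le_one_iff.2 (by linarith)
      calc (x - y + 1) ^ β * exp (-(x - y + 1)) ≤ (x - y + 1) ^ β * 1 := by gcongr
        _ ≤ (2 * L⁻¹) ^ β := by
          rw [mul_one]
          exact rpow_le_rpow hz hz2 hβ.le
    rw [abs_of_nonneg (gammaDens_nonneg hβ _)]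
    have := mul_nonneg hC₁ p1
    linarith

lemma exists_polyApprox_tail (hβ : 0 < β) (d : ℕ) : ∃ C ≥ 0, ∀ h > 0,
    ∀ x₀ y : ℝ, 0 ≤ x₀ → y ≤ 1 →
      PolyApprox d x₀ h (fun x => ∑' m : ℕ, gammaDens β (x - y + (m + 2 : ℕ))) (C * h ^ d) := by
  obtain ⟨C₁, hC₁, h₁⟩ := exists_polyApprox_gammaDens hβ d
  obtain ⟨C₂, hC₂, h₂⟩ := exists_gammaDens_shift_le hβ
  have hr0 : 0 ≤ exp (-(1 / 2)) := (exp_pos _).le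
  have hs := summable_exp_half_pow
  refine ⟨C₁ * (∑' m : ℕ, exp (-(1 / 2)) ^ m) + 1, by positivity, fun h hh x₀ y hx₀ hy => ?_⟩
  have htend := tendsto_sum_nat_add (fun m : ℕ => C₂ * exp (-(1 / 2)) ^ m)
  obtain ⟨M, hM⟩ := (htend.eventually (gt_mem_nhds (show 0 < h ^ d by positivity))).exists
  have hsum : ∀ x ∈ Set.Icc x₀ (x₀ + h),
      Summable fun m : ℕ => gammaDens β (x - y + (m + 2 : ℕ)) := fun x hx =>
    (summable_nat_add_iff 2).2 (summable_gammaDens_shift hβ (by linarith [hx.1]))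
  have e1 : PolyApprox d x₀ h
      (fun x => ∑ m ∈ Finset.range M, gammaDens β (x - y + (m + 2 : ℕ)))
      (∑ m ∈ Finset.range M, C₁ * h ^ d * exp (-(1 / 2)) ^ m) := by
    refine PolyApprox.sum _ fun m _ => ?_
    have := h₁ 1 le_rfl h hh.le x₀ (-y + (m + 2 : ℕ)) (by
      push_cast
      linarith [(m.cast_nonneg : (0 : ℝ) ≤ m)])
    refine (this.mono ?_).congr fun x hx => by rw [← add_assoc, ← sub_eq_add_neg]
    rw [one_pow, mul_one, ← exp_nat_mul]
    gcongr
    push_cast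
    linarith
  have e2 : PolyApprox d x₀ h
      (fun x => ∑' m : ℕ, gammaDens β (x - y + (m + M + 2 : ℕ))) (h ^ d) := by
    refine polyApprox_of_abs_le fun x hx => ?_
    rw [abs_of_nonneg (tsum_nonneg fun m => gammaDens_nonneg hβ _)]
    have s1 : Summable fun m : ℕ => gammaDens β (x - y + (m + M + 2 : ℕ)) :=
      (summable_nat_add_iff (f := fun m : ℕ => gammaDens β (x - y + (m + 2 : ℕ))) M).2 (hsum x hx)
    have s2 : Summable fun m : ℕ => C₂ * exp (-(1 / 2)) ^ (m + M) :=
      (summable_nat_add_iff (f := fun m : ℕ => C₂ * exp (-(1 / 2)) ^ m) M).2 (hs.mul_left C₂)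
    have h3 : ∀ m : ℕ, gammaDens β (x - y + (m + M + 2 : ℕ)) ≤ C₂ * exp (-(1 / 2)) ^ (m + M) := by
      intro m
      refine (h₂ _ (by linarith [hx.1]) _).trans ?_
      refine mul_le_mul_of_nonneg_left ?_ hC₂.le
      exact pow_le_pow_of_le_one hr0 (exp_le_one_iff.2 (by norm_num)) (by omega)
    exact (s1.tsum_le_tsum h3 s2).trans hM.le
  refine ((e1.add e2).mono ?_).congr fun x hx => ?_
  swap
  · exact (hsum x hx).sum_add_tsum_nat_add M
  rw [← Finset.mul_sum]
  have := hs.sum_le_tsum (Finset.range M) fun m _ => pow_nonneg hr0 m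
  have h3 : C₁ * h ^ d * ∑ m ∈ Finset.range M, exp (-(1 / 2)) ^ m
      ≤ C₁ * h ^ d * ∑' m : ℕ, exp (-(1 / 2)) ^ m := by gcongr
  linarith

/-- Piecewise polynomial approximation of the difference of the two kernels. -/
lemma exists_polyApprox_sub (hβ : 0 < β) (d : ℕ) : ∃ C ≥ 0, ∀ L ≥ 1, ∀ h > 0, h * L ≤ 1 →
    ∀ x₀ y : ℝ, 0 ≤ x₀ → x₀ + h ≤ 1 → y ∈ Set.Icc (0 : ℝ) 1 →
      PolyApprox d x₀ h (fun x => perKernel β x y - rlKernel β x y)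
        (C * (h ^ d * L ^ d + L⁻¹ ^ (β + 1))
          + if x₀ < L⁻¹ ∧ 1 - L⁻¹ < y then C * L⁻¹ ^ β else 0) := by
  obtain ⟨C₁, hC₁, h₁⟩ := exists_polyApprox_diag hβ d
  obtain ⟨C₂, hC₂, h₂⟩ := exists_polyApprox_corner hβ d
  obtain ⟨C₃, hC₃, h₃⟩ := exists_polyApprox_tail hβ d
  refine ⟨C₁ + C₂ + C₃, by positivity, fun L hL h hh hhL x₀ y hx₀ hx1 hy => ?_⟩
  have hL0 : 0 < L := by linarith
  refine ((((h₁ L hL h hh.le hhL x₀ y hx1 hy.1).add (h₂ L hL h hh.le hhL x₀ y hx₀ hy.2)).add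
    (h₃ h hh x₀ y hx₀ hy.2)).mono ?_).congr fun x hx => ?_
  · have p1 : 0 ≤ h ^ d * L ^ d := by positivity
    have p2 : 0 ≤ L⁻¹ ^ (β + 1) := by positivity
    have p3 : 0 ≤ L⁻¹ ^ β := by positivity
    have p4 : h ^ d ≤ h ^ d * L ^ d := le_mul_of_one_le_right (by positivity) (one_le_pow₀ hL)
    have q1 := mul_nonneg hC₂ p2
    have q2 := mul_nonneg hC₃ p2
    have q3 := mul_le_mul_of_nonneg_left p4 hC₃
    split_ifs
    · have := mul_nonneg hC₁ p3
      have := mul_nonneg hC₃ p3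
      linarith
    · linarith
  · have hs := summable_gammaDens_shift hβ (show -1 ≤ x - y by linarith [hx.1, hy.2])
    have := hs.sum_add_tsum_nat_add 2
    rw [perKernel, ← this, Finset.sum_range_succ, Finset.sum_range_one]
    simp only [Nat.cast_zero, add_zero, Nat.cast_one]
    ring

end KernelDifference

section Residual

lemma measureReal_μ01_Ioi_le {a : ℝ} (ha : a ≤ 1) : μ01.real (Set.Ioi a) ≤ 1 - a := by
  unfold μ01
  rw [measureReal_restrict_apply measurableSet_Ioi]
  refine (measureReal_mono (s₂ := Set.Icc a 1) (fun x hx => ⟨hx.1.le, hx.2.2⟩) ?_).trans ?_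
  · simp
  · rw [Real.volume_real_Icc_of_le ha]

lemma measureReal_μ01_Iio_le {a : ℝ} (ha : 0 ≤ a) : μ01.real (Set.Iio a) ≤ a := by
  unfold μ01
  rw [measureReal_restrict_apply measurableSet_Iio]
  refine (measureReal_mono (s₂ := Set.Icc 0 a) (fun x hx => ⟨hx.2.1, hx.1.le⟩) ?_).trans ?_
  · simp
  · rw [Real.volume_real_Icc_of_le ha, sub_zero]

lemma ae_lt_one : ∀ᵐ x ∂μ01, x < 1 := by
  have h : ∀ᵐ x : ℝ ∂μ01, x ≠ 1 := by
    unfold μ01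
    exact ae_restrict_of_ae (Measure.ae_ne volume 1)
  filter_upwards [h, ae_mem_Icc] with x h1 h2
  exact lt_of_le_of_ne h2.2 h1

variable {g : ℝ → ℝ → ℝ}

lemma BddKernel.integral_sq_comm (hg : BddKernel g) :
    ∫ x, ∫ y, g x y ^ 2 ∂μ01 ∂μ01 = ∫ y, ∫ x, g x y ^ 2 ∂μ01 ∂μ01 := by
  obtain ⟨C, hC⟩ := hg.bdd
  refine integral_integral_swap ?_
  refine Integrable.of_bound (C := C ^ 2) ?_ ?_
  · exact (hg.meas.pow_const 2).aestronglyMeasurable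
  · have h1 : ∀ᵐ z ∂(μ01.prod μ01), z.1 ∈ Set.Icc (0 : ℝ) 1 ∧ z.2 ∈ Set.Icc (0 : ℝ) 1 := by
      exact ((Measure.quasiMeasurePreserving_fst (μ := μ01) (ν := μ01)).ae ae_mem_Icc).and
        ((Measure.quasiMeasurePreserving_snd (μ := μ01) (ν := μ01)).ae ae_mem_Icc)
    filter_upwards [h1] with z hz
    rw [Function.uncurry_def, Real.norm_eq_abs, abs_pow]
    gcongr
    exact hC _ hz.1 _ hz.2

/-- The part of the kernel not captured by an orthonormal family, as an integral over slices. -/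
lemma BddKernel.residual_eq {ι : Type*} [Fintype ι] (hg : BddKernel g) (ψ : ι → Lp ℝ 2 μ01) :
    ∑' k, ‖hg.seq k‖ ^ 2 - ∑ j, ∑' k, ⟪ψ j, hg.seq k⟫ ^ 2
      = ∫ y, (∫ x, g x y ^ 2 ∂μ01 - ∑ j, (∫ x, ψ j x * g x y ∂μ01) ^ 2) ∂μ01 := by
  obtain ⟨C, hC⟩ := hg.bdd
  have hi : ∀ j, Integrable (fun y => (∫ x, ψ j x * g x y ∂μ01) ^ 2) μ01 := fun j =>
    (hg.memLp_integral_mul (ψ j)).integrable_sq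
  rw [integral_sub _ (integrable_finsetSum _ fun j _ => hi j), integral_finsetSum _ fun j _ => hi j,
    hg.tsum_norm_sq_seq, hg.integral_sq_comm]
  · simp only [hg.tsum_inner_sq_seq]
  · refine Integrable.of_bound (C := C ^ 2) ?_ ?_
    · refine Measurable.aestronglyMeasurable ?_
      exact ((hg.meas.comp measurable_swap).pow_const
        2).stronglyMeasurable.integral_prod_right.measurable
    · filter_upwards [ae_mem_Icc] with y hy
      refine (norm_integral_le_of_norm_le_const (C := C ^ 2) ?_).trans (by simp)
      filter_upwards [ae_mem_Icc] with x hx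
      rw [Real.norm_eq_abs, abs_pow]
      gcongr
      exact hC _ hx _ hy

/-- Projecting on the span of an orthonormal basis of a subspace is best approximation. -/
lemma norm_sq_sub_sum_le {H : Type*} [NormedAddCommGroup H] [InnerProductSpace ℝ H]
    (V : Submodule ℝ H) {ι : Type*} [Fintype ι] (b : OrthonormalBasis ι ℝ V) (f : H) {w : H}
    (hw : w ∈ V) : ‖f‖ ^ 2 - ∑ j, ⟪(b j : H), f⟫ ^ 2 ≤ ‖f - w‖ ^ 2 := by
  have hb : Orthonormal ℝ fun j => (b j : H) := b.orthonormal.comp_linearIsometry V.subtypeₗᵢ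
  have h1 : w = ∑ j, (b.repr ⟨w, hw⟩ j) • (b j : H) := by
    have := congrArg (Subtype.val) (b.sum_repr ⟨w, hw⟩)
    simpa using this.symm
  rw [h1, norm_sub_sum_sq hb]
  have : 0 ≤ ∑ j, (⟪(b j : H), f⟫ - b.repr ⟨w, hw⟩ j) ^ 2 :=
    Finset.sum_nonneg fun j _ => sq_nonneg _
  linarith

/-- A monomial restricted to the `i`-th of `N` equal blocks of the unit interval. -/
noncomputable def blockMonomial (N i j : ℕ) : ℝ → ℝ :=
  (Set.Ico ((i : ℝ) / N) ((i + 1 : ℝ) / N)).indicator fun x => x ^ j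

lemma memLp_blockMonomial (N i j : ℕ) : MemLp (blockMonomial N i j) 2 μ01 := by
  refine MemLp.of_bound (Measurable.aestronglyMeasurable ?_) 1 ?_
  · exact (measurable_id.pow_const j).indicator measurableSet_Ico
  · filter_upwards [ae_mem_Icc] with x hx
    unfold blockMonomial
    by_cases h : x ∈ Set.Ico ((i : ℝ) / N) ((i + 1 : ℝ) / N)
    · rw [Set.indicator_of_mem h, norm_pow, Real.norm_eq_abs, abs_of_nonneg hx.1]
      exact pow_le_one₀ hx.1 hx.2
    · rw [Set.indicator_of_notMem h]
      simp

lemma sum_blockMonomial {N : ℕ} (hN : 0 < N) (d : ℕ) (c : Fin N → ℕ → ℝ) {x : ℝ}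
    (hx0 : 0 ≤ x) (hx1 : x < 1) : ∃ i : Fin N,
      x ∈ Set.Ico ((i : ℝ) / N) ((i + 1 : ℝ) / N) ∧
      ∑ p : Fin N × Fin d, c p.1 p.2 * blockMonomial N p.1 p.2 x
        = ∑ j ∈ Finset.range d, c i j * x ^ j := by
  have hN' : (0 : ℝ) < N := by exact_mod_cast hN
  have hlt : ⌊(N : ℝ) * x⌋₊ < N := by
    rw [Nat.floor_lt (by positivity)]
    nlinarith
  have hmem : ∀ k : ℕ, x ∈ Set.Ico ((k : ℝ) / N) ((k + 1 : ℝ) / N) ↔ ⌊(N : ℝ) * x⌋₊ = k := by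
    intro k
    rw [Nat.floor_eq_iff (by positivity), Set.mem_Ico, div_le_iff₀ hN', lt_div_iff₀ hN',
      mul_comm x]
  refine ⟨⟨_, hlt⟩, (hmem _).2 rfl, ?_⟩
  rw [Fintype.sum_prod_type, Finset.sum_eq_single ⟨_, hlt⟩]
  · rw [← Fin.sum_univ_eq_sum_range (fun j => c ⟨_, hlt⟩ j * x ^ j) d]
    refine Finset.sum_congr rfl fun j _ => ?_
    rw [blockMonomial, Set.indicator_of_mem ((hmem _).2 rfl)]
  · intro i _ hi
    refine Finset.sum_eq_zero fun j _ => ?_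
    rw [blockMonomial, Set.indicator_of_notMem, mul_zero]
    intro hc
    exact hi (Fin.ext ((hmem _).1 hc).symm)
  · simp

/-- The span of the piecewise monomials. -/
noncomputable def blockSpace (N d : ℕ) : Submodule ℝ (Lp ℝ 2 μ01) :=
  Submodule.span ℝ (Set.range fun p : Fin N × Fin d => (memLp_blockMonomial N p.1 p.2).toLp)

instance (N d : ℕ) : FiniteDimensional ℝ (blockSpace N d) :=
  FiniteDimensional.span_of_finite ℝ (Set.finite_range _)

lemma finrank_blockSpace_le (N d : ℕ) : Module.finrank ℝ (blockSpace N d) ≤ N * d := by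
  refine (finrank_range_le_card _).trans ?_
  simp

variable {β : ℝ}

/-- The difference of the kernels is nearly of finite rank. -/
lemma exists_residual_le (hβ : 0 < β) (d : ℕ) : ∃ C ≥ 0, ∀ N : ℕ, 0 < N → ∀ L : ℝ, 1 ≤ L → L ≤ N →
    ∃ q ≤ N * d, ∃ ψ : Fin q → Lp ℝ 2 μ01, Orthonormal ℝ ψ ∧
      ∑' k, ‖((bddKernel_perKernel hβ).sub (bddKernel_rlKernel hβ)).seq k‖ ^ 2
        - ∑ j, ∑' k, ⟪ψ j, ((bddKernel_perKernel hβ).sub (bddKernel_rlKernel hβ)).seq k⟫ ^ 2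
        ≤ C * ((L / N) ^ (2 * d) + L⁻¹ ^ (2 * (β + 1))) := by
  obtain ⟨C, hC, happ⟩ := exists_polyApprox_sub hβ d
  refine ⟨8 * C ^ 2, by positivity, fun N hN L hL hLN => ?_⟩
  have hL0 : 0 < L := by linarith
  have hN' : (0 : ℝ) < N := by exact_mod_cast hN
  have hg := (bddKernel_perKernel hβ).sub (bddKernel_rlKernel hβ)
  set b := stdOrthonormalBasis ℝ (blockSpace N d)
  refine ⟨_, finrank_blockSpace_le N d, fun j => (b j : Lp ℝ 2 μ01),
    b.orthonormal.comp_linearIsometry (blockSpace N d).subtypeₗᵢ, ?_⟩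
  rw [hg.residual_eq]
  set A : ℝ := C * ((1 / N) ^ d * L ^ d + L⁻¹ ^ (β + 1)) with hA
  set B : ℝ := C * L⁻¹ ^ β with hB
  have hA0 : 0 ≤ A := by positivity
  have hB0 : 0 ≤ B := by positivity
  have hLi : L⁻¹ ≤ 1 := inv_le_one_of_one_le₀ hL
  have hpt : ∀ᵐ y ∂μ01, (∫ x, (perKernel β x y - rlKernel β x y) ^ 2 ∂μ01
      - ∑ j, (∫ x, (b j : Lp ℝ 2 μ01) x * (perKernel β x y - rlKernel β x y) ∂μ01) ^ 2)
      ≤ 2 * A ^ 2 + (Set.Ioi (1 - L⁻¹)).indicator (fun _ => 2 * B ^ 2 * (2 * L⁻¹)) y := by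
    filter_upwards [ae_mem_Icc] with y hy
    have hblock : ∀ i : Fin N, ∃ c : ℕ → ℝ, ∀ x ∈ Set.Icc ((i : ℝ) / N) ((i : ℝ) / N + 1 / N),
        |perKernel β x y - rlKernel β x y - ∑ j ∈ Finset.range d, c j * x ^ j|
          ≤ A + if (i : ℝ) / N < L⁻¹ ∧ 1 - L⁻¹ < y then B else 0 := by
      intro i
      refine happ L hL (1 / N) (by positivity) ?_ (i / N) y (by positivity) ?_ hy
      · rw [one_div_mul_eq_div, div_le_one hN']
        exact hLN
      · rw [← add_div, div_le_one hN']
        exact_mod_cast i.2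
    choose c hc using hblock
    set w : Lp ℝ 2 μ01 :=
      ∑ p : Fin N × Fin d, c p.1 p.2 • (memLp_blockMonomial N p.1 p.2).toLp with hw
    have hwV : w ∈ blockSpace N d :=
      Submodule.sum_mem _ fun p _ => Submodule.smul_mem _ _ (Submodule.subset_span ⟨p, rfl⟩)
    have h1 := norm_sq_sub_sum_le (blockSpace N d) b (hg.memLp_left hy).toLp hwV
    simp only [inner_toLp, norm_sq_toLp] at h1
    refine h1.trans ?_
    have hwm : MemLp (fun x => ∑ p : Fin N × Fin d, c p.1 p.2 * blockMonomial N p.1 p.2 x)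
        2 μ01 := memLp_finsetSum _ fun p _ => (memLp_blockMonomial N p.1 p.2).const_mul _
    have hwe : w = hwm.toLp := by
      refine Lp.ext ?_
      have e1 := Lp.coeFn_finsetSum Finset.univ
        fun p : Fin N × Fin d => c p.1 p.2 • (memLp_blockMonomial N p.1 p.2).toLp
      have e2 : ∀ᵐ x ∂μ01, ∀ p : Fin N × Fin d,
          (c p.1 p.2 • (memLp_blockMonomial N p.1 p.2).toLp : Lp ℝ 2 μ01) x
            = c p.1 p.2 * blockMonomial N p.1 p.2 x := by
        refine ae_all_iff.2 fun p => ?_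
        filter_upwards [Lp.coeFn_smul (c p.1 p.2) (memLp_blockMonomial N p.1 p.2).toLp,
          (memLp_blockMonomial N p.1 p.2).coeFn_toLp] with x hx1 hx2
        rw [hx1, Pi.smul_apply, hx2, smul_eq_mul]
      filter_upwards [e1, e2, hwm.coeFn_toLp] with x h1 h2 h3
      rw [hw, h1, h3, Finset.sum_apply]
      exact Finset.sum_congr rfl fun p _ => h2 p
    rw [hwe, ← MemLp.toLp_sub, norm_sq_toLp]
    have h2 : ∀ᵐ x ∂μ01,
        ((fun x => perKernel β x y - rlKernel β x y)
          - fun x => ∑ p : Fin N × Fin d, c p.1 p.2 * blockMonomial N p.1 p.2 x) x ^ 2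
        ≤ 2 * A ^ 2 + (Set.Iio (2 * L⁻¹)).indicator
          (fun _ => (Set.Ioi (1 - L⁻¹)).indicator (fun _ => 2 * B ^ 2) y) x := by
      filter_upwards [ae_mem_Icc, ae_lt_one] with x hx hx1
      obtain ⟨i, hi, hsum⟩ := sum_blockMonomial hN d c hx.1 hx1
      rw [Pi.sub_apply, hsum]
      have h3 := hc i x ⟨hi.1, by rw [← add_div]; exact hi.2.le⟩
      have hyn : 0 ≤ (Set.Ioi (1 - L⁻¹)).indicator (fun _ => 2 * B ^ 2) y :=
        Set.indicator_nonneg (fun _ _ => by positivity) _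
      have hxn := Set.indicator_nonneg (s := Set.Iio (2 * L⁻¹)) (fun _ _ => hyn) x
      split_ifs at h3 with hcase
      · have hx2 : x ∈ Set.Iio (2 * L⁻¹) := by
          have h4 : (1 : ℝ) / N ≤ L⁻¹ := by
            rw [one_div]
            exact inv_anti₀ hL0 hLN
          have h5 := hi.2
          rw [add_div] at h5
          have := hcase.1
          simp only [Set.mem_Iio]
          linarith
        rw [Set.indicator_of_mem hx2,
          Set.indicator_of_mem (show y ∈ Set.Ioi (1 - L⁻¹) from hcase.2)]
        calc _ ≤ (A + B) ^ 2 := sq_le_sq' (neg_le_of_abs_le h3) (le_of_abs_le h3)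
          _ ≤ _ := by nlinarith [sq_nonneg (A - B)]
      · rw [add_zero] at h3
        have h6 := sq_le_sq' (neg_le_of_abs_le h3) (le_of_abs_le h3)
        nlinarith [sq_nonneg A]
    refine (integral_mono_ae ?_ ?_ h2).trans ?_
    · exact ((hg.memLp_left hy).sub hwm).integrable_sq
    · exact (integrable_const _).add ((integrable_const _).indicator measurableSet_Iio)
    · rw [integral_add (integrable_const _) ((integrable_const _).indicator measurableSet_Iio),
        integral_indicator_const _ measurableSet_Iio, integral_const, probReal_univ, one_smul]
      gcongr
      by_cases hy2 : y ∈ Set.Ioi (1 - L⁻¹)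
      · rw [Set.indicator_of_mem hy2, Set.indicator_of_mem hy2, smul_eq_mul, mul_comm]
        gcongr
        exact measureReal_μ01_Iio_le (by positivity)
      · rw [Set.indicator_of_notMem hy2, Set.indicator_of_notMem hy2, smul_zero]
  have hnn : 0 ≤ᵐ[μ01] fun y => (∫ x, (perKernel β x y - rlKernel β x y) ^ 2 ∂μ01
      - ∑ j, (∫ x, (b j : Lp ℝ 2 μ01) x * (perKernel β x y - rlKernel β x y) ∂μ01) ^ 2) := by
    filter_upwards [ae_mem_Icc] with y hy
    have hb : Orthonormal ℝ fun j => (b j : Lp ℝ 2 μ01) :=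
      b.orthonormal.comp_linearIsometry (blockSpace N d).subtypeₗᵢ
    have h1 := norm_sub_sum_sq hb (hg.memLp_left hy).toLp
      fun j => ⟪(b j : Lp ℝ 2 μ01), (hg.memLp_left hy).toLp⟫
    simp only [sub_self, inner_toLp, norm_sq_toLp, ne_eq, OfNat.ofNat_ne_zero, not_false_eq_true,
      zero_pow, Finset.sum_const_zero, zero_add] at h1
    simp only [Pi.zero_apply]
    rw [← h1]
    positivity
  refine (integral_mono_of_nonneg hnn
    ((integrable_const _).add ((integrable_const _).indicator measurableSet_Ioi)) hpt).trans ?_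
  rw [integral_add' (integrable_const _) ((integrable_const _).indicator measurableSet_Ioi),
    integral_indicator_const _ measurableSet_Ioi, integral_const, probReal_univ, one_smul]
  have h5 : μ01.real (Set.Ioi (1 - L⁻¹)) ≤ L⁻¹ := by
    have := measureReal_μ01_Ioi_le (a := 1 - L⁻¹) (by linarith [inv_pos.2 hL0])
    linarith
  have h6 : μ01.real (Set.Ioi (1 - L⁻¹)) • (2 * B ^ 2 * (2 * L⁻¹))
      ≤ 4 * (B * L⁻¹) ^ 2 := by
    rw [smul_eq_mul]
    calc _ ≤ L⁻¹ * (2 * B ^ 2 * (2 * L⁻¹)) := by gcongr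
      _ = _ := by ring
  have h7 : B * L⁻¹ = C * L⁻¹ ^ (β + 1) := by
    rw [hB, rpow_add_one (by positivity)]
    ring
  have h8 : L⁻¹ ^ (2 * (β + 1)) = (L⁻¹ ^ (β + 1)) ^ 2 := by
    rw [← rpow_natCast, ← rpow_mul (by positivity)]
    push_cast
    ring_nf
  have h9 : (L / N) ^ (2 * d) = ((1 / N) ^ d * L ^ d) ^ 2 := by
    rw [← mul_pow, ← pow_mul]
    ring
  rw [h7] at h6
  rw [h8, h9, hA] at *
  set s := (1 / (N : ℝ)) ^ d * L ^ d
  set t := L⁻¹ ^ (β + 1)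
  nlinarith [mul_nonneg (sq_nonneg C) (sq_nonneg (s - t)), mul_nonneg (sq_nonneg C) (sq_nonneg s)]

end Residual

section GridQuantizer

lemma exists_grid_point {M : ℕ} (hM : 0 < M) (x : ℝ) :
    ∃ j ∈ Finset.Icc (-(M : ℤ) ^ 2) ((M : ℤ) ^ 2), (x - j / M) ^ 2 ≤ (1 + x ^ 4) / (M : ℝ) ^ 2 := by
  have hM' : (0 : ℝ) < M := by exact_mod_cast hM
  rcases le_or_gt |x| M with hx | hx
  · have hb := abs_le.1 hx
    refine ⟨⌊x * M⌋, Finset.mem_Icc.2 ⟨Int.le_floor.2 ?_, ?_⟩, ?_⟩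
    · push_cast
      nlinarith
    · have h1 : ((⌊x * M⌋ : ℤ) : ℝ) ≤ ((M : ℤ) ^ 2 : ℤ) := by
        push_cast
        exact (Int.floor_le _).trans (by nlinarith)
      exact_mod_cast h1
    · have h1 := Int.floor_le (x * M)
      have h2 := Int.lt_floor_add_one (x * M)
      have h3 : x - ⌊x * M⌋ / M = (x * M - ⌊x * M⌋) / M := by field_simp
      rw [h3, div_pow]
      gcongr
      have : 0 ≤ x ^ 4 := by positivity
      nlinarith
  · refine ⟨0, Finset.mem_Icc.2 ⟨by simp, by positivity⟩, ?_⟩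
    have h1 : (M : ℝ) ^ 2 ≤ x ^ 2 := by
      rw [← sq_abs x]
      gcongr
    rw [le_div_iff₀ (by positivity)]
    simp only [Int.cast_zero, zero_div, sub_zero]
    nlinarith [sq_nonneg x]

variable {H : Type*} [NormedAddCommGroup H] [InnerProductSpace ℝ H]

section Grid
variable {Ω : Type*} [MeasurableSpace Ω] {P : Measure Ω} [IsProbabilityMeasure P] {X : Ω → H}

/-- Quantizing finitely many coordinates on a grid. -/
lemma distortion_le_grid {ι : Type*} [Fintype ι] {φ : ι → H} (hφ : Orthonormal ℝ φ)
    (hX : MemLp X 2 P) {B : ℝ} (hInt : ∀ i, Integrable (fun ω => ⟪φ i, X ω⟫ ^ 4) P)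
    (hB : ∀ i, ∫ ω, ⟪φ i, X ω⟫ ^ 4 ∂P ≤ B) {M : ℕ} (hM : 0 < M) {R : ℝ}
    (hR : Fintype.card ι * log (2 * (M : ℝ) ^ 2 + 1) ≤ R) :
    distortion P X R ≤ Fintype.card ι * (1 + B) / (M : ℝ) ^ 2
      + (∫ ω, ‖X ω‖ ^ 2 ∂P - ∑ i, ∫ ω, ⟪φ i, X ω⟫ ^ 2 ∂P) := by
  classical
  have hM' : (0 : ℝ) < M := by exact_mod_cast hM
  set α : Finset H := (Fintype.piFinset fun _ : ι => Finset.Icc (-(M : ℤ) ^ 2) ((M : ℤ) ^ 2)).image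
    fun j => ∑ i, ((j i : ℝ) / M) • φ i with hα
  have hne : α.Nonempty := by
    refine ⟨_, Finset.mem_image_of_mem _ (a := (0 : ι → ℤ)) (Fintype.mem_piFinset.2 fun i => ?_)⟩
    exact Finset.mem_Icc.2 ⟨by simp, by positivity⟩
  have hcard : (α.card : ℝ) ≤ exp R := by
    have h1 : α.card ≤ (2 * M ^ 2 + 1) ^ Fintype.card ι := by
      refine Finset.card_image_le.trans ?_
      rw [Fintype.card_piFinset, Finset.prod_const, Finset.card_univ]
      refine le_of_eq ?_
      congr 1
      rw [Int.card_Icc]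
      have : (M : ℤ) ^ 2 + 1 - -(M : ℤ) ^ 2 = ((2 * M ^ 2 + 1 : ℕ) : ℤ) := by
        push_cast
        ring
      rw [this, Int.toNat_natCast]
    calc (α.card : ℝ) ≤ ((2 * M ^ 2 + 1 : ℕ) : ℝ) ^ Fintype.card ι := by exact_mod_cast h1
      _ = exp (Fintype.card ι * log (2 * (M : ℝ) ^ 2 + 1)) := by
        rw [exp_nat_mul, exp_log (by positivity)]
        push_cast
        rfl
      _ ≤ exp R := exp_le_exp.2 hR
  have hsq : ∀ i, Integrable (fun ω => ⟪φ i, X ω⟫ ^ 2) P := fun i =>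
    (hX.const_inner (φ i)).integrable_sq
  have hXsq : Integrable (fun ω => ‖X ω‖ ^ 2) P := hX.integrable_norm_pow (by norm_num)
  have hpt : ∀ ω, minSq α (X ω) ≤ ∑ i, (1 + ⟪φ i, X ω⟫ ^ 4) / (M : ℝ) ^ 2
      + (‖X ω‖ ^ 2 - ∑ i, ⟪φ i, X ω⟫ ^ 2) := by
    intro ω
    choose j hj hj2 using fun i => exists_grid_point hM ⟪φ i, X ω⟫
    refine (minSq_le (Finset.mem_image_of_mem _ (Fintype.mem_piFinset.2 hj)) _).trans ?_
    rw [norm_sub_sum_sq hφ]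
    gcongr with i
    exact hj2 i
  have h4 : ∀ i, Integrable (fun ω => (1 + ⟪φ i, X ω⟫ ^ 4) / (M : ℝ) ^ 2) P := fun i =>
    ((integrable_const _).add (hInt i)).div_const _
  refine (distortion_le hne hcard).trans ((integral_mono (integrable_minSq hX hne)
    ((integrable_finsetSum _ fun i _ => h4 i).add
      (hXsq.sub (integrable_finsetSum _ fun i _ => hsq i))) hpt).trans ?_)
  simp only [Pi.add_apply, Pi.sub_apply]
  rw [integral_add (integrable_finsetSum _ fun i _ => h4 i)
      (by exact hXsq.sub (integrable_finsetSum _ fun i _ => hsq i)),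
    integral_sub hXsq (integrable_finsetSum _ fun i _ => hsq i),
    integral_finsetSum _ (fun i _ => h4 i), integral_finsetSum _ (fun i _ => hsq i)]
  gcongr
  calc ∑ i, ∫ ω, (1 + ⟪φ i, X ω⟫ ^ 4) / (M : ℝ) ^ 2 ∂P
      ≤ ∑ _i : ι, (1 + B) / (M : ℝ) ^ 2 := by
        refine Finset.sum_le_sum fun i _ => ?_
        rw [integral_div, integral_add (integrable_const _) (hInt i), integral_const,
          probReal_univ, one_smul]
        gcongr
        exact hB i
    _ = _ := by
      rw [Finset.sum_const, Finset.card_univ, nsmul_eq_mul, mul_div_assoc]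

end Grid

variable [CompleteSpace H]
variable {κ : Type*}

lemma distortion_gaussianSeries_le_grid (t : lp (fun _ : κ => H) 2) {q : ℕ} {ψ : Fin q → H}
    (hψ : Orthonormal ℝ ψ) {M : ℕ} (hM : 0 < M) {R : ℝ}
    (hR : q * log (2 * (M : ℝ) ^ 2 + 1) ≤ R) :
    distortion (noiseMeasure κ) (gaussianSeries t) R
      ≤ q * (1 + 48 * exp ((∑' k, ‖t k‖ ^ 2) / 2)) / (M : ℝ) ^ 2
        + (∑' k, ‖t k‖ ^ 2 - ∑ j, ∑' k, ⟪ψ j, t k⟫ ^ 2) := by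
  have hm : ∀ f : H, AEMeasurable (fun ω => ⟪f, gaussianSeries t ω⟫) (noiseMeasure κ) := fun f =>
    ((memLp_gaussianSeries t).1.const_inner (c := f)).aemeasurable
  have h := distortion_le_grid (P := noiseMeasure κ) hψ (memLp_gaussianSeries t)
    (B := 48 * exp ((∑' k, ‖t k‖ ^ 2) / 2)) (fun i => ?_) (fun i => ?_) hM (R := R)
    (by simpa using hR)
  · simpa only [integral_norm_sq_gaussianSeries, integral_inner_sq_gaussianSeries,
      Fintype.card_fin] using h
  · have := integrable_pow_gaussianReal (∑' k, ⟪ψ i, t k⟫ ^ 2).toNNReal 4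
    rw [← map_inner_gaussianSeries t (ψ i)] at this
    exact this.comp_aemeasurable (hm _)
  · have h1 := integral_pow_four_gaussianReal_le (∑' k, ⟪ψ i, t k⟫ ^ 2).toNNReal
    rw [← map_inner_gaussianSeries t (ψ i), integral_map (hm _) (by fun_prop)] at h1
    refine h1.trans ?_
    rw [Real.coe_toNNReal _ (tsum_nonneg fun k => sq_nonneg _)]
    have hs : Summable fun k => ‖t k‖ ^ 2 := by
      simpa only [real_inner_self_eq_norm_sq] using (lp.hasSum_inner (𝕜 := ℝ) t t).summable
    refine mul_le_mul_of_nonneg_left (exp_le_exp.2 (div_le_div_of_nonneg_right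
      (Summable.tsum_le_tsum (fun k => ?_) (summable_inner_sq t (ψ i)) hs) two_pos.le))
      (by norm_num)
    have h2 := abs_real_inner_le_norm (ψ i) (t k)
    rw [hψ.1 i, one_mul] at h2
    exact sq_le_sq' (abs_le.1 h2).1 (abs_le.1 h2).2

end GridQuantizer

section Remainder

lemma tendsto_rpow_mul_floor_rpow {p κ e : ℝ} (hκ : 0 < κ) (he : 0 ≤ e) (hp : p < κ * e) :
    Tendsto (fun R : ℝ => R ^ p * (⌊R ^ κ⌋₊ : ℝ) ^ (-e)) atTop (nhds 0) := by
  have h1 : Tendsto (fun R : ℝ => 2 ^ e * R ^ (-(κ * e - p))) atTop (nhds (2 ^ e * 0)) :=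
    (tendsto_rpow_neg_atTop (by linarith)).const_mul _
  rw [mul_zero] at h1
  refine squeeze_zero' ?_ ?_ h1
  · filter_upwards [eventually_ge_atTop 0] with R hR
    positivity
  · filter_upwards [eventually_ge_atTop 1] with R hR
    have hR0 : 0 < R := by linarith
    have hRk : 1 ≤ R ^ κ := one_le_rpow hR hκ.le
    have hfl : R ^ κ / 2 ≤ (⌊R ^ κ⌋₊ : ℝ) := by
      have h2 := Nat.lt_floor_add_one (R ^ κ)
      have h3 : (1 : ℝ) ≤ (⌊R ^ κ⌋₊ : ℝ) := by
        exact_mod_cast Nat.one_le_iff_ne_zero.2 (Nat.floor_pos.2 hRk).ne'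
      linarith
    calc R ^ p * (⌊R ^ κ⌋₊ : ℝ) ^ (-e) ≤ R ^ p * (R ^ κ / 2) ^ (-e) :=
          mul_le_mul_of_nonneg_left
            (rpow_le_rpow_of_nonpos (by positivity) hfl (neg_nonpos.2 he)) (by positivity)
      _ = 2 ^ e * R ^ (-(κ * e - p)) := by
        rw [div_rpow (by positivity) (by norm_num), ← rpow_mul hR0.le,
          rpow_neg (by norm_num : (0 : ℝ) ≤ 2), div_inv_eq_mul, ← mul_assoc, ← rpow_add hR0,
          mul_comm]
        congr 2
        ring

variable {β : ℝ}

/-- The distortion of the remainder is negligible. -/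
lemma tendsto_distortion_remainder (hβ : 0 < β) :
    Tendsto (fun R : ℝ => R ^ (2 * β + 1) * distortion (noiseMeasure ℤ)
      (gaussianSeries ((bddKernel_perKernel hβ).sub (bddKernel_rlKernel hβ)).seq) R)
      atTop (nhds 0) := by
  set t := ((bddKernel_perKernel hβ).sub (bddKernel_rlKernel hβ)).seq with ht
  obtain ⟨κ, hκ0, hκ1, hκ2⟩ : ∃ κ : ℝ, 0 < κ ∧ κ < 1 ∧ 2 * β + 1 < κ * (κ * (2 * (β + 1))) := by
    have hε : 0 < 1 / (4 * (β + 1)) := by positivity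
    have hε1 : 1 / (4 * (β + 1)) < 1 := by
      rw [div_lt_one (by positivity)]
      linarith
    refine ⟨1 - 1 / (4 * (β + 1)), by linarith, by linarith, ?_⟩
    have : (1 - 1 / (4 * (β + 1))) * ((1 - 1 / (4 * (β + 1))) * (2 * (β + 1)))
        = 2 * β + 1 + 1 / (8 * (β + 1)) := by
      field_simp
      ring
    rw [this]
    have : 0 < 1 / (8 * (β + 1)) := by positivity
    linarith
  obtain ⟨d, hd⟩ := exists_nat_gt ((2 * β + 1) / (κ * ((1 - κ) * 2)))
  have hd2 : 2 * β + 1 < κ * ((1 - κ) * (2 * d)) := by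
    have h1 : 0 < κ * ((1 - κ) * 2) := mul_pos hκ0 (by linarith)
    rw [div_lt_iff₀ h1] at hd
    linarith
  obtain ⟨A, hA⟩ := exists_nat_gt ((2 * β + 1) / κ)
  have hA2 : 2 * β + 1 < κ * (2 * A - 1 : ℝ) := by
    rw [div_lt_iff₀ hκ0] at hA
    have hA1 : 1 ≤ A := by
      by_contra hc
      have : A = 0 := by omega
      subst this
      simp at hA
      linarith
    have : (1 : ℝ) ≤ A := by exact_mod_cast hA1
    nlinarith
  obtain ⟨C, hC, hres⟩ := exists_residual_le hβ d
  set B : ℝ := 1 + 48 * exp ((∑' k, ‖t k‖ ^ 2) / 2) with hB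
  have hlim : Tendsto (fun R : ℝ => d * B * (R ^ (2 * β + 1) * (⌊R ^ κ⌋₊ : ℝ) ^ (-(2 * A - 1 : ℝ)))
      + (C * (R ^ (2 * β + 1) * (⌊R ^ κ⌋₊ : ℝ) ^ (-((1 - κ) * (2 * d))))
        + C * (R ^ (2 * β + 1) * (⌊R ^ κ⌋₊ : ℝ) ^ (-(κ * (2 * (β + 1)))))))
      atTop (nhds (d * B * 0 + (C * 0 + C * 0))) := by
    refine ((tendsto_rpow_mul_floor_rpow hκ0 ?_ hA2).const_mul _).add
      (((tendsto_rpow_mul_floor_rpow hκ0 ?_ hd2).const_mul _).add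
        ((tendsto_rpow_mul_floor_rpow hκ0 ?_ hκ2).const_mul _))
    · by_contra hc
      nlinarith
    · have : 0 < 1 - κ := by linarith
      positivity
    · positivity
  simp only [mul_zero, add_zero] at hlim
  have hrate : ∀ᶠ R : ℝ in atTop, d * (log 3 + 2 * A * log R) ≤ R ^ (1 - κ) := by
    have h1 : (fun R : ℝ => d * (log 3 + 2 * A * log R)) =o[atTop] fun R => R ^ (1 - κ) := by
      refine Asymptotics.IsLittleO.const_mul_left ?_ _
      refine Asymptotics.IsLittleO.add ?_ ?_
      · refine Asymptotics.isLittleO_const_left.2 (Or.inr ?_)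
        exact tendsto_norm_atTop_atTop.comp (tendsto_rpow_atTop (by linarith))
      · exact (isLittleO_log_rpow_atTop (by linarith)).const_mul_left _
    filter_upwards [h1.bound one_pos, eventually_ge_atTop 0] with R hR hR0
    rw [one_mul, Real.norm_eq_abs, Real.norm_eq_abs, abs_of_nonneg (rpow_nonneg hR0 _)] at hR
    exact (le_abs_self _).trans hR
  refine squeeze_zero' ?_ ?_ hlim
  · filter_upwards [eventually_ge_atTop 0] with R hR
    exact mul_nonneg (rpow_nonneg hR _) (distortion_nonneg _)
  · filter_upwards [hrate, eventually_ge_atTop 1] with R hR hR1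
    have hR0 : 0 < R := by linarith
    set N := ⌊R ^ κ⌋₊ with hN
    have hN0 : 0 < N := Nat.floor_pos.2 (one_le_rpow hR1 hκ0.le)
    have hN' : (0 : ℝ) < N := by exact_mod_cast hN0
    have hN1 : (1 : ℝ) ≤ N := by exact_mod_cast hN0
    have hNle : (N : ℝ) ≤ R ^ κ := Nat.floor_le (by positivity)
    obtain ⟨q, hq, ψ, hψ, hψres⟩ := hres N hN0 ((N : ℝ) ^ κ) (one_le_rpow hN1 hκ0.le)
      ((rpow_le_rpow_of_exponent_le hN1 hκ1.le).trans_eq (rpow_one _))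
    have hq' : (q : ℝ) ≤ N * d := by exact_mod_cast hq
    have hlogM : log (2 * ((N ^ A : ℕ) : ℝ) ^ 2 + 1) ≤ log 3 + 2 * A * log R := by
      have h1 : 2 * ((N ^ A : ℕ) : ℝ) ^ 2 + 1 ≤ 3 * R ^ (2 * A) := by
        have h2 : ((N ^ A : ℕ) : ℝ) ^ 2 = (N : ℝ) ^ (2 * A) := by
          push_cast
          ring
        have h3 : (1 : ℝ) ≤ (N : ℝ) ^ (2 * A) := one_le_pow₀ hN1
        have h4 : (N : ℝ) ^ (2 * A) ≤ R ^ (2 * A) := by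
          gcongr
          refine hNle.trans ?_
          calc R ^ κ ≤ R ^ (1 : ℝ) := rpow_le_rpow_of_exponent_le hR1 hκ1.le
            _ = R := rpow_one R
        rw [h2]
        linarith
      refine (log_le_log (by positivity) h1).trans_eq ?_
      rw [log_mul (by norm_num) (by positivity), log_pow]
      push_cast
      ring
    have hlog0 : 0 ≤ log (2 * ((N ^ A : ℕ) : ℝ) ^ 2 + 1) := log_nonneg (by
      have : 0 ≤ 2 * ((N ^ A : ℕ) : ℝ) ^ 2 := by positivity
      linarith)
    have hlog1 : 0 ≤ log 3 + 2 * A * log R := hlog0.trans hlogM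
    have hqR : q * log (2 * ((N ^ A : ℕ) : ℝ) ^ 2 + 1) ≤ R := by
      calc q * log (2 * ((N ^ A : ℕ) : ℝ) ^ 2 + 1)
          ≤ (N * d) * (log 3 + 2 * A * log R) := by gcongr
        _ = N * (d * (log 3 + 2 * A * log R)) := by ring
        _ ≤ R ^ κ * R ^ (1 - κ) := by gcongr
        _ = R := by
          rw [← rpow_add hR0, add_sub_cancel, rpow_one]
    have hmain := distortion_gaussianSeries_le_grid t hψ (M := N ^ A) (by positivity) hqR
    have hB0 : 0 < B := by positivity
    have hfirst : q * B / ((N ^ A : ℕ) : ℝ) ^ 2 ≤ d * B * (N : ℝ) ^ (-(2 * A - 1 : ℝ)) := by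
      have h1 : (N : ℝ) ^ (-(2 * A - 1 : ℝ)) = N / ((N ^ A : ℕ) : ℝ) ^ 2 := by
        rw [neg_sub, rpow_sub hN', rpow_one]
        congr 1
        rw [show (2 * A : ℝ) = ((2 * A : ℕ) : ℝ) by push_cast; ring, rpow_natCast]
        push_cast
        ring
      rw [h1, mul_div_assoc', div_le_div_iff_of_pos_right (by positivity)]
      nlinarith
    have hsec : ((N : ℝ) ^ κ / N) ^ (2 * d) = (N : ℝ) ^ (-((1 - κ) * (2 * d))) := by
      rw [← rpow_sub_one hN'.ne', ← rpow_natCast, ← rpow_mul hN'.le]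
      push_cast
      ring_nf
    have hthird : ((N : ℝ) ^ κ)⁻¹ ^ (2 * (β + 1)) = (N : ℝ) ^ (-(κ * (2 * (β + 1)))) := by
      rw [← rpow_neg hN'.le, ← rpow_mul hN'.le, neg_mul]
    rw [hsec, hthird] at hψres
    have hRp : 0 ≤ R ^ (2 * β + 1) := by positivity
    calc _ ≤ R ^ (2 * β + 1) * (d * B * (N : ℝ) ^ (-(2 * A - 1 : ℝ))
          + C * ((N : ℝ) ^ (-((1 - κ) * (2 * d))) + (N : ℝ) ^ (-(κ * (2 * (β + 1)))))) :=
          mul_le_mul_of_nonneg_left (hmain.trans (add_le_add hfirst hψres)) hRp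
      _ = _ := by ring

end Remainder

section StolzCesaro

lemma eventually_le_mul_of_sub_le {T b : ℕ → ℝ} {c : ℝ} (hT : Tendsto T atTop (nhds 0))
    (hb : Tendsto b atTop (nhds 0))
    (h : ∀ᶠ n in atTop, T n - T (n + 1) ≤ c * (b n - b (n + 1))) :
    ∀ᶠ n in atTop, T n ≤ c * b n := by
  obtain ⟨N, hN⟩ := eventually_atTop.1 h
  have hlim : Tendsto (fun n => T (n + N) - c * b (n + N)) atTop (nhds 0) := by
    have := (hT.sub (hb.const_mul c)).comp (tendsto_add_atTop_nat N)
    rwa [mul_zero, sub_zero] at this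
  have hmono : Monotone fun n => T (n + N) - c * b (n + N) := by
    refine monotone_nat_of_le_succ fun n => ?_
    have := hN (n + N) (by omega)
    rw [show n + 1 + N = n + N + 1 by ring]
    linarith
  filter_upwards [eventually_ge_atTop N] with n hn
  have := hmono.ge_of_tendsto hlim (n - N)
  simp only [Nat.sub_add_cancel hn] at this
  linarith

/-- The Stolz–Cesàro theorem for null sequences. -/
lemma tendsto_div_of_tendsto_sub_div {T b : ℕ → ℝ} {l : ℝ} (hT : Tendsto T atTop (nhds 0))
    (hb : Tendsto b atTop (nhds 0)) (hanti : ∀ᶠ n in atTop, b (n + 1) < b n)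
    (hpos : ∀ᶠ n in atTop, 0 < b n)
    (h : Tendsto (fun n => (T n - T (n + 1)) / (b n - b (n + 1))) atTop (nhds l)) :
    Tendsto (fun n => T n / b n) atTop (nhds l) := by
  refine tendsto_order.2 ⟨fun c hc => ?_, fun c hc => ?_⟩
  · obtain ⟨c', hc', hc'l⟩ := exists_between hc
    have hT' : Tendsto (fun n => -T n) atTop (nhds 0) := by simpa using hT.neg
    have := eventually_le_mul_of_sub_le (c := -c') hT' hb (by
      filter_upwards [h.eventually_const_lt hc'l, hanti] with n hn hn2
      rw [lt_div_iff₀ (by linarith)] at hn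
      linarith)
    filter_upwards [this, hpos] with n hn hn2
    rw [lt_div_iff₀ hn2]
    nlinarith
  · obtain ⟨c', hlc', hc'⟩ := exists_between hc
    have := eventually_le_mul_of_sub_le (c := c') hT hb (by
      filter_upwards [h.eventually_lt_const hlc', hanti] with n hn hn2
      rw [div_lt_iff₀ (by linarith)] at hn
      linarith)
    filter_upwards [this, hpos] with n hn hn2
    rw [div_lt_iff₀ hn2]
    nlinarith

lemma tendsto_mul_one_sub_one_add_inv_rpow (q : ℝ) :
    Tendsto (fun n : ℕ => (n : ℝ) * (1 - (1 + (n : ℝ)⁻¹) ^ (-q))) atTop (nhds q) := by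
  have h1 : HasDerivAt (fun x : ℝ => x ^ (-q)) (-q) 1 := by
    simpa using Real.hasDerivAt_rpow_const (x := 1) (p := -q) (Or.inl one_ne_zero)
  have h2 : Tendsto (fun n : ℕ => (n : ℝ)⁻¹) atTop (nhdsWithin 0 {0}ᶜ) := by
    refine tendsto_nhdsWithin_iff.2 ⟨tendsto_inv_atTop_nhds_zero_nat, ?_⟩
    filter_upwards [eventually_gt_atTop 0] with n hn
    have : (n : ℝ) ≠ 0 := by positivity
    simpa using this
  have h3 := ((hasDerivAt_iff_tendsto_slope_zero.1 h1).comp h2).neg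
  rw [neg_neg] at h3
  refine h3.congr fun n => ?_
  simp only [Function.comp_apply, inv_inv, one_rpow, smul_eq_mul]
  ring

/-- Tails of sequences with regularly varying increments. -/
lemma tendsto_rpow_mul_of_tendsto_sub {T : ℕ → ℝ} {q c : ℝ} (hq : 0 < q)
    (hT : Tendsto T atTop (nhds 0))
    (h : Tendsto (fun n : ℕ => (n : ℝ) ^ (q + 1) * (T n - T (n + 1))) atTop (nhds c)) :
    Tendsto (fun n : ℕ => (n : ℝ) ^ q * T n) atTop (nhds (c / q)) := by
  have hb : Tendsto (fun n : ℕ => (n : ℝ) ^ (-q)) atTop (nhds 0) :=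
    (tendsto_rpow_neg_atTop hq).comp tendsto_natCast_atTop_atTop
  have hkey := tendsto_div_of_tendsto_sub_div (l := c / q) hT hb ?_ ?_ ?_
  · refine hkey.congr fun n => ?_
    rw [rpow_neg n.cast_nonneg, div_inv_eq_mul, mul_comm]
  · filter_upwards [eventually_gt_atTop 0] with n hn
    have : (0 : ℝ) < n := by exact_mod_cast hn
    exact rpow_lt_rpow_of_neg this (by push_cast; linarith) (by linarith)
  · filter_upwards [eventually_gt_atTop 0] with n hn
    have : (0 : ℝ) < n := by exact_mod_cast hn
    positivity
  · refine (h.div (tendsto_mul_one_sub_one_add_inv_rpow q) hq.ne').congr' ?_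
    filter_upwards [eventually_gt_atTop 0] with n hn
    have hn' : (0 : ℝ) < n := by exact_mod_cast hn
    have h1 : (n : ℝ) * (1 - (1 + (n : ℝ)⁻¹) ^ (-q))
        = (n : ℝ) ^ (q + 1) * ((n : ℝ) ^ (-q) - ((n + 1 : ℕ) : ℝ) ^ (-q)) := by
      have h2 : ((n + 1 : ℕ) : ℝ) = n * (1 + (n : ℝ)⁻¹) := by
        push_cast
        field_simp
      rw [h2, mul_rpow hn'.le (by positivity), rpow_add hn', rpow_one]
      have h3 : (n : ℝ) ^ q * (n : ℝ) ^ (-q) = 1 := by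
        rw [← rpow_add hn', add_neg_cancel, rpow_zero]
      linear_combination (-(n : ℝ) * (1 - (1 + (n : ℝ)⁻¹) ^ (-q))) * h3
    rw [Pi.div_apply, h1, mul_div_mul_left _ _ (by positivity)]

end StolzCesaro

section Eigenvalues

variable {β : ℝ}

lemma tendsto_rpow_mul_eigval :
    Tendsto (fun n : ℕ => (n : ℝ) ^ (2 * (β + 1)) * eigval β n) atTop
      (nhds ((2 * π) ^ (-(2 * (β + 1))))) := by
  have h1 : Tendsto (fun n : ℕ => (((n : ℝ)⁻¹) ^ 2 + (2 * π) ^ 2) ^ (-(β + 1))) atTop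
      (nhds ((0 ^ 2 + (2 * π) ^ 2) ^ (-(β + 1)))) := by
    refine Tendsto.rpow_const ?_ (Or.inl (by positivity))
    exact (tendsto_inv_atTop_nhds_zero_nat.pow 2).add_const _
  have h2 : ((0 : ℝ) ^ 2 + (2 * π) ^ 2) ^ (-(β + 1)) = (2 * π) ^ (-(2 * (β + 1))) := by
    rw [zero_pow two_ne_zero, zero_add, ← rpow_natCast, ← rpow_mul (by positivity)]
    congr 1
    push_cast
    ring
  rw [h2] at h1
  refine h1.congr' ?_
  filter_upwards [eventually_gt_atTop 0] with n hn
  have hn' : (0 : ℝ) < n := by exact_mod_cast hn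
  have h3 : ((n : ℝ)⁻¹) ^ 2 + (2 * π) ^ 2 = (1 + (2 * π * n) ^ 2) / (n : ℝ) ^ 2 := by
    field_simp
  have h4 : ((n : ℝ) ^ 2) ^ (-(β + 1)) = ((n : ℝ) ^ (2 * (β + 1)))⁻¹ := by
    rw [← rpow_natCast, ← rpow_mul hn'.le, ← rpow_neg hn'.le]
    congr 1
    push_cast
    ring
  rw [h3, div_rpow (by positivity) (by positivity), h4, div_inv_eq_mul, mul_comm, eigval,
    Int.cast_natCast]

lemma eigval_neg (k : ℤ) : eigval β (-k) = eigval β k := by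
  simp [eigval]

lemma eigval_le_of_abs_le (hβ : 0 < β) {j k : ℤ} (h : |j| ≤ |k|) : eigval β k ≤ eigval β j := by
  have h1 : (j : ℝ) ^ 2 ≤ (k : ℝ) ^ 2 := by exact_mod_cast sq_le_sq.2 h
  refine rpow_le_rpow_of_nonpos (by positivity) ?_ (by linarith)
  rw [mul_pow, mul_pow _ (k : ℝ)]
  gcongr

lemma eigval_le_one (hβ : 0 < β) (k : ℤ) : eigval β k ≤ 1 := by
  have := eigval_le_of_abs_le hβ (j := 0) (k := k) (by simp)
  simpa [eigval] using this

lemma tendsto_mul_log_eigval_div :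
    Tendsto (fun n : ℕ => (n : ℝ) * log (eigval β n / eigval β (n + 1))) atTop
      (nhds (2 * (β + 1))) := by
  have hg : Tendsto (fun n : ℕ => (n : ℝ) * ((2 * π) ^ 2 * (2 * n + 1) / (1 + (2 * π * n) ^ 2)))
      atTop (nhds 2) := by
    have h0 := tendsto_inv_atTop_nhds_zero_nat (𝕜 := ℝ)
    have h1 : Tendsto (fun n : ℕ => (2 * π) ^ 2 * (2 + (n : ℝ)⁻¹)
        / (((n : ℝ)⁻¹) ^ 2 + (2 * π) ^ 2)) atTop
        (nhds ((2 * π) ^ 2 * (2 + 0) / (0 ^ 2 + (2 * π) ^ 2))) :=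
      ((h0.const_add 2).const_mul _).div ((h0.pow 2).add_const _) (by positivity)
    have h2 : (2 * π) ^ 2 * (2 + 0) / (0 ^ 2 + (2 * π) ^ 2) = 2 := by
      field_simp
      ring
    rw [h2] at h1
    refine h1.congr' ?_
    filter_upwards [eventually_gt_atTop 0] with n hn
    have hn' : (0 : ℝ) < n := by exact_mod_cast hn
    field_simp
  have h := (Real.tendsto_nat_mul_log_one_add_of_tendsto hg).const_mul (β + 1)
  rw [mul_comm (β + 1) 2] at h
  refine h.congr fun n => ?_
  have h1 : eigval β n / eigval β (n + 1)
      = (1 + (2 * π) ^ 2 * (2 * n + 1) / (1 + (2 * π * n) ^ 2)) ^ (β + 1) := by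
    rw [eigval, eigval, rpow_neg (by positivity), rpow_neg (by positivity), inv_div_inv,
      ← div_rpow (by positivity) (by positivity)]
    congr 1
    push_cast
    field_simp
    ring
  rw [h1, log_rpow (by positivity)]
  ring

/-- The rate needed to resolve the coordinates `|k| ≤ K` down to the water level `eigval β K`. -/
noncomputable def waterRate (β : ℝ) (K : ℕ) : ℝ :=
  ∑ k ∈ Finset.Icc (-(K : ℤ)) K, 1 / 2 * log (eigval β k / eigval β K)

lemma card_Icc_neg_self (K : ℕ) : ((Finset.Icc (-(K : ℤ)) K).card : ℝ) = 2 * K + 1 := by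
  rw [Int.card_Icc, show (K : ℤ) + 1 - -(K : ℤ) = ((2 * K + 1 : ℕ) : ℤ) by push_cast; ring,
    Int.toNat_natCast]
  push_cast
  ring

lemma waterRate_succ_sub (K : ℕ) : waterRate β (K + 1) - waterRate β K
    = (2 * K + 1) / 2 * log (eigval β K / eigval β (K + 1)) := by
  have hp : ∀ k, eigval β k ≠ 0 := fun k => (eigval_pos k).ne'
  rw [waterRate, waterRate, Nat.cast_succ, Finset.sum_Icc_succ_eq_add_endpoints, eigval_neg,
    div_self (hp _), log_one, mul_zero, zero_add, zero_add, ← Finset.sum_sub_distrib,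
    Finset.sum_congr rfl (g := fun _ => 1 / 2 * log (eigval β K / eigval β (K + 1))),
    Finset.sum_const, nsmul_eq_mul, card_Icc_neg_self]
  · ring
  · intro k _
    rw [log_div (hp _) (hp _), log_div (hp _) (hp _), log_div (hp _) (hp _)]
    ring

lemma tendsto_waterRate_div :
    Tendsto (fun K : ℕ => waterRate β K / K) atTop (nhds (2 * (β + 1))) := by
  have h0 : waterRate β 0 = 0 := by
    simp [waterRate, div_self (eigval_pos (β := β) 0).ne']
  have h1 : Tendsto (fun K : ℕ => waterRate β (K + 1) - waterRate β K) atTop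
      (nhds (2 * (β + 1))) := by
    have h2 : Tendsto (fun n : ℕ => (1 + (n : ℝ)⁻¹ / 2)
        * ((n : ℝ) * log (eigval β n / eigval β (n + 1)))) atTop
        (nhds ((1 + 0 / 2) * (2 * (β + 1)))) :=
      ((tendsto_inv_atTop_nhds_zero_nat.div_const 2).const_add 1).mul (tendsto_mul_log_eigval_div)
    rw [zero_div, add_zero, one_mul] at h2
    refine h2.congr' ?_
    filter_upwards [eventually_gt_atTop 0] with n hn
    have hn' : (0 : ℝ) < n := by exact_mod_cast hn
    rw [waterRate_succ_sub]
    field_simp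
  refine h1.cesaro.congr fun n => ?_
  rw [Finset.sum_range_sub, h0, sub_zero, inv_mul_eq_div]

/-- The mass of the eigenvalues outside of `|k| ≤ K`. -/
noncomputable def eigTail (β : ℝ) (K : ℕ) : ℝ :=
  ∑' k, eigval β k - ∑ k ∈ Finset.Icc (-(K : ℤ)) K, eigval β k

lemma tendsto_finset_Icc_atTop :
    Tendsto (fun K : ℕ => Finset.Icc (-(K : ℤ)) K) atTop atTop := by
  refine tendsto_atTop_finset_of_monotone (fun a b h => ?_) fun x => ⟨x.natAbs, ?_⟩
  · exact Finset.Icc_subset_Icc (by simpa using h) (by exact_mod_cast h)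
  · rw [Finset.mem_Icc]
    omega

lemma tendsto_rpow_mul_eigTail (hβ : 0 < β) (hs : Summable (eigval β)) :
    Tendsto (fun K : ℕ => (K : ℝ) ^ (2 * β + 1) * eigTail β K) atTop
      (nhds (2 * (2 * π) ^ (-(2 * (β + 1))) / (2 * β + 1))) := by
  refine tendsto_rpow_mul_of_tendsto_sub (by linarith) ?_ ?_
  · have := (hs.hasSum.comp tendsto_finset_Icc_atTop).const_sub (∑' k, eigval β k)
    rwa [sub_self] at this
  · have h1 : ∀ K, eigTail β K - eigTail β (K + 1) = 2 * eigval β (K + 1 : ℕ) := by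
      intro K
      rw [eigTail, eigTail, Nat.cast_succ, Finset.sum_Icc_succ_eq_add_endpoints, eigval_neg]
      ring
    have h2 := (tendsto_rpow_mul_eigval (β := β)).comp (tendsto_add_atTop_nat 1)
    have h3 : Tendsto (fun n : ℕ => (1 + (n : ℝ)⁻¹) ^ (-(2 * (β + 1)))) atTop
        (nhds ((1 + 0) ^ (-(2 * (β + 1))))) :=
      (tendsto_inv_atTop_nhds_zero_nat.const_add 1).rpow_const (Or.inl (by norm_num))
    rw [add_zero, one_rpow] at h3
    have h4 := (h3.mul h2).const_mul 2
    rw [one_mul] at h4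
    refine h4.congr' ?_
    filter_upwards [eventually_gt_atTop 0] with n hn
    have hn' : (0 : ℝ) < n := by exact_mod_cast hn
    have h5 : ((n + 1 : ℕ) : ℝ) = n * (1 + (n : ℝ)⁻¹) := by
      push_cast
      field_simp
    have h6 : (1 + (n : ℝ)⁻¹) ^ (-(2 * (β + 1))) * ((n + 1 : ℕ) : ℝ) ^ (2 * (β + 1))
        = (n : ℝ) ^ (2 * β + 1 + 1) := by
      rw [h5, mul_rpow hn'.le (by positivity), mul_left_comm, ← rpow_add (by positivity),
        neg_add_cancel, rpow_zero, mul_one]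
      congr 1
      ring
    simp only [Function.comp_apply]
    rw [h1, ← h6]
    ring

end Eigenvalues

section Diagonal

variable {β : ℝ}

lemma eigval_le_of_mem_Icc (hβ : 0 < β) {K : ℕ} {k : ℤ} (hk : k ∈ Finset.Icc (-(K : ℤ)) K) :
    eigval β K ≤ eigval β k :=
  eigval_le_of_abs_le hβ (by
    rw [Finset.mem_Icc] at hk
    rw [Nat.abs_cast, abs_le]
    exact hk)

lemma eigval_le_of_notMem_Icc (hβ : 0 < β) {K : ℕ} {k : ℤ} (hk : k ∉ Finset.Icc (-(K : ℤ)) K) :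
    eigval β k ≤ eigval β K :=
  eigval_le_of_abs_le hβ (by
    rw [Finset.mem_Icc, ← abs_le] at hk
    rw [Nat.abs_cast]
    exact (not_le.1 hk).le)

lemma meanLogWeight_of_le {θ v : ℝ} (hθ : 0 < θ) (h : v ≤ θ) :
    meanLogWeight θ v = v / (2 * θ) := by
  unfold meanLogWeight
  split_ifs with h'
  · obtain rfl := le_antisymm h h'
    rw [div_self hθ.ne', log_one]
    field_simp
    ring
  · rfl

variable {H : Type*} [NormedAddCommGroup H] [InnerProductSpace ℝ H] {φ : ℤ → H}
  {t : lp (fun _ : ℤ => H) 2}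

lemma norm_sq_of_eq_smul (hφ : Orthonormal ℝ φ) (ht : ∀ k, t k = √(eigval β k) • φ k) (k : ℤ) :
    ‖t k‖ ^ 2 = eigval β k := by
  rw [ht, norm_smul, hφ.1, mul_one, norm_of_nonneg (Real.sqrt_nonneg _),
    Real.sq_sqrt (eigval_pos k).le]

lemma summable_eigval (hφ : Orthonormal ℝ φ) (ht : ∀ k, t k = √(eigval β k) • φ k) :
    Summable (eigval β) := by
  have := (lp.hasSum_inner (𝕜 := ℝ) t t).summable
  simp only [real_inner_self_eq_norm_sq] at this
  exact this.congr fun k => (norm_sq_of_eq_smul hφ ht k)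

variable [CompleteSpace H]

lemma map_inner_diagonal (hφ : Orthonormal ℝ φ) (ht : ∀ k, t k = √(eigval β k) • φ k)
    (F : Finset ℤ) :
    (noiseMeasure ℤ).map (fun ω (i : F) => ⟪φ i, gaussianSeries t ω⟫)
      = Measure.pi fun i : F => gaussianReal 0 (eigval β i).toNNReal := by
  rw [map_inner_gaussianSeries_of_orthonormal hφ t ht F]
  simp only [Real.sq_sqrt (eigval_pos _).le]

lemma le_distortion_diagonal (hβ : 0 < β) (hφ : Orthonormal ℝ φ)
    (ht : ∀ k, t k = √(eigval β k) • φ k) (K : ℕ) {R : ℝ} (hR : 0 ≤ R) :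
    2 * eigval β K * (waterRate β K - R) + (2 * K + 1) * eigval β K + eigTail β K
      ≤ distortion (noiseMeasure ℤ) (gaussianSeries t) R := by
  have hθ : 0 < eigval β (K : ℤ) := eigval_pos _
  set θ := eigval β (K : ℤ) with hθdef
  have hlow : ∀ K' : ℕ, 2 * θ * (∑ k ∈ Finset.Icc (-(K' : ℤ)) K', meanLogWeight θ (eigval β k) - R)
      ≤ distortion (noiseMeasure ℤ) (gaussianSeries t) R := by
    intro K'
    have h := le_distortion_of_gaussian_coords
      (hφ.comp (Subtype.val : (Finset.Icc (-(K' : ℤ)) K') → ℤ) Subtype.val_injective)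
      (memLp_gaussianSeries t) (map_inner_diagonal hφ ht _) hθ hR
    simp only [Real.coe_toNNReal _ (eigval_pos (β := β) _).le] at h
    rwa [Finset.sum_coe_sort (Finset.Icc (-(K' : ℤ)) K')
      fun k => meanLogWeight θ (eigval β k)] at h
  have hsplit : ∀ K' ≥ K, ∑ k ∈ Finset.Icc (-(K' : ℤ)) K', meanLogWeight θ (eigval β k)
      = ∑ k ∈ Finset.Icc (-(K' : ℤ)) K', eigval β k / (2 * θ)
        + ∑ k ∈ Finset.Icc (-(K : ℤ)) K,
          (1 / 2 * log (eigval β k / θ) + 1 / 2 - eigval β k / (2 * θ)) := by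
    intro K' hK'
    rw [← sub_eq_iff_eq_add', ← Finset.sum_sub_distrib]
    have hsub : Finset.Icc (-(K : ℤ)) K ⊆ Finset.Icc (-(K' : ℤ)) K' :=
      Finset.Icc_subset_Icc (by simpa using hK') (by exact_mod_cast hK')
    rw [← Finset.sum_subset hsub]
    · refine Finset.sum_congr rfl fun k hk => ?_
      rw [meanLogWeight, if_pos (eigval_le_of_mem_Icc hβ hk)]
    · intro k _ hk
      rw [meanLogWeight_of_le hθ (eigval_le_of_notMem_Icc hβ hk), sub_self]
  have hlim : Tendsto (fun K' : ℕ => 2 * θ * (∑ k ∈ Finset.Icc (-(K' : ℤ)) K', eigval β k / (2 * θ)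
        + ∑ k ∈ Finset.Icc (-(K : ℤ)) K,
          (1 / 2 * log (eigval β k / θ) + 1 / 2 - eigval β k / (2 * θ)) - R)) atTop
      (nhds (2 * θ * ((∑' k, eigval β k) / (2 * θ) + ∑ k ∈ Finset.Icc (-(K : ℤ)) K,
          (1 / 2 * log (eigval β k / θ) + 1 / 2 - eigval β k / (2 * θ)) - R))) := by
    refine (((Tendsto.add_const _ ?_).sub_const _).const_mul _)
    exact ((summable_eigval hφ ht).hasSum.div_const _).comp tendsto_finset_Icc_atTop
  refine le_trans (le_of_eq ?_) (le_of_tendsto hlim ?_)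
  · rw [Finset.sum_sub_distrib, Finset.sum_add_distrib, Finset.sum_const, nsmul_eq_mul,
      card_Icc_neg_self, ← Finset.sum_div, waterRate, eigTail]
    field_simp
    ring
  · filter_upwards [eventually_ge_atTop K] with K' hK'
    rw [← hsplit K' hK']
    exact hlow K'

lemma distortion_diagonal_le (hβ : 0 < β) (hφ : Orthonormal ℝ φ)
    (ht : ∀ k, t k = √(eigval β k) • φ k) (K : ℕ) {ε R : ℝ} (hε : 0 < ε) (hε1 : ε ≤ 1)
    (hR : waterRate β K + 2 * ε * (2 * K + 1) + 2 ≤ R) :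
    distortion (noiseMeasure ℤ) (gaussianSeries t) R
      ≤ (2 * K + 1) * eigval β K * (1 + ε)
        + exp (-(ε ^ 2 / 32 * (2 * K + 1))) * (96 * (2 * K + 1) ^ 2 + 4) + eigTail β K := by
  have hco : ∀ k, ((eigval β k).toNNReal : ℝ) = eigval β k := fun k =>
    Real.coe_toNNReal _ (eigval_pos k).le
  have hcard : (Fintype.card (Finset.Icc (-(K : ℤ)) K) : ℝ) = 2 * K + 1 := by
    rw [Fintype.card_coe, card_Icc_neg_self]
  have h := distortion_le_of_gaussian_coords
    (hφ.comp (Subtype.val : (Finset.Icc (-(K : ℤ)) K) → ℤ) Subtype.val_injective)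
    (memLp_gaussianSeries t) (map_inner_diagonal hφ ht _) (θ := (eigval β K).toNNReal)
    (Real.toNNReal_pos.2 (eigval_pos _))
    (fun i => Real.toNNReal_le_toNNReal (eigval_le_of_mem_Icc hβ i.2))
    (fun i => Real.toNNReal_le_one.2 (eigval_le_one hβ _)) hε hε1 (R := R) (by
      rw [hcard]
      simp only [hco]
      rwa [Finset.sum_coe_sort (Finset.Icc (-(K : ℤ)) K)
        fun k => 1 / 2 * log (eigval β k / eigval β K)])
  rw [hcard, integral_norm_sq_gaussianSeries] at h
  simp only [hco, norm_sq_of_eq_smul hφ ht] at h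
  rwa [Finset.sum_coe_sort (Finset.Icc (-(K : ℤ)) K) fun k => eigval β k] at h

lemma tendsto_floor_div {a : ℝ} (ha : 0 < a) :
    Tendsto (fun R : ℝ => ⌊R / a⌋₊) atTop atTop :=
  tendsto_nat_floor_atTop.comp (tendsto_id.atTop_div_const ha)

lemma tendsto_div_floor_div {a : ℝ} (ha : 0 < a) :
    Tendsto (fun R : ℝ => R / (⌊R / a⌋₊ : ℝ)) atTop (nhds a) := by
  have h := (tendsto_nat_floor_mul_div_atTop (R := ℝ) (inv_nonneg.2 ha.le)).inv₀
    (inv_ne_zero ha.ne')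
  rw [inv_inv] at h
  refine h.congr fun R => ?_
  rw [inv_div, inv_mul_eq_div]

lemma tendsto_rpow_mul_of_floor {a p c : ℝ} (ha : 0 < a) {f : ℕ → ℝ}
    (h : Tendsto (fun K : ℕ => (K : ℝ) ^ p * f K) atTop (nhds c)) :
    Tendsto (fun R : ℝ => R ^ p * f ⌊R / a⌋₊) atTop (nhds (a ^ p * c)) := by
  refine (((tendsto_div_floor_div ha).rpow_const (p := p) (Or.inl ha.ne')).mul
    (h.comp (tendsto_floor_div ha))).congr' ?_
  filter_upwards [(tendsto_floor_div ha).eventually_gt_atTop 0, eventually_ge_atTop 0] with R hR hR0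
  have hK : (0 : ℝ) < ⌊R / a⌋₊ := by exact_mod_cast hR
  simp only [Function.comp_apply]
  rw [div_rpow hR0 hK.le]
  field_simp

lemma tendsto_rpow_mul_card_mul_eigval :
    Tendsto (fun K : ℕ => (K : ℝ) ^ (2 * β + 1) * ((2 * K + 1) * eigval β K)) atTop
      (nhds (2 * (2 * π) ^ (-(2 * (β + 1))))) := by
  have h := ((tendsto_inv_atTop_nhds_zero_nat (𝕜 := ℝ)).const_add 2).mul
    (tendsto_rpow_mul_eigval (β := β))
  rw [add_zero] at h
  refine h.congr' ?_
  filter_upwards [eventually_gt_atTop 0] with K hK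
  have hK' : (0 : ℝ) < K := by exact_mod_cast hK
  rw [show 2 * (β + 1) = 2 * β + 1 + 1 by ring, rpow_add hK', rpow_one]
  field_simp

lemma tendsto_rpow_mul_exp_mul_card_sq (p : ℝ) {c : ℝ} (hc : 0 < c) :
    Tendsto (fun K : ℕ => (K : ℝ) ^ p * (exp (-(c * (2 * K + 1))) * (96 * (2 * K + 1) ^ 2 + 4)))
      atTop (nhds 0) := by
  have h1 : Tendsto (fun K : ℕ => 868 * ((K : ℝ) ^ (p + 2) * exp (-c * K))) atTop
      (nhds (868 * 0)) :=
    ((tendsto_rpow_mul_exp_neg_mul_atTop_nhds_zero (p + 2) c hc).comp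
      tendsto_natCast_atTop_atTop).const_mul _
  rw [mul_zero] at h1
  refine squeeze_zero' (Eventually.of_forall fun K => by positivity) ?_ h1
  filter_upwards [eventually_ge_atTop 1] with K hK
  have hK1 : (1 : ℝ) ≤ K := by exact_mod_cast hK
  have hK0 : (0 : ℝ) < K := by linarith
  have h2 : exp (-(c * (2 * K + 1))) ≤ exp (-c * K) := exp_le_exp.2 (by nlinarith)
  have h3 : 96 * (2 * (K : ℝ) + 1) ^ 2 + 4 ≤ 868 * (K : ℝ) ^ 2 := by nlinarith
  calc (K : ℝ) ^ p * (exp (-(c * (2 * K + 1))) * (96 * (2 * K + 1) ^ 2 + 4))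
      ≤ (K : ℝ) ^ p * (exp (-c * K) * (868 * (K : ℝ) ^ 2)) := by gcongr
    _ = _ := by
      rw [rpow_add hK0, rpow_two]
      ring

/-- The sharp asymptotics of the distortion in the diagonal case. -/
lemma tendsto_distortion_diagonal (hβ : 0 < β) (hφ : Orthonormal ℝ φ)
    (ht : ∀ k, t k = √(eigval β k) • φ k) :
    Tendsto (fun R : ℝ => R ^ (2 * β + 1) * distortion (noiseMeasure ℤ) (gaussianSeries t) R) atTop
      (nhds ((2 * (β + 1)) ^ (2 * β + 1) * (2 * (2 * π) ^ (-(2 * (β + 1)))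
        + 2 * (2 * π) ^ (-(2 * (β + 1))) / (2 * β + 1)))) := by
  have htail := tendsto_rpow_mul_eigTail hβ (summable_eigval hφ ht)
  have hcard := tendsto_rpow_mul_card_mul_eigval (β := β)
  set L := (2 * π) ^ (-(2 * (β + 1))) with hL
  refine tendsto_order.2 ⟨fun c hc => ?_, fun c hc => ?_⟩
  · have ha : 0 < 2 * (β + 1) := by linarith
    set a := 2 * (β + 1) with hadef
    have h1 := tendsto_rpow_mul_of_floor ha
      (f := fun K => (2 * K + 1) * eigval β K + eigTail β K)
      ((hcard.add htail).congr fun K => (mul_add _ _ _).symm)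
    have h2 : Tendsto (fun R : ℝ => R ^ (2 * β + 1)
        * (2 * eigval β (⌊R / a⌋₊ : ℕ) * (waterRate β ⌊R / a⌋₊ - R))) atTop (nhds 0) := by
      have h3 := (((tendsto_div_floor_div ha).rpow_const (p := 2 * β + 1) (Or.inl ha.ne')).mul
        (((tendsto_rpow_mul_eigval (β := β)).comp (tendsto_floor_div ha)).const_mul 2)).mul
        (((tendsto_waterRate_div (β := β)).comp (tendsto_floor_div ha)).sub
          (tendsto_div_floor_div ha))
      rw [sub_self, mul_zero] at h3
      refine h3.congr' ?_
      filter_upwards [(tendsto_floor_div ha).eventually_gt_atTop 0, eventually_ge_atTop 0]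
        with R hR hR0
      have hK : (0 : ℝ) < ⌊R / a⌋₊ := by exact_mod_cast hR
      simp only [Function.comp_apply]
      rw [div_rpow hR0 hK.le, show 2 * (β + 1) = 2 * β + 1 + 1 by ring, rpow_add hK (2 * β + 1) 1,
        rpow_one]
      field_simp
    have h4 := h1.add h2
    rw [add_zero] at h4
    filter_upwards [h4.eventually_const_lt hc, eventually_ge_atTop 0] with R hR hR0
    refine hR.trans_le ?_
    have h5 := mul_le_mul_of_nonneg_left (le_distortion_diagonal hβ hφ ht ⌊R / a⌋₊ hR0)
      (rpow_nonneg hR0 (2 * β + 1))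
    refine le_trans (le_of_eq ?_) h5
    ring
  · have hcont : Tendsto (fun ε : ℝ => (2 * (β + 1) + 5 * ε) ^ (2 * β + 1)
        * ((1 + ε) * (2 * L) + 2 * L / (2 * β + 1))) (nhdsWithin 0 (Set.Ioi 0))
        (nhds ((2 * (β + 1)) ^ (2 * β + 1) * (2 * L + 2 * L / (2 * β + 1)))) := by
      have : ContinuousAt (fun ε : ℝ => (2 * (β + 1) + 5 * ε) ^ (2 * β + 1)
        * ((1 + ε) * (2 * L) + 2 * L / (2 * β + 1))) 0 := by
        refine ContinuousAt.mul (ContinuousAt.rpow_const (by fun_prop) (Or.inr (by linarith)))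
          (by fun_prop)
      have h := this.tendsto.mono_left (nhdsWithin_le_nhds (s := Set.Ioi (0 : ℝ)))
      simpa using h
    obtain ⟨ε, hεc, hε0, hε1⟩ : ∃ ε : ℝ, (2 * (β + 1) + 5 * ε) ^ (2 * β + 1)
        * ((1 + ε) * (2 * L) + 2 * L / (2 * β + 1)) < c ∧ 0 < ε ∧ ε ≤ 1 := by
      obtain ⟨ε, h1, h2⟩ := ((hcont.eventually_lt_const hc).and
        (Ioc_mem_nhdsGT (one_pos : (0 : ℝ) < 1))).exists
      exact ⟨ε, h1, h2.1, h2.2⟩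
    have ha : 0 < 2 * (β + 1) + 5 * ε := by linarith
    set a := 2 * (β + 1) + 5 * ε with hadef
    have h1 := tendsto_rpow_mul_of_floor ha (f := fun K => (1 + ε) * ((2 * K + 1) * eigval β K)
      + exp (-(ε ^ 2 / 32 * (2 * K + 1))) * (96 * (2 * K + 1) ^ 2 + 4) + eigTail β K)
      (c := (1 + ε) * (2 * L) + 2 * L / (2 * β + 1)) (by
        have h2 := ((hcard.const_mul (1 + ε)).add (tendsto_rpow_mul_exp_mul_card_sq (2 * β + 1)
          (c := ε ^ 2 / 32) (by positivity))).add htail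
        rw [add_zero] at h2
        refine h2.congr fun K => ?_
        ring)
    have hrate : ∀ᶠ K : ℕ in atTop, waterRate β K + 2 * ε * (2 * K + 1) + 2 ≤ a * K := by
      have h3 : 2 * (β + 1) < 2 * (β + 1) + ε / 2 := by linarith
      filter_upwards [tendsto_waterRate_div.eventually_lt_const h3, eventually_gt_atTop 0,
        tendsto_natCast_atTop_atTop.eventually_ge_atTop ((2 * ε + 2) / (ε / 2))] with K hK hK0 hK1
      have hK' : (0 : ℝ) < K := by exact_mod_cast hK0
      rw [div_lt_iff₀ hK'] at hK
      rw [div_le_iff₀ (by positivity)] at hK1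
      rw [hadef]
      linarith
    filter_upwards [h1.eventually_lt_const hεc, (tendsto_floor_div ha).eventually hrate,
      eventually_ge_atTop 0] with R hR hR1 hR0
    refine lt_of_le_of_lt ?_ hR
    have hfl : a * (⌊R / a⌋₊ : ℝ) ≤ R := by
      have := Nat.floor_le (show 0 ≤ R / a by positivity)
      rwa [le_div_iff₀ ha, mul_comm] at this
    refine mul_le_mul_of_nonneg_left ((distortion_diagonal_le hβ hφ ht ⌊R / a⌋₊ hε0 hε1
      (hR1.trans hfl)).trans (le_of_eq ?_)) (rpow_nonneg hR0 _)
    ring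

end Diagonal

section Perturbation

lemma tendsto_rpow_mul_comp_mul {f : ℝ → ℝ} {p c u : ℝ} (hu : 0 < u)
    (h : Tendsto (fun R : ℝ => R ^ p * f R) atTop (nhds c)) :
    Tendsto (fun R : ℝ => R ^ p * f (u * R)) atTop (nhds (u ^ (-p) * c)) := by
  refine ((h.comp (tendsto_id.const_mul_atTop hu)).const_mul (u ^ (-p))).congr' ?_
  filter_upwards [eventually_ge_atTop 0] with R hR
  have h1 : u ^ (-p) * u ^ p = 1 := by rw [← rpow_add hu, neg_add_cancel, rpow_zero]
  simp only [Function.comp_apply, id]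
  rw [mul_rpow hu.le hR]
  linear_combination R ^ p * f (u * R) * h1

lemma exists_pos_mul_one_add_rpow (q c : ℝ) {s : Set ℝ} (hs : s ∈ nhds c) :
    ∃ η : ℝ, 0 < η ∧ (1 + η) ^ q * c ∈ s := by
  have h : ContinuousAt (fun η : ℝ => (1 + η) ^ q * c) 0 :=
    ContinuousAt.mul (ContinuousAt.rpow_const (by fun_prop) (Or.inl (by norm_num))) (by fun_prop)
  have h1 := h.tendsto.mono_left (nhdsWithin_le_nhds (s := Set.Ioi (0 : ℝ)))
  simp only [add_zero, one_rpow, one_mul] at h1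
  obtain ⟨η, h2, h3⟩ := ((h1.eventually hs).and self_mem_nhdsWithin).exists
  exact ⟨η, h3, h2⟩

/-- A perturbation of smaller order does not affect the asymptotics of the distortion. -/
lemma tendsto_rpow_mul_of_le_add {a b r : ℝ → ℝ} {p c : ℝ}
    (hb : ∀ ⦃R S η : ℝ⦄, 0 ≤ R → 0 ≤ S → 0 < η →
      b (R + S) ≤ (1 + η) * a R + (1 + 1 / η) * r S)
    (ha : ∀ ⦃R S η : ℝ⦄, 0 ≤ R → 0 ≤ S → 0 < η →
      a (R + S) ≤ (1 + η) * b R + (1 + 1 / η) * r S)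
    (hac : Tendsto (fun R : ℝ => R ^ p * a R) atTop (nhds c))
    (hr : Tendsto (fun R : ℝ => R ^ p * r R) atTop (nhds 0)) :
    Tendsto (fun R : ℝ => R ^ p * b R) atTop (nhds c) := by
  refine tendsto_order.2 ⟨fun c' hc' => ?_, fun c' hc' => ?_⟩
  · obtain ⟨η, hη, hηc⟩ := exists_pos_mul_one_add_rpow (-(1 + p)) c (Ioi_mem_nhds hc')
    have h1 := ((tendsto_rpow_mul_comp_mul (u := 1 + η) (by linarith) hac).sub
      ((tendsto_rpow_mul_comp_mul hη hr).const_mul (1 + 1 / η))).const_mul (1 + η)⁻¹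
    have h2 : (1 + η)⁻¹ * ((1 + η) ^ (-p) * c - (1 + 1 / η) * (η ^ (-p) * 0))
        = (1 + η) ^ (-(1 + p)) * c := by
      rw [neg_add, rpow_add (by linarith), rpow_neg_one]
      ring
    rw [h2] at h1
    filter_upwards [h1.eventually_const_lt hηc, eventually_ge_atTop 0] with R hR hR0
    refine hR.trans_le ?_
    have h3 := ha hR0 (mul_nonneg hη.le hR0) hη
    rw [show R + η * R = (1 + η) * R by ring] at h3
    rw [inv_mul_le_iff₀ (by linarith)]
    have h4 := mul_le_mul_of_nonneg_left h3 (rpow_nonneg hR0 p)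
    linarith
  · obtain ⟨η, hη, hηc⟩ := exists_pos_mul_one_add_rpow (1 + p) c (Iio_mem_nhds hc')
    have h1 := ((tendsto_rpow_mul_comp_mul (u := (1 + η)⁻¹) (by positivity) hac).const_mul
      (1 + η)).add ((tendsto_rpow_mul_comp_mul (u := η / (1 + η)) (by positivity) hr).const_mul
        (1 + 1 / η))
    have h2 : (1 + η) * ((1 + η)⁻¹ ^ (-p) * c) + (1 + 1 / η) * ((η / (1 + η)) ^ (-p) * 0)
        = (1 + η) ^ (1 + p) * c := by
      rw [inv_rpow (by linarith), rpow_neg (by linarith), inv_inv, rpow_add (by linarith),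
        rpow_one]
      ring
    rw [h2] at h1
    filter_upwards [h1.eventually_lt_const hηc, eventually_ge_atTop 0] with R hR hR0
    refine lt_of_le_of_lt ?_ hR
    have h3 := hb (R := (1 + η)⁻¹ * R) (S := η / (1 + η) * R) (by positivity) (by positivity) hη
    rw [show (1 + η)⁻¹ * R + η / (1 + η) * R = R by field_simp] at h3
    have h4 := mul_le_mul_of_nonneg_left h3 (rpow_nonneg hR0 p)
    linarith

end Perturbation

section Main

variable {β : ℝ}

lemma tendsto_distortion_rlKernel (hβ : 0 < β) :
    Tendsto (fun R : ℝ => R ^ (2 * β + 1) * distortion (noiseMeasure ℤ)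
      (gaussianSeries (bddKernel_rlKernel hβ).seq) R) atTop
      (nhds ((2 * (β + 1)) ^ (2 * β + 1) * (2 * (2 * π) ^ (-(2 * (β + 1)))
        + 2 * (2 * π) ^ (-(2 * (β + 1))) / (2 * β + 1)))) := by
  obtain ⟨φ, hφ, ht⟩ := exists_orthonormal_seq_perKernel hβ
  have hr := tendsto_distortion_remainder hβ
  have hsub : gaussianSeries ((bddKernel_perKernel hβ).sub (bddKernel_rlKernel hβ)).seq
      = gaussianSeries (bddKernel_perKernel hβ).seq
        - gaussianSeries (bddKernel_rlKernel hβ).seq := by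
    rw [BddKernel.seq_sub, map_sub]
  have hae := Lp.coeFn_sub (gaussianSeries (bddKernel_perKernel hβ).seq)
    (gaussianSeries (bddKernel_rlKernel hβ).seq)
  rw [← hsub] at hae
  have hX := memLp_gaussianSeries (bddKernel_perKernel hβ).seq
  have hY := memLp_gaussianSeries (bddKernel_rlKernel hβ).seq
  have hZ := memLp_gaussianSeries ((bddKernel_perKernel hβ).sub (bddKernel_rlKernel hβ)).seq
  refine tendsto_rpow_mul_of_le_add (fun R S η hR hS hη => ?_) (fun R S η hR hS hη => ?_)
    (tendsto_distortion_diagonal hβ hφ ht) hr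
  · refine le_trans (le_of_eq ?_) ((distortion_add_le hX hZ.neg hR hS hη).trans ?_)
    · refine distortion_congr_ae ?_ _
      filter_upwards [hae] with ω hω
      rw [Pi.neg_apply, hω, Pi.sub_apply]
      abel
    · gcongr
      exact distortion_neg S
  · refine le_trans (le_of_eq ?_) (distortion_add_le hY hZ hR hS hη)
    refine distortion_congr_ae ?_ _
    filter_upwards [hae] with ω hω
    rw [hω, Pi.sub_apply]
    abel

lemma rate_constant_eq (hβ : 0 < β) {x : ℝ} (hx : 0 ≤ x) :
    (π ^ (-(β + 1)) * (β + 1) ^ (β + 1 / 2) * ((2 * β + 2) / (2 * β + 1)) ^ (1 / 2 : ℝ)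
        * x ^ (-(β + 1 / 2))) ^ 2
      = (2 * (β + 1)) ^ (2 * β + 1) * (2 * (2 * π) ^ (-(2 * (β + 1)))
        + 2 * (2 * π) ^ (-(2 * (β + 1))) / (2 * β + 1)) * (x ^ (2 * β + 1))⁻¹ := by
  have hsq : ∀ {y : ℝ} (_ : 0 ≤ y) (q : ℝ), (y ^ q) ^ 2 = y ^ (2 * q) := fun hy q => by
    rw [← rpow_natCast, ← rpow_mul hy]
    congr 1
    push_cast
    ring
  have hα : 0 < β + 1 := by linarith
  have h1 : 0 < 2 * β + 1 := by linarith
  rw [mul_pow, mul_pow, mul_pow, hsq pi_pos.le, hsq hα.le, hsq (by positivity), hsq hx,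
    mul_one_div_cancel two_ne_zero, rpow_one, mul_rpow two_pos.le hα.le,
    mul_rpow two_pos.le pi_pos.le, ← rpow_neg hx,
    show 2 * (β + 1 / 2) = 2 * β + 1 by ring, show 2 * -(β + 1) = -(2 * (β + 1)) by ring,
    show 2 * -(β + 1 / 2) = -(2 * β + 1) by ring]
  have h2 : (2 : ℝ) ^ (2 * β + 1) * (2 : ℝ) ^ (-(2 * (β + 1))) = 1 / 2 := by
    rw [← rpow_add two_pos, show 2 * β + 1 + -(2 * (β + 1)) = -1 by ring, rpow_neg_one, one_div]
  have h3 : (2 * β + 2) / (2 * β + 1) = 1 + 1 / (2 * β + 1) := by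
    field_simp
    ring
  rw [h3]
  linear_combination -2 * (β + 1) ^ (2 * β + 1) * π ^ (-(2 * (β + 1)))
    * (1 + 1 / (2 * β + 1)) * x ^ (-(2 * β + 1)) * h2

end Main

end FracBM

/-- High-resolution quantization formula for the fractionally integrated Brownian motion:
`e_n(Y^β) ~ π^{-(β+1)} (β+1)^{β+1/2} ((2β+2)/(2β+1))^{1/2} (log n)^{-(β+1/2)}`. -/
theorem fractionally_integrated_bm_quantization
    (β : ℝ) (hβ : 0 < β)
    {Ω : Type*} [MeasurableSpace Ω] (P : Measure Ω) [IsProbabilityMeasure P]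
    (Y : Ω → Lp ℝ 2 μ01)
    (hYmeas : AEStronglyMeasurable Y P)
    (hYint : Integrable (fun ω => ‖Y ω‖ ^ 2) P)
    -- `Y` is a centered Gaussian random vector in `L²([0,1],dt)` ...
    (hGauss : ∀ f : Lp ℝ 2 μ01, ∃ v : ℝ≥0,
      Measure.map (fun ω => ⟪f, Y ω⟫) P = gaussianReal 0 v)
    -- ... whose covariance is that of the fractionally integrated Brownian motion `Y^β`
    (hcov : ∀ f g : Lp ℝ 2 μ01,
      (∫ ω, ⟪f, Y ω⟫ * ⟪g, Y ω⟫ ∂P)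
        = ∫ s in (0:ℝ)..1, (∫ t in (0:ℝ)..1, f s * fibmKernel β s t * g t)) :
    Tendsto (fun n : ℕ =>
        quantErr P Y n /
          (Real.pi ^ (-(β + 1)) * (β + 1) ^ (β + 1/2) *
            ((2*β + 2)/(2*β + 1)) ^ (1/2 : ℝ) * (Real.log n) ^ (-(β + 1/2))))
      atTop (nhds 1) := by
  have hlog : Tendsto (fun n : ℕ => log n) atTop atTop :=
    tendsto_log_atTop.comp tendsto_natCast_atTop_atTop
  set C := (2 * (β + 1)) ^ (2 * β + 1) * (2 * (2 * π) ^ (-(2 * (β + 1)))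
    + 2 * (2 * π) ^ (-(2 * (β + 1))) / (2 * β + 1)) with hC
  have hC0 : 0 < C := by positivity
  have h1 := (((FracBM.tendsto_distortion_rlKernel hβ).comp hlog).div_const C).sqrt
  rw [← hC, div_self hC0.ne', Real.sqrt_one] at h1
  refine h1.congr' ?_
  filter_upwards [eventually_ge_atTop 1, hlog.eventually_gt_atTop 0] with n hn hn0
  set D := Real.pi ^ (-(β + 1)) * (β + 1) ^ (β + 1/2) *
    ((2*β + 2)/(2*β + 1)) ^ (1/2 : ℝ) * (Real.log n) ^ (-(β + 1/2)) with hD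
  have hD0 : 0 ≤ D := by positivity
  have hD2 : D ^ 2 = C * (log n ^ (2 * β + 1))⁻¹ := FracBM.rate_constant_eq hβ hn0.le
  rw [FracBM.quantErr_eq_sqrt_distortion hn,
    FracBM.distortion_eq_gaussianSeries hβ hYmeas hGauss hcov, ← Real.sqrt_sq hD0,
    ← Real.sqrt_div' _ (sq_nonneg D), hD2]
  congr 1
  simp only [Function.comp_apply]
  have : 0 < log (n : ℝ) ^ (2 * β + 1) := by positivity
  field_simp
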